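/- Suppose a ∈ X^k is a universal center. Then for every open connected set U ⊆ ℂ^k containing the polynomially convex hull of Γ_k, the path A_k is a loop (A_k(0)=A_k(T)=0) and, regarded as a loop in U, it is homotopic in U to the constant loop at 0 (it represents the unit element of π₁(U)). -/

import Mathlib

open MeasureTheory

noncomputable section

/-- The class `X`: sequences `a = (a₁, a₂, …)` of bounded measurable functions on `[0,T]`
with `sup_{x,i} |aᵢ(x)|^{1/i} < ∞` (equivalently `‖aᵢ(x)‖ ≤ Cⁱ` for some `C`).
We index by `ℕ`, using only indices `i ≥ 1`. -/
def MemX (T : ℝ) (a : ℕ → ℝ → ℂ) : Prop :=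
  (∀ i, Measurable (a i)) ∧
    ∃ C : ℝ, ∀ i : ℕ, 1 ≤ i → ∀ x ∈ Set.Icc (0 : ℝ) T, ‖a i x‖ ≤ C ^ i

/-- Auxiliary iterated integral: for the multi-index list `[j₁, …, jₖ]` (outermost first),
`itIntAux a [j₁,…,jₖ] x = ∫_{0 ≤ s_k ≤ … ≤ s_1 ≤ x} a_{j₁}(s₁)⋯a_{jₖ}(sₖ) ds`. -/
def itIntAux (a : ℕ → ℝ → ℂ) : List ℕ → ℝ → ℂ
  | [], _ => 1
  | i :: l, x => ∫ s in (0 : ℝ)..x, a i s * itIntAux a l s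

/-- The basic iterated integral `I_{i₁,…,iₖ}(a)` over `0 ≤ s₁ ≤ ⋯ ≤ sₖ ≤ T`,
with the multi-index encoded as the list `[i₁, …, iₖ]` (so the empty list gives `1`). -/
def itInt (T : ℝ) (a : ℕ → ℝ → ℂ) (l : List ℕ) : ℂ :=
  itIntAux a l.reverse T

/-- `a` is a universal center: every basic iterated integral of positive order vanishes
at `a`. -/
def IsUnivCenter (T : ℝ) (a : ℕ → ℝ → ℂ) : Prop :=
  ∀ l : List ℕ, l ≠ [] → (∀ i ∈ l, 1 ≤ i) → itInt T a l = 0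

/-- The Lipschitz path `A_k : [0,T] → ℂᵏ`, `A_k(x) = (∫₀ˣ a₁, …, ∫₀ˣ a_k)`. -/
def pathA (T : ℝ) (a : ℕ → ℝ → ℂ) (k : ℕ) : ℝ → (Fin k → ℂ) := fun x j =>
  ∫ t in (0 : ℝ)..x, a (j.1 + 1) t

/-- The polynomially convex hull of a set `K ⊆ ℂᵏ`: all `z` such that
`|p(z)| ≤ max_{w ∈ K} |p(w)|` for every holomorphic polynomial `p` in `k` variables. -/
def polyHull {k : ℕ} (K : Set (Fin k → ℂ)) : Set (Fin k → ℂ) :=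
  {z | ∀ p : MvPolynomial (Fin k) ℂ, ∀ M : ℝ,
    (∀ w ∈ K, ‖MvPolynomial.eval w p‖ ≤ M) → ‖MvPolynomial.eval z p‖ ≤ M}


namespace UC
open Set Filter Topology Metric

section toolkit
variable {E F : Type*} [NormedAddCommGroup E] [NormedSpace ℂ E]
  [NormedAddCommGroup F] [NormedSpace ℂ F]

lemma cauchy_fderiv {f : E → F} {z : E} {r M : ℝ} (hr : 0 < r)
    (hf : ∀ w ∈ ball z r, DifferentiableAt ℂ f w) (hM : ∀ w ∈ ball z r, ‖f w‖ ≤ M) :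
    ‖fderiv ℂ f z‖ ≤ 2 * M / r := by
  refine Complex.norm_fderiv_le_div_of_mapsTo_ball
    (fun w hw => (hf w hw).differentiableWithinAt) ?_ hr
  intro w hw
  rw [mem_closedBall, dist_eq_norm]
  have h1 := hM w hw
  have h2 := hM z (mem_ball_self hr)
  calc _ ≤ ‖f w‖ + ‖f z‖ := norm_sub_le _ _
    _ ≤ 2 * M := by linarith

/-- uniform limits of holomorphic maps -/
lemma differentiableAt_of_uniform_limit [CompleteSpace F] {W : Set E} (hW : IsOpen W)
    {f : ℕ → E → F} {g : E → F} (hf : ∀ n, ∀ z ∈ W, DifferentiableAt ℂ (f n) z)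
    (hfg : TendstoUniformlyOn f g atTop W) {z : E} (hz : z ∈ W) : DifferentiableAt ℂ g z := by
  obtain ⟨r, hr, hrW⟩ := Metric.isOpen_iff.1 hW z hz
  have hr2 : 0 < r / 2 := by linarith
  have hsub : ∀ w ∈ ball z (r/2), ball w (r/2) ⊆ W := by
    intro w hw
    refine (ball_subset_ball' ?_).trans hrW
    rw [mem_ball] at hw; linarith
  have hC : UniformCauchySeqOn (fun n w => fderiv ℂ (f n) w) atTop (ball z (r/2)) := by
    rw [Metric.uniformCauchySeqOn_iff]
    intro ε hε
    have h1 := hfg.uniformCauchySeqOn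
    rw [Metric.uniformCauchySeqOn_iff] at h1
    obtain ⟨N, hN⟩ := h1 (ε * (r/2) / 4) (by positivity)
    refine ⟨N, fun m hm n hn w hw => ?_⟩
    have hd : ∀ k, DifferentiableAt ℂ (f k) w := fun k =>
      hf k w (hsub w hw (mem_ball_self hr2))
    rw [dist_eq_norm, ← fderiv_sub (hd m) (hd n)]
    have := cauchy_fderiv (f := f m - f n) (z := w) (M := ε * (r/2) / 4) hr2
      (fun v hv => (hf m v (hsub w hw hv)).sub (hf n v (hsub w hw hv)))
      (fun v hv => by
        have := hN m hm n hn v (hsub w hw hv)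
        rw [dist_eq_norm] at this
        exact this.le)
    refine this.trans_lt ?_
    rw [show 2 * (ε * (r/2) / 4) / (r/2) = ε / 2 by field_simp; ring]
    linarith
  have hlim : ∀ w ∈ ball z (r/2), ∃ L, Tendsto (fun n => fderiv ℂ (f n) w) atTop (𝓝 L) := by
    intro w hw
    exact cauchySeq_tendsto_of_complete (hC.cauchySeq hw)
  choose! g' hg' using hlim
  have hU := hC.tendstoUniformlyOn_of_tendsto hg'
  have := hasFDerivAt_of_tendstoUniformlyOn (f := f) (g := g) (f' := fun n w => fderiv ℂ (f n) w)
    isOpen_ball hU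
    (fun n w hw => (hf n w (hsub w hw (mem_ball_self hr2))).hasFDerivAt)
    (fun w hw => hfg.tendsto_at (hsub w hw (mem_ball_self hr2))) (mem_ball_self hr2)
  exact this.differentiableAt

lemma aesm_clm [FiniteDimensional ℂ E] {X : Type*} [MeasurableSpace X] {μ : Measure X}
    {L : X → E →L[ℂ] F} (h : ∀ v, AEStronglyMeasurable (fun x => L x v) μ) :
    AEStronglyMeasurable L μ := by
  let b := Module.finBasis ℂ E
  have : L = fun x => ∑ i, (LinearMap.toContinuousLinearMap (b.coord i)).smulRight (L x (b i)) := by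
    funext x
    ext v
    conv_lhs => rw [← b.sum_repr v]
    simp only [map_sum, map_smul, ContinuousLinearMap.sum_apply,
      ContinuousLinearMap.smulRight_apply]
    rfl
  rw [this]
  refine Finset.aestronglyMeasurable_fun_sum _ fun i _ => ?_
  exact ((ContinuousLinearMap.smulRightL ℂ E F
    (LinearMap.toContinuousLinearMap (b.coord i))).continuous.comp_aestronglyMeasurable (h (b i)))

/-- parametric integrals -/
lemma param_integral [FiniteDimensional ℂ E] [CompleteSpace F] {X : Type*} [MeasurableSpace X] {μ : Measure X}
    [IsFiniteMeasure μ] {f : X → E → F} {u : E} {r M : ℝ} (hr : 0 < r)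
    (hm : ∀ w ∈ ball u r, AEStronglyMeasurable (fun x => f x w) μ)
    (hd : ∀ᵐ x ∂μ, ∀ w ∈ ball u r, DifferentiableAt ℂ (f x) w)
    (hM : ∀ᵐ x ∂μ, ∀ w ∈ ball u r, ‖f x w‖ ≤ M) :
    DifferentiableAt ℂ (fun w => ∫ x, f x w ∂μ) u := by
  have hr2 : 0 < r / 2 := by linarith
  have hsub : ∀ w ∈ ball u (r/2), ball w (r/2) ⊆ ball u r := by
    intro w hw
    refine (ball_subset_ball' ?_)
    rw [mem_ball] at hw; linarith
  have hu : u ∈ ball u r := mem_ball_self hr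
  refine (hasFDerivAt_integral_of_dominated_of_fderiv_le (F := fun w x => f x w)
    (F' := fun w x => fderiv ℂ (f x) w) (bound := fun _ => 2 * M / (r/2)) (ball_mem_nhds u hr2)
    ?_ ?_ ?_ ?_ ?_ ?_).differentiableAt
  · filter_upwards [ball_mem_nhds u hr] with w hw using hm w hw
  · refine Integrable.of_bound (hm u hu) M ?_
    filter_upwards [hM] with x hx using hx u hu
  · refine aesm_clm fun v => ?_
    have hc : Tendsto (fun n : ℕ => ‖(n : ℂ)‖) atTop atTop := by
      simpa using tendsto_natCast_atTop_atTop (R := ℝ)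
    have hin : ∀ᶠ n : ℕ in atTop, u + (n : ℂ)⁻¹ • v ∈ ball u r := by
      have : Tendsto (fun n : ℕ => u + (n : ℂ)⁻¹ • v) atTop (𝓝 (u + (0 : ℂ) • v)) := by
        refine tendsto_const_nhds.add (Tendsto.smul ?_ tendsto_const_nhds)
        exact tendsto_inv_atTop_nhds_zero_nat (𝕜 := ℂ)
      rw [zero_smul, add_zero] at this
      exact this (ball_mem_nhds u hr)
    obtain ⟨N, hN⟩ := eventually_atTop.1 hin
    refine aestronglyMeasurable_of_tendsto_ae (u := atTop) (f := fun (n : ℕ) x =>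
      ((n + N : ℕ) : ℂ) • (f x (u + ((n + N : ℕ) : ℂ)⁻¹ • v) - f x u)) ?_ ?_
    · intro n
      exact ((hm _ (hN _ (by omega))).sub (hm u hu)).const_smul _
    · filter_upwards [hd] with x hx
      have := (hx u hu).hasFDerivAt.lim v hc
      exact this.comp (tendsto_add_atTop_nat N)
  · filter_upwards [hM, hd] with x hx hdx w hw
    exact cauchy_fderiv hr2 (fun v hv => hdx v (hsub w hw hv)) (fun v hv => hx v (hsub w hw hv))
  · exact integrable_const _
  · filter_upwards [hd] with x hx w hw
    exact (hx w (hsub w hw (mem_ball_self hr2))).hasFDerivAt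

end toolkit
end UC

namespace UC
open Set Filter Topology Metric

section toolkit2
variable {E F : Type*} [NormedAddCommGroup E] [NormedSpace ℂ E]
  [NormedAddCommGroup F] [NormedSpace ℂ F]

lemma dslope_diff_same [FiniteDimensional ℂ E] [CompleteSpace F] {h : ℂ × E → F} {w0 : ℂ} {r0 : E}
    (h0 : ∀ᶠ p in 𝓝 (w0, r0), DifferentiableAt ℂ h p) :
    DifferentiableAt ℂ (fun p : ℂ × E => dslope (fun w => h (w, p.2)) w0 p.1) (w0, r0) := by
  have : ProperSpace (ℂ × E) := FiniteDimensional.proper ℂ _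
  obtain ⟨ε, hε, hball⟩ := Metric.eventually_nhds_iff_ball.1 h0
  set ρ := ε / 3 with hρ
  have hρ0 : 0 < ρ := by positivity
  have hin : ∀ w ∈ closedBall w0 (2 * ρ), ∀ r ∈ ball r0 (2*ρ), (w, r) ∈ closedBall (w0, r0) (2 * ρ) := by
    intro w hw r hr
    rw [← closedBall_prod_same]
    exact ⟨hw, ball_subset_closedBall hr⟩
  have hcb : closedBall (w0, r0) (2 * ρ) ⊆ ball (w0, r0) ε :=
    closedBall_subset_ball (by rw [hρ]; linarith)
  have hdiff : ∀ p ∈ closedBall (w0, r0) (2 * ρ), DifferentiableAt ℂ h p := fun p hp => hball p (hcb hp)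
  obtain ⟨M, hM⟩ := (isCompact_closedBall (w0, r0) (2 * ρ)).exists_bound_of_continuousOn
    (f := h) (fun p hp => (hdiff p hp).continuousAt.continuousWithinAt)
  have hsl : ∀ r ∈ ball r0 (2 * ρ), ∀ w ∈ closedBall w0 (2 * ρ), DifferentiableAt ℂ (fun w => h (w, r)) w := by
    intro r hr w hw
    have h1 := hdiff _ (hin w hw r hr)
    have h2 : DifferentiableAt ℂ (fun w : ℂ => (w, r)) w := by fun_prop
    exact DifferentiableAt.comp (g := h) (f := fun w : ℂ => (w, r)) w h1 h2
  have hcirc : ∀ θ : ℝ, circleMap w0 (2 * ρ) θ ∈ closedBall w0 (2 * ρ) := fun θ =>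
    circleMap_mem_closedBall _ (by positivity) _
  have hw0 : w0 ∈ closedBall w0 (2 * ρ) := mem_closedBall_self (by positivity)
  have key : ∀ p ∈ ball (w0, r0) ρ, dslope (fun w => h (w, p.2)) w0 p.1 =
      (2 * Real.pi * Complex.I : ℂ)⁻¹ • ∫ θ in Ioc 0 (2 * Real.pi), deriv (circleMap w0 (2 * ρ)) θ •
        ((circleMap w0 (2 * ρ) θ - p.1)⁻¹ • ((circleMap w0 (2 * ρ) θ - w0)⁻¹ •
          (h (circleMap w0 (2 * ρ) θ, p.2) - h (w0, p.2)))) := by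
    intro p hp
    rw [← ball_prod_same] at hp
    have hp2 : p.2 ∈ ball r0 (2 * ρ) := ball_subset_ball (by linarith) hp.2
    have hp1 : p.1 ∈ ball w0 (2 * ρ) := ball_subset_ball (by linarith) hp.1
    have hD : DifferentiableOn ℂ (dslope (fun w => h (w, p.2)) w0) (closedBall w0 (2 * ρ)) := by
      rw [Complex.differentiableOn_dslope (closedBall_mem_nhds _ (by positivity))]
      exact fun w hw => (hsl _ hp2 w hw).differentiableWithinAt
    have hc := hD.circleIntegral_sub_inv_smul hp1
    rw [circleIntegral, intervalIntegral.integral_of_le (by positivity)] at hc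
    rw [eq_inv_smul_iff₀ (by simp [Real.pi_ne_zero]), ← hc]
    refine setIntegral_congr_fun measurableSet_Ioc fun θ _ => ?_
    have : circleMap w0 (2 * ρ) θ ≠ w0 := circleMap_ne_center (by positivity)
    simp only [dslope_of_ne _ this, slope_def_module]
  have hPI : DifferentiableAt ℂ (fun p : ℂ × E => ∫ θ in Ioc 0 (2 * Real.pi), deriv (circleMap w0 (2 * ρ)) θ •
        ((circleMap w0 (2 * ρ) θ - p.1)⁻¹ • ((circleMap w0 (2 * ρ) θ - w0)⁻¹ •
          (h (circleMap w0 (2 * ρ) θ, p.2) - h (w0, p.2))))) (w0, r0) := by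
    have hne : ∀ θ : ℝ, ∀ p ∈ ball (w0, r0) ρ, ρ ≤ ‖circleMap w0 (2 * ρ) θ - p.1‖ := by
      intro θ p hp
      rw [← ball_prod_same] at hp
      have h1 : ‖circleMap w0 (2 * ρ) θ - w0‖ = 2 * ρ := by
        simp [circleMap, abs_of_pos hρ0]
      have h2 := hp.1
      rw [mem_ball, dist_eq_norm] at h2
      have := norm_sub_norm_le (circleMap w0 (2 * ρ) θ - w0) (p.1 - w0)
      rw [sub_sub_sub_cancel_right] at this
      linarith
    refine param_integral (r := ρ) (M := (2 * ρ) * (ρ⁻¹ * ((2*ρ)⁻¹ * (M + M)))) hρ0 ?_ ?_ ?_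
    · intro p hp
      have hne' := fun θ => hne θ p hp
      rw [← ball_prod_same] at hp
      have hp2 : p.2 ∈ ball r0 (2 * ρ) := ball_subset_ball (by linarith) hp.2
      refine Continuous.aestronglyMeasurable ?_
      have e1 : Continuous (fun θ => deriv (circleMap w0 (2 * ρ)) θ) := by
        simp only [deriv_circleMap]; fun_prop
      have e2 : Continuous (fun θ => (circleMap w0 (2 * ρ) θ - p.1)⁻¹) := by
        refine ((continuous_circleMap _ _).sub continuous_const).inv₀ fun θ => ?_
        exact norm_pos_iff.1 (hρ0.trans_le (hne' θ))
      have e3 : Continuous (fun θ => (circleMap w0 (2 * ρ) θ - w0)⁻¹) := by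
        refine ((continuous_circleMap _ _).sub continuous_const).inv₀ fun θ => ?_
        exact sub_ne_zero.2 (circleMap_ne_center (by positivity))
      have e4 : Continuous (fun θ => h (circleMap w0 (2 * ρ) θ, p.2)) := by
        refine continuous_iff_continuousAt.2 fun θ => ?_
        have := (hsl _ hp2 _ (hcirc θ)).continuousAt
        exact ContinuousAt.comp (g := fun w => h (w, p.2)) this (continuous_circleMap _ _).continuousAt
      exact e1.smul (e2.smul (e3.smul (e4.sub continuous_const)))
    · refine ae_of_all _ fun θ p hp => ?_
      have hne' := norm_pos_iff.1 (hρ0.trans_le (hne θ p hp))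
      rw [← ball_prod_same] at hp
      have hp2 : p.2 ∈ ball r0 (2 * ρ) := ball_subset_ball (by linarith) hp.2
      have d1 : DifferentiableAt ℂ (fun p : ℂ × E => h (circleMap w0 (2 * ρ) θ, p.2)) p :=
        DifferentiableAt.comp (g := h) (f := fun p : ℂ × E => (circleMap w0 (2 * ρ) θ, p.2)) p
          (hdiff _ (hin _ (hcirc θ) _ hp2)) (by fun_prop)
      have d2 : DifferentiableAt ℂ (fun p : ℂ × E => h (w0, p.2)) p :=
        DifferentiableAt.comp (g := h) (f := fun p : ℂ × E => (w0, p.2)) p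
          (hdiff _ (hin _ hw0 _ hp2)) (by fun_prop)
      have d3 : DifferentiableAt ℂ (fun p : ℂ × E => (circleMap w0 (2 * ρ) θ - p.1)⁻¹) p :=
        DifferentiableAt.inv (by fun_prop) hne'
      exact (d3.smul ((d1.sub d2).const_smul _)).const_smul _
    · refine ae_of_all _ fun θ p hp => ?_
      have hne' := hne θ p hp
      rw [← ball_prod_same] at hp
      have hp2 : p.2 ∈ ball r0 (2 * ρ) := ball_subset_ball (by linarith) hp.2
      rw [norm_smul, norm_smul, norm_smul, norm_inv, norm_inv]
      have h1 : ‖circleMap w0 (2 * ρ) θ - w0‖ = 2 * ρ := by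
        simp [circleMap, abs_of_pos hρ0]
      have h2 : ‖deriv (circleMap w0 (2 * ρ)) θ‖ = 2 * ρ := by
        simp [abs_of_pos hρ0]
      rw [h1, h2]
      have h3 : ‖h (circleMap w0 (2 * ρ) θ, p.2) - h (w0, p.2)‖ ≤ M + M :=
        (norm_sub_le _ _).trans (add_le_add (hM _ (hin _ (hcirc θ) _ hp2)) (hM _ (hin _ hw0 _ hp2)))
      gcongr
  refine (hPI.const_smul (2 * Real.pi * Complex.I : ℂ)⁻¹).congr_of_eventuallyEq ?_
  filter_upwards [ball_mem_nhds (w0, r0) hρ0] with p hp using key p hp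

lemma dslope_diff [FiniteDimensional ℂ E] [CompleteSpace F] {h : ℂ × E → F} {w0 w1 : ℂ} {r0 : E}
    (h0 : ∀ᶠ p in 𝓝 (w0, r0), DifferentiableAt ℂ h p) (h1 : DifferentiableAt ℂ h (w1, r0)) :
    DifferentiableAt ℂ (fun p : ℂ × E => dslope (fun w => h (w, p.2)) w0 p.1) (w1, r0) := by
  rcases eq_or_ne w1 w0 with rfl | hne
  · exact dslope_diff_same h0
  have : (fun p : ℂ × E => dslope (fun w => h (w, p.2)) w0 p.1) =ᶠ[𝓝 (w1, r0)]
      fun p => (p.1 - w0)⁻¹ • (h p - h (w0, p.2)) := by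
    have : ∀ᶠ p in 𝓝 (w1, r0), p.1 ≠ w0 :=
      (continuous_fst.continuousAt (x := (w1, r0))).eventually_ne hne
    filter_upwards [this] with p hp
    rw [dslope_of_ne _ hp, slope_def_module]
  refine DifferentiableAt.congr_of_eventuallyEq ?_ this
  have d2 : DifferentiableAt ℂ (fun p : ℂ × E => h (w0, p.2)) (w1, r0) :=
    DifferentiableAt.comp (g := h) (f := fun p : ℂ × E => (w0, p.2)) _
      h0.self_of_nhds (by fun_prop)
  have d3 : DifferentiableAt ℂ (fun p : ℂ × E => (p.1 - w0)⁻¹) (w1, r0) :=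
    DifferentiableAt.inv (by fun_prop) (sub_ne_zero.2 hne)
  exact d3.smul (h1.sub d2)

lemma clm_diff [FiniteDimensional ℂ E] {G : Type*} [NormedAddCommGroup G] [NormedSpace ℂ G]
    {L : G → E →L[ℂ] F} {z : G} (h : ∀ v, DifferentiableAt ℂ (fun x => L x v) z) :
    DifferentiableAt ℂ L z := by
  let b := Module.finBasis ℂ E
  have : L = fun x => ∑ i, (ContinuousLinearMap.smulRightL ℂ E F
    (LinearMap.toContinuousLinearMap (b.coord i))) (L x (b i)) := by
    funext x
    ext v
    conv_lhs => rw [← b.sum_repr v]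
    simp only [map_sum, map_smul, sum_apply]
    rfl
  rw [this]
  refine DifferentiableAt.fun_sum fun i _ => ?_
  exact (ContinuousLinearMap.differentiableAt _).comp z (h (b i))

lemma fderiv_diff [FiniteDimensional ℂ E] [CompleteSpace F] {f : E → F} {z : E}
    (h : ∀ᶠ w in 𝓝 z, DifferentiableAt ℂ f w) : DifferentiableAt ℂ (fderiv ℂ f) z := by
  refine clm_diff fun v => ?_
  have key : ∀ᶠ w in 𝓝 z, fderiv ℂ f w v = dslope (fun l : ℂ => f (w + l • v)) 0 0 := by
    filter_upwards [h] with w hw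
    rw [dslope_same]
    have h1 : HasFDerivAt f (fderiv ℂ f w) (w + (0:ℂ) • v) := by simpa using hw.hasFDerivAt
    have h2 : HasDerivAt (fun l : ℂ => w + l • v) v 0 := by
      simpa using ((hasDerivAt_id (0:ℂ)).smul_const v).const_add w
    exact (h1.comp_hasDerivAt (0:ℂ) h2).deriv.symm
  refine DifferentiableAt.congr_of_eventuallyEq ?_ key
  have hc : Tendsto (fun p : ℂ × E => p.2 + p.1 • v) (𝓝 (0, z)) (𝓝 z) := by
    have : Continuous (fun p : ℂ × E => p.2 + p.1 • v) := by fun_prop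
    simpa using this.tendsto (0, z)
  have := dslope_diff_same (h := fun p : ℂ × E => f (p.2 + p.1 • v)) (w0 := 0) (r0 := z) (by
    filter_upwards [hc.eventually h] with p hp
    exact DifferentiableAt.comp (g := f) (f := fun p : ℂ × E => p.2 + p.1 • v) p hp (by fun_prop))
  exact DifferentiableAt.comp (f := fun w : E => ((0 : ℂ), w)) z this (by fun_prop)

lemma hol_contDiff {E F : Type} [NormedAddCommGroup E] [NormedSpace ℂ E]
    [NormedAddCommGroup F] [NormedSpace ℂ F] [FiniteDimensional ℂ E] [CompleteSpace F] {f : E → F} {W : Set E} (hW : IsOpen W)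
    (h : ∀ w ∈ W, DifferentiableAt ℂ f w) (n : ℕ) : ContDiffOn ℂ n f W := by
  induction n generalizing F with
  | zero =>
    exact contDiffOn_zero.2 fun w hw => (h w hw).continuousAt.continuousWithinAt
  | succ n ih =>
    rw [show ((n+1 : ℕ) : WithTop ℕ∞) = n + 1 by push_cast; rfl, contDiffOn_succ_iff_fderiv_of_isOpen hW]
    refine ⟨fun w hw => (h w hw).differentiableWithinAt, by simp, ?_⟩
    exact ih (fun w hw => fderiv_diff (by filter_upwards [hW.mem_nhds hw] with x hx using h x hx))

end toolkit2
end UC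

namespace UC
open Set Filter Topology Metric

/-- the point of the plane with given coordinates -/
def zt (p : ℝ × ℝ) : ℂ := ⟨p.1, p.2⟩

lemma continuous_zt : Continuous zt := by
  have : zt = fun p : ℝ × ℝ => (p.1 : ℂ) + p.2 * Complex.I := by
    funext p; apply Complex.ext <;> simp [zt]
  rw [this]; fun_prop

def phi0 (t : ℝ) : ℝ := (Ioc (0:ℝ) 1).indicator (fun t => t ^ (-(1/2) : ℝ)) t
def phi1 (t : ℝ) : ℝ := phi0 t + phi0 (-t)

lemma phi1_int : Integrable phi1 := by
  have h0 : Integrable phi0 := by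
    have := intervalIntegral.intervalIntegrable_rpow' (a := 0) (b := 1) (r := -(1/2)) (by norm_num)
    rw [intervalIntegrable_iff_integrableOn_Ioc_of_le zero_le_one] at this
    exact (integrable_indicator_iff measurableSet_Ioc).2 this
  exact h0.add h0.comp_neg

lemma phi0_nonneg (t : ℝ) : 0 ≤ phi0 t := by
  unfold phi0
  refine indicator_nonneg (fun t ht => ?_) t
  exact Real.rpow_nonneg ht.1.le _

lemma phi1_nonneg (t : ℝ) : 0 ≤ phi1 t := add_nonneg (phi0_nonneg _) (phi0_nonneg _)

lemma phi1_lower {t : ℝ} (ht : t ≠ 0) (ht1 : |t| ≤ 1) : |t| ^ (-(1/2) : ℝ) ≤ phi1 t := by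
  rcases lt_or_gt_of_ne ht with h | h
  · have : phi0 (-t) = |t| ^ (-(1/2) : ℝ) := by
      rw [abs_of_neg h] at *
      unfold phi0; rw [indicator_of_mem]; constructor <;> linarith
    unfold phi1; have := phi0_nonneg t; linarith
  · have : phi0 t = |t| ^ (-(1/2) : ℝ) := by
      rw [abs_of_pos h] at *
      unfold phi0; rw [indicator_of_mem]; constructor <;> linarith
    unfold phi1; have := phi0_nonneg (-t); linarith

lemma inv_norm_le {w : ℂ} (h1 : w.re ≠ 0) (h2 : w.im ≠ 0) : ‖w‖⁻¹ ≤ phi1 w.re * phi1 w.im + 1 := by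
  have hw : 0 < ‖w‖ := by
    rw [norm_pos_iff]; intro h; simp [h] at h1
  by_cases h : 1 ≤ ‖w‖
  · have := inv_le_one_of_one_le₀ h
    have := mul_nonneg (phi1_nonneg w.re) (phi1_nonneg w.im)
    linarith
  push Not at h
  have a1 := (Complex.abs_re_le_norm w)
  have a2 := (Complex.abs_im_le_norm w)
  have b1 : 0 < |w.re| := abs_pos.2 h1
  have b2 : 0 < |w.im| := abs_pos.2 h2
  have e1 := phi1_lower h1 (a1.trans h.le)
  have e2 := phi1_lower h2 (a2.trans h.le)
  have : ‖w‖⁻¹ ≤ |w.re| ^ (-(1/2) : ℝ) * |w.im| ^ (-(1/2) : ℝ) := by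
    rw [← Real.mul_rpow b1.le b2.le, Real.rpow_neg (by positivity)]
    refine inv_anti₀ (Real.rpow_pos_of_pos (by positivity) _) ?_
    rw [← Real.sqrt_eq_rpow, Real.sqrt_le_left hw.le]
    nlinarith
  have := mul_le_mul e1 e2 (Real.rpow_nonneg b2.le _) (phi1_nonneg _)
  linarith

lemma ae_ne (z : ℂ) : ∀ᵐ p : ℝ × ℝ, p.1 ≠ z.re ∧ p.2 ≠ z.im := by
  have h1 : ∀ᵐ p : ℝ × ℝ, p.1 ≠ z.re :=
    (Measure.quasiMeasurePreserving_fst (μ := (volume : Measure ℝ)) (ν := (volume : Measure ℝ))).ae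
      (Measure.ae_ne volume z.re)
  have h2 : ∀ᵐ p : ℝ × ℝ, p.2 ≠ z.im :=
    (Measure.quasiMeasurePreserving_snd (μ := (volume : Measure ℝ)) (ν := (volume : Measure ℝ))).ae
      (Measure.ae_ne volume z.im)
  exact h1.and h2

lemma ae_ne' (S : Set (ℝ × ℝ)) (z : ℂ) : ∀ᵐ p ∂(volume.restrict S), zt p ≠ z := by
  refine ae_restrict_of_ae ?_
  filter_upwards [ae_ne z] with p hp h
  exact hp.1 (by rw [← h]; rfl)

lemma phi_prod_int : Integrable (fun p : ℝ × ℝ => phi1 p.1 * phi1 p.2) :=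
  phi1_int.mul_prod phi1_int

lemma kernel_le (z : ℂ) : ∀ᵐ p : ℝ × ℝ, ‖zt p - z‖⁻¹ ≤
    (fun p : ℝ × ℝ => phi1 p.1 * phi1 p.2) (p - (z.re, z.im)) + 1 := by
  filter_upwards [ae_ne z] with p hp
  exact inv_norm_le (w := zt p - z) (by simpa [zt, sub_eq_zero] using hp.1)
    (by simpa [zt, sub_eq_zero] using hp.2)

lemma kernel_meas (z : ℂ) : Measurable (fun p => (zt p - z)⁻¹) :=
  (continuous_zt.measurable.sub_const z).inv

lemma kernel_int {S : Set (ℝ × ℝ)} (hS : volume S ≠ ⊤) (z : ℂ) :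
    IntegrableOn (fun p => (zt p - z)⁻¹) S := by
  have h1 : Integrable (fun p : ℝ × ℝ => (fun p : ℝ × ℝ => phi1 p.1 * phi1 p.2) (p - (z.re, z.im)) + 1)
      (volume.restrict S) := by
    have : IsFiniteMeasure (volume.restrict S) := ⟨by simpa using hS.lt_top⟩
    exact ((phi_prod_int.comp_sub_right _).restrict).add (integrable_const _)
  refine h1.mono' (kernel_meas z).aestronglyMeasurable ?_
  filter_upwards [ae_restrict_of_ae (kernel_le z)] with p hp
  rw [norm_inv]; exact hp

lemma kernel_bound {S : Set (ℝ × ℝ)} (hS : volume S ≠ ⊤) :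
    ∃ C, 0 ≤ C ∧ ∀ z, ∫ p in S, ‖(zt p - z)⁻¹‖ ≤ C := by
  have : IsFiniteMeasure (volume.restrict S) := ⟨by simpa using hS.lt_top⟩
  refine ⟨(∫ p : ℝ × ℝ, phi1 p.1 * phi1 p.2) + volume.real S, ?_, fun z => ?_⟩
  · have : 0 ≤ ∫ p : ℝ × ℝ, phi1 p.1 * phi1 p.2 :=
      integral_nonneg fun p => mul_nonneg (phi1_nonneg _) (phi1_nonneg _)
    positivity
  have hI := phi_prod_int.comp_sub_right (z.re, z.im)
  calc ∫ p in S, ‖(zt p - z)⁻¹‖ ≤ ∫ p in S, ((fun p : ℝ × ℝ => phi1 p.1 * phi1 p.2) (p - (z.re, z.im)) + 1) := by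
        refine integral_mono_ae (kernel_int hS z).norm (hI.restrict.add (integrable_const _)) ?_
        filter_upwards [ae_restrict_of_ae (kernel_le z)] with p hp
        rw [norm_inv]; exact hp
    _ = (∫ p in S, (fun p : ℝ × ℝ => phi1 p.1 * phi1 p.2) (p - (z.re, z.im))) + volume.real S := by
        rw [integral_add hI.restrict (integrable_const _)]; simp
    _ ≤ _ := by
        gcongr
        rw [← integral_sub_right_eq_self (fun p : ℝ × ℝ => phi1 p.1 * phi1 p.2) (z.re, z.im)]
        refine setIntegral_le_integral hI (ae_of_all _ fun p => ?_)
        exact mul_nonneg (phi1_nonneg _) (phi1_nonneg _)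

lemma log_neg_of_im_pos {w : ℂ} (h : 0 < w.im) : Complex.log (-w) = Complex.log w - Real.pi * Complex.I := by
  rw [Complex.log, Complex.log, Complex.arg_neg_eq_arg_sub_pi_of_im_pos h]; push_cast; rw [norm_neg]; ring
lemma log_neg_of_im_neg {w : ℂ} (h : w.im < 0) : Complex.log (-w) = Complex.log w + Real.pi * Complex.I := by
  rw [Complex.log, Complex.log, Complex.arg_neg_eq_arg_add_pi_of_im_neg h]; push_cast; rw [norm_neg]; ring

lemma inner_int {y0 y1 t : ℝ} {z : ℂ} (h0 : y0 < z.im) (h1 : z.im < y1) (ht : t ≠ z.re) :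
    ∫ y in Ioo y0 y1, (zt (t, y) - z)⁻¹ =
      -Complex.I * (Complex.log (zt (t, y1) - z) - Complex.log (zt (t, y0) - z))
        - (if t < z.re then 2 * Real.pi else 0 : ℝ) := by
  have hle : y0 ≤ y1 := by linarith
  rw [← integral_Ioc_eq_integral_Ioo, ← intervalIntegral.integral_of_le hle]
  have hd : ∀ y : ℝ, HasDerivAt (fun y => zt (t, y) - z) Complex.I y := by
    intro y
    have e : (fun y => zt (t, y) - z) = fun y : ℝ => ((y : ℂ) * Complex.I + t - z) := by
      funext y; apply Complex.ext <;> simp [zt]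
    rw [e]
    have := ((Complex.ofRealCLM.hasDerivAt (x := y)).mul_const Complex.I).add_const (t : ℂ) |>.sub_const z
    simpa using this
  have hcont : Continuous (fun y => (zt (t, y) - z)⁻¹) := by
    refine Continuous.inv₀ ((continuous_zt.comp (by fun_prop)).sub continuous_const) fun y h => ht ?_
    have := congrArg Complex.re h
    simpa [zt, sub_eq_zero] using this
  have hne : ∀ y, zt (t, y) - z ≠ 0 := by
    intro y h
    have := congrArg Complex.re h
    exact ht (by simpa [zt, sub_eq_zero] using this)
  rcases lt_or_gt_of_ne ht with hlt | hgt
  · rw [intervalIntegral.integral_eq_sub_of_hasDerivAt (f := fun y => -Complex.I * Complex.log (-(zt (t, y) - z)))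
      ?_ (hcont.intervalIntegrable _ _)]
    · simp only [hlt, if_true]
      rw [log_neg_of_im_pos (by simp [zt, h1]), log_neg_of_im_neg (by simp [zt, h0])]
      push_cast
      linear_combination (2 * (Real.pi : ℂ)) * Complex.I_mul_I
    · intro y _
      have := ((hd y).neg.clog_real (by left; simp [zt, hlt])).const_mul (-Complex.I)
      refine this.congr_deriv ?_
      rw [Pi.neg_apply, neg_div_neg_eq, ← mul_div_assoc, neg_mul, Complex.I_mul_I, neg_neg, one_div]
  · rw [intervalIntegral.integral_eq_sub_of_hasDerivAt (f := fun y => -Complex.I * Complex.log ((zt (t, y) - z)))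
      ?_ (hcont.intervalIntegrable _ _)]
    · simp only [hgt.not_gt, if_false]
      push_cast; ring
    · intro y _
      have := ((hd y).clog_real (by left; simp [zt, hgt])).const_mul (-Complex.I)
      refine this.congr_deriv ?_
      rw [← mul_div_assoc, neg_mul, Complex.I_mul_I, neg_neg, one_div]

/-- data of a rectangle with an inner strip -/
structure Strip where
  (xL α β xR y0 y1 : ℝ)
  h1 : xL < α
  h2 : α < β
  h3 : β < xR
  h4 : y0 < y1

namespace Strip
variable (Q : Strip)
def S : Set (ℝ × ℝ) := Ioo Q.α Q.β ×ˢ Ioo Q.y0 Q.y1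
def OL : Set ℂ := {z | z.re < Q.xR ∧ Q.y0 < z.im ∧ z.im < Q.y1}
def OR : Set ℂ := {z | Q.xL < z.re ∧ Q.y0 < z.im ∧ z.im < Q.y1}
def O : Set ℂ := {z | Q.xL < z.re ∧ z.re < Q.xR ∧ Q.y0 < z.im ∧ z.im < Q.y1}
def chi (x : ℝ) : ℝ := max 0 (min 1 ((x - Q.α) / (Q.β - Q.α)))
def kap : ℝ := 2 * Real.pi * (Q.β - Q.α)
def L (z : ℂ) : ℂ := ∫ t in Ioo Q.α Q.β,
  -Complex.I * (Complex.log (zt (t, Q.y1) - z) - Complex.log (zt (t, Q.y0) - z))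

lemma kap_pos : 0 < Q.kap := by
  have := Q.h2; have := Real.pi_pos; unfold kap
  have : 0 < Q.β - Q.α := by linarith
  positivity

lemma isOpen_O : IsOpen Q.O := by
  simp only [O, ofPred_and]
  refine (isOpen_lt ?_ ?_).inter ((isOpen_lt ?_ ?_).inter ((isOpen_lt ?_ ?_).inter (isOpen_lt ?_ ?_))) <;> fun_prop
lemma isOpen_OL : IsOpen Q.OL := by
  simp only [OL, ofPred_and]
  refine ((isOpen_lt ?_ ?_).inter ((isOpen_lt ?_ ?_).inter (isOpen_lt ?_ ?_))) <;> fun_prop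
lemma isOpen_OR : IsOpen Q.OR := by
  simp only [OR, ofPred_and]
  refine ((isOpen_lt ?_ ?_).inter ((isOpen_lt ?_ ?_).inter (isOpen_lt ?_ ?_))) <;> fun_prop

lemma S_meas : MeasurableSet Q.S := measurableSet_Ioo.prod measurableSet_Ioo
lemma S_fin : volume Q.S ≠ ⊤ := by
  rw [S, Measure.volume_eq_prod, Measure.prod_prod]
  simp [ENNReal.mul_eq_top]
instance : IsFiniteMeasure (volume.restrict Q.S) := ⟨by simpa using Q.S_fin.lt_top⟩
lemma S_sub {p : ℝ × ℝ} (hp : p ∈ Q.S) : zt p ∈ Q.O := by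
  obtain ⟨⟨a, b⟩, c, d⟩ := hp
  have := Q.h1; have := Q.h3
  exact ⟨by simp [zt]; linarith, by simp [zt]; linarith, c, d⟩

lemma chi_nonneg (x : ℝ) : 0 ≤ Q.chi x := le_max_left _ _
lemma chi_le_one (x : ℝ) : Q.chi x ≤ 1 := max_le zero_le_one (min_le_left _ _)
lemma chi_left {x : ℝ} (h : x ≤ Q.α) : Q.chi x = 0 := by
  have := Q.h2
  refine max_eq_left ((min_le_right _ _).trans ?_)
  exact div_nonpos_of_nonpos_of_nonneg (by linarith) (by linarith)
lemma chi_right {x : ℝ} (h : Q.β ≤ x) : Q.chi x = 1 := by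
  have := Q.h2
  unfold chi
  rw [min_eq_left, max_eq_right zero_le_one]
  rw [le_div_iff₀ (by linarith)]; linarith

lemma int_step (x : ℝ) : ∫ t in Ioo Q.α Q.β, (if t < x then 2 * Real.pi else 0 : ℝ) = Q.kap * Q.chi x := by
  have h2 := Q.h2
  have : (fun t => (if t < x then 2 * Real.pi else 0 : ℝ)) = (Iio x).indicator (fun _ => 2 * Real.pi) := by
    funext t; simp [indicator, mem_Iio]
  rw [this, setIntegral_indicator measurableSet_Iio, Ioo_inter_Iio, setIntegral_const]
  simp only [Real.volume_real_Ioo, smul_eq_mul, kap]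
  rcases le_or_gt x Q.α with h | h
  · rw [Q.chi_left h, min_eq_right (by linarith), max_eq_right (by linarith)]; ring
  rcases le_or_gt Q.β x with h' | h'
  · rw [Q.chi_right h', min_eq_left h', max_eq_left (by linarith)]; ring
  · rw [min_eq_right h'.le, max_eq_left (by linarith)]
    have e : Q.chi x = (x - Q.α) / (Q.β - Q.α) := by
      unfold chi
      rw [min_eq_right, max_eq_right]
      · exact div_nonneg (by linarith) (by linarith)
      · rw [div_le_one (by linarith)]; linarith
    rw [e]
    have : Q.β - Q.α ≠ 0 := by linarith
    field_simp

lemma log_cont {z : ℂ} {y : ℝ} (hy : y ≠ z.im) : Continuous (fun t => Complex.log (zt (t, y) - z)) := by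
  refine Continuous.clog ((continuous_zt.comp (by fun_prop)).sub continuous_const) fun t => ?_
  right; simpa [zt, sub_eq_zero] using hy

lemma kernel_formula {z : ℂ} (h0 : Q.y0 < z.im) (h1 : z.im < Q.y1) :
    ∫ p in Q.S, (zt p - z)⁻¹ = Q.L z - (Q.kap * Q.chi z.re : ℝ) := by
  have hint := kernel_int Q.S_fin z
  rw [S, Measure.volume_eq_prod] at *
  rw [setIntegral_prod _ hint]
  have : ∫ t in Ioo Q.α Q.β, ∫ y in Ioo Q.y0 Q.y1, (zt (t, y) - z)⁻¹ = 
    ∫ t in Ioo Q.α Q.β, (-Complex.I * (Complex.log (zt (t, Q.y1) - z) - Complex.log (zt (t, Q.y0) - z))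
        - (if t < z.re then 2 * Real.pi else 0 : ℝ)) := by
    refine integral_congr_ae (ae_restrict_of_ae ?_)
    filter_upwards [Measure.ae_ne volume z.re] with t ht using inner_int h0 h1 ht
  rw [this, integral_sub, integral_complex_ofReal, Q.int_step]
  · rfl
  · have : Continuous (fun t => -Complex.I * (Complex.log (zt (t, Q.y1) - z) - Complex.log (zt (t, Q.y0) - z))) :=
      continuous_const.mul ((log_cont h1.ne').sub (log_cont h0.ne))
    exact (this.integrableOn_Icc (a := Q.α) (b := Q.β)).mono_set Ioo_subset_Icc_self
  · refine Integrable.ofReal (f := fun t => if t < z.re then 2 * Real.pi else 0) ?_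
    refine Integrable.of_bound (f := fun t => if t < z.re then 2 * Real.pi else 0) (C := 2 * Real.pi) ?_ (ae_of_all _ fun t => ?_)
    · exact (Measurable.ite measurableSet_Iio measurable_const measurable_const).aestronglyMeasurable
    · show ‖(if t < z.re then 2 * Real.pi else 0 : ℝ)‖ ≤ _
      split_ifs <;> simp [abs_of_pos Real.pi_pos, Real.pi_pos.le]

lemma L_diff {z : ℂ} (h0 : Q.y0 < z.im) (h1 : z.im < Q.y1) : DifferentiableAt ℂ Q.L z := by
  obtain ⟨r, hr, hr0, hr1⟩ : ∃ r > 0, (∀ w ∈ closedBall z r, Q.y0 < w.im) ∧ ∀ w ∈ closedBall z r, w.im < Q.y1 := by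
    refine ⟨min (z.im - Q.y0) (Q.y1 - z.im) / 2, by
      have : 0 < min (z.im - Q.y0) (Q.y1 - z.im) := lt_min (by linarith) (by linarith)
      linarith, ?_, ?_⟩ <;>
    · intro w hw
      rw [mem_closedBall, dist_eq_norm] at hw
      have a := (Complex.abs_im_le_norm (w - z)).trans hw
      rw [abs_le, Complex.sub_im] at a
      have b1 := min_le_left (z.im - Q.y0) (Q.y1 - z.im)
      have b2 := min_le_right (z.im - Q.y0) (Q.y1 - z.im)
      linarith
  have hc : ∀ y : ℝ, (∀ w ∈ closedBall z r, y ≠ w.im) → ∃ M, ∀ t ∈ Icc Q.α Q.β, ∀ w ∈ closedBall z r,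
      ‖Complex.log (zt (t, y) - w)‖ ≤ M := by
    intro y hy
    have : ContinuousOn (fun q : ℝ × ℂ => Complex.log (zt (q.1, y) - q.2)) (Icc Q.α Q.β ×ˢ closedBall z r) := by
      refine ContinuousOn.clog ((continuous_zt.comp (by fun_prop)).sub continuous_snd).continuousOn fun q hq => ?_
      right; simpa [zt, sub_eq_zero] using hy _ hq.2
    obtain ⟨M, hM⟩ := (isCompact_Icc.prod (isCompact_closedBall z r)).exists_bound_of_continuousOn this
    exact ⟨M, fun t ht w hw => hM (t, w) ⟨ht, hw⟩⟩
  obtain ⟨M1, hM1⟩ := hc Q.y1 (fun w hw => (hr1 w hw).ne')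
  obtain ⟨M0, hM0⟩ := hc Q.y0 (fun w hw => (hr0 w hw).ne)
  refine param_integral (r := r) (M := 1 * (M1 + M0)) hr ?_ ?_ ?_
  · intro w hw
    have hw := ball_subset_closedBall hw
    exact (continuous_const.mul ((log_cont (hr1 w hw).ne').sub (log_cont (hr0 w hw).ne))).aestronglyMeasurable
  · refine ae_of_all _ fun t w hw => ?_
    have hw := ball_subset_closedBall hw
    refine DifferentiableAt.const_mul (DifferentiableAt.sub ?_ ?_) _
    · refine DifferentiableAt.clog (by fun_prop) ?_
      right; simpa [zt, sub_eq_zero] using (hr1 w hw).ne'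
    · refine DifferentiableAt.clog (by fun_prop) ?_
      right; simpa [zt, sub_eq_zero] using (hr0 w hw).ne
  · refine (ae_restrict_mem measurableSet_Ioo).mono fun t ht w hw => ?_
    have hw := ball_subset_closedBall hw
    have ht := Ioo_subset_Icc_self ht
    rw [norm_mul, norm_neg, Complex.norm_I]
    gcongr
    exact (norm_sub_le _ _).trans (add_le_add (hM1 t ht w hw) (hM0 t ht w hw))

end Strip
end UC

namespace UC
open Set Filter Topology Metric

namespace Strip
variable (Q : Strip)
variable {E F : Type*} [NormedAddCommGroup E] [NormedSpace ℂ E]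
  [NormedAddCommGroup F] [NormedSpace ℂ F]

def Tt (f : ℂ → F) (z : ℂ) : F := (Q.kap : ℂ)⁻¹ • ∫ p in Q.S, (zt p - z)⁻¹ • f (zt p)
def PL (f : ℂ → F) (z : ℂ) : F := Q.Tt f z + (Q.chi z.re : ℂ) • f z
def PR (f : ℂ → F) (z : ℂ) : F := Q.Tt f z + ((Q.chi z.re : ℂ) - 1) • f z
def C0 : ℝ := Classical.choose (kernel_bound Q.S_fin)
lemma C0_nonneg : 0 ≤ Q.C0 := (Classical.choose_spec (kernel_bound Q.S_fin)).1
lemma C0_spec (z : ℂ) : ∫ p in Q.S, ‖(zt p - z)⁻¹‖ ≤ Q.C0 :=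
  (Classical.choose_spec (kernel_bound Q.S_fin)).2 z
def C1 : ℝ := Q.kap⁻¹ * Q.C0 + 1
lemma C1_pos : 0 < Q.C1 := by
  have := Q.C0_nonneg; have := Q.kap_pos; unfold C1; positivity

lemma PL_sub_PR (f : ℂ → F) (z : ℂ) : Q.PL f z - Q.PR f z = f z := by
  simp only [PL, PR, sub_smul, one_smul]; abel

lemma f_aesm {f : ℂ → F} (hf : ContinuousOn f Q.O) :
    AEStronglyMeasurable (fun p => f (zt p)) (volume.restrict Q.S) := by
  refine ContinuousOn.aestronglyMeasurable ?_ Q.S_meas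
  exact hf.comp continuous_zt.continuousOn fun p hp => Q.S_sub hp

lemma kf_int {f : ℂ → F} (hf : ContinuousOn f Q.O) {M : ℝ} (hM : ∀ z ∈ Q.O, ‖f z‖ ≤ M) (z : ℂ) :
    Integrable (fun p => (zt p - z)⁻¹ • f (zt p)) (volume.restrict Q.S) := by
  have h1 : Integrable (fun p => (zt p - z)⁻¹) (volume.restrict Q.S) := kernel_int Q.S_fin z
  refine (h1.norm.mul_const M).mono' (h1.aestronglyMeasurable.smul (Q.f_aesm hf)) ?_
  refine (ae_restrict_mem Q.S_meas).mono fun p hp => ?_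
  rw [norm_smul]
  gcongr
  exact hM _ (Q.S_sub hp)

lemma Tt_bound {f : ℂ → F} {M : ℝ} (hM : ∀ z ∈ Q.O, ‖f z‖ ≤ M) (z : ℂ) :
    ‖Q.Tt f z‖ ≤ Q.kap⁻¹ * Q.C0 * M := by
  have hk := Q.kap_pos
  have hM0 : 0 ≤ M := by
    have h1 := Q.h1; have h2 := Q.h2; have h3 := Q.h3; have h4 := Q.h4
    refine (norm_nonneg _).trans (hM (zt ((Q.α + Q.β) / 2, (Q.y0 + Q.y1) / 2)) (Q.S_sub ?_))
    refine ⟨⟨?_, ?_⟩, ?_, ?_⟩ <;> simp only <;> linarith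
  rw [Tt, norm_smul, norm_inv, Complex.norm_real, Real.norm_of_nonneg hk.le, mul_assoc]
  gcongr
  have h1 : Integrable (fun p => (zt p - z)⁻¹) (volume.restrict Q.S) := kernel_int Q.S_fin z
  calc _ ≤ ∫ p in Q.S, ‖(zt p - z)⁻¹‖ * M := by
        refine norm_integral_le_of_norm_le (h1.norm.mul_const M) ?_
        refine (ae_restrict_mem Q.S_meas).mono fun p hp => ?_
        rw [norm_smul]
        gcongr
        exact hM _ (Q.S_sub hp)
    _ = (∫ p in Q.S, ‖(zt p - z)⁻¹‖) * M := integral_mul_const _ _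
    _ ≤ _ := by gcongr; exact Q.C0_spec z

lemma PL_bound {f : ℂ → F} {M : ℝ} (hM : ∀ z ∈ Q.O, ‖f z‖ ≤ M) {z : ℂ} (hz : z ∈ Q.OL) :
    ‖Q.PL f z‖ ≤ Q.C1 * M := by
  refine (norm_add_le _ _).trans ?_
  rw [C1, add_mul, one_mul]
  refine add_le_add (Q.Tt_bound hM z) ?_
  have hM0 : 0 ≤ M := by
    by_contra h
    have := Q.Tt_bound (f := fun _ => (0:F)) (M := 0) (by simp) z
    have h1 := Q.h1; have h2 := Q.h2; have h3 := Q.h3; have h4 := Q.h4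
    refine h ((norm_nonneg _).trans (hM (zt ((Q.α + Q.β) / 2, (Q.y0 + Q.y1) / 2)) (Q.S_sub ?_)))
    refine ⟨⟨?_, ?_⟩, ?_, ?_⟩ <;> simp only <;> linarith
  by_cases h : z.re ≤ Q.α
  · simp [Q.chi_left h, hM0]
  · have hzO : z ∈ Q.O := ⟨by have := Q.h1; linarith, hz⟩
    rw [norm_smul, Complex.norm_real, Real.norm_of_nonneg (Q.chi_nonneg _)]
    calc _ ≤ 1 * M := mul_le_mul (Q.chi_le_one _) (hM z hzO) (norm_nonneg _) zero_le_one
      _ = M := one_mul M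

lemma PR_bound {f : ℂ → F} {M : ℝ} (hM : ∀ z ∈ Q.O, ‖f z‖ ≤ M) {z : ℂ} (hz : z ∈ Q.OR) :
    ‖Q.PR f z‖ ≤ Q.C1 * M := by
  refine (norm_add_le _ _).trans ?_
  rw [C1, add_mul, one_mul]
  refine add_le_add (Q.Tt_bound hM z) ?_
  have hM0 : 0 ≤ M := by
    by_contra h
    have h1 := Q.h1; have h2 := Q.h2; have h3 := Q.h3; have h4 := Q.h4
    refine h ((norm_nonneg _).trans (hM (zt ((Q.α + Q.β) / 2, (Q.y0 + Q.y1) / 2)) (Q.S_sub ?_)))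
    refine ⟨⟨?_, ?_⟩, ?_, ?_⟩ <;> simp only <;> linarith
  by_cases h : Q.β ≤ z.re
  · simp [Q.chi_right h, hM0]
  · have hzO : z ∈ Q.O := ⟨hz.1, by have := Q.h3; linarith, hz.2⟩
    rw [norm_smul, ← Complex.ofReal_one, ← Complex.ofReal_sub, Complex.norm_real,
      Real.norm_of_nonpos (by linarith [Q.chi_le_one z.re])]
    calc _ ≤ 1 * M := mul_le_mul (by linarith [Q.chi_nonneg z.re]) (hM z hzO) (norm_nonneg _) zero_le_one
      _ = M := one_mul M

lemma PR_sub {f g : ℂ → F} (hf : ContinuousOn f Q.O) (hg : ContinuousOn g Q.O) {M N : ℝ}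
    (hM : ∀ z ∈ Q.O, ‖f z‖ ≤ M) (hN : ∀ z ∈ Q.O, ‖g z‖ ≤ N) (z : ℂ) :
    Q.PR (fun w => f w - g w) z = Q.PR f z - Q.PR g z := by
  simp only [PR, Tt, smul_sub]
  rw [integral_sub (Q.kf_int hf hM z) (Q.kf_int hg hN z), smul_sub]
  abel

/-- holomorphic bounded functions on the product -/
def Good (Ω : Set E) (f : ℂ × E → F) (M : ℝ) : Prop :=
  (∀ p ∈ Q.O ×ˢ Ω, DifferentiableAt ℂ f p) ∧ ∀ p ∈ Q.O ×ˢ Ω, ‖f p‖ ≤ M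

variable {Q}
lemma Good.slice_cont {Ω : Set E} {f : ℂ × E → F} {M : ℝ} (h : Q.Good Ω f M) {r : E} (hr : r ∈ Ω) :
    ContinuousOn (fun z => f (z, r)) Q.O := by
  intro z hz
  have := (h.1 (z, r) ⟨hz, hr⟩).continuousAt
  exact (ContinuousAt.comp (g := f) (f := fun z : ℂ => (z, r)) this (by fun_prop)).continuousWithinAt
variable (Q)

lemma T_diff_out [FiniteDimensional ℂ E] [CompleteSpace F] {Ω : Set E} (hΩ : IsOpen Ω) {f : ℂ × E → F} {M : ℝ}
    (h : Q.Good Ω f M) {z : ℂ} {r : E} (hr : r ∈ Ω) {δ : ℝ} (hδ : 0 < δ)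
    (hz : ∀ p ∈ Q.S, ∀ w ∈ ball z δ, δ ≤ ‖zt p - w‖) :
    DifferentiableAt ℂ (fun q : ℂ × E => Q.Tt (fun w => f (w, q.2)) q.1) (z, r) := by
  obtain ⟨ε, hε, hεΩ⟩ := Metric.isOpen_iff.1 hΩ r hr
  refine DifferentiableAt.const_smul ?_ _
  have hb : ∀ q ∈ ball (z, r) (min δ ε), q.1 ∈ ball z δ ∧ q.2 ∈ Ω := by
    intro q hq
    rw [← ball_prod_same] at hq
    exact ⟨ball_subset_ball (min_le_left _ _) hq.1, hεΩ (ball_subset_ball (min_le_right _ _) hq.2)⟩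
  refine param_integral (r := min δ ε) (M := δ⁻¹ * M) (lt_min hδ hε) ?_ ?_ ?_
  · intro q hq
    exact (Q.kf_int (h.slice_cont (hb q hq).2) (fun w hw => h.2 (w, q.2) ⟨hw, (hb q hq).2⟩) q.1).aestronglyMeasurable
  · refine (ae_restrict_mem Q.S_meas).mono fun p hp q hq => ?_
    obtain ⟨h1, h2⟩ := hb q hq
    have hne := norm_pos_iff.1 (hδ.trans_le (hz p hp _ h1))
    have d1 : DifferentiableAt ℂ (fun q : ℂ × E => f (zt p, q.2)) q :=
      DifferentiableAt.comp (g := f) (f := fun q : ℂ × E => (zt p, q.2)) q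
          (h.1 _ ⟨Q.S_sub hp, h2⟩) (by fun_prop)
    have d3 : DifferentiableAt ℂ (fun q : ℂ × E => (zt p - q.1)⁻¹) q :=
        DifferentiableAt.inv (by fun_prop) hne
    exact d3.smul d1
  · refine (ae_restrict_mem Q.S_meas).mono fun p hp q hq => ?_
    obtain ⟨h1, h2⟩ := hb q hq
    rw [norm_smul, norm_inv]
    have := hz p hp _ h1
    have := h.2 (zt p, q.2) ⟨Q.S_sub hp, h2⟩
    gcongr

lemma T_diff_left [FiniteDimensional ℂ E] [CompleteSpace F] {Ω : Set E} (hΩ : IsOpen Ω) {f : ℂ × E → F} {M : ℝ}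
    (h : Q.Good Ω f M) {z : ℂ} {r : E} (hr : r ∈ Ω) (hz : z.re < Q.α) :
    DifferentiableAt ℂ (fun q : ℂ × E => Q.Tt (fun w => f (w, q.2)) q.1) (z, r) := by
  refine Q.T_diff_out hΩ h hr (δ := (Q.α - z.re) / 2) (by linarith) ?_
  intro p hp w hw
  rw [mem_ball, dist_eq_norm] at hw
  have a := abs_lt.1 ((Complex.abs_re_le_norm (w - z)).trans_lt hw)
  have b := (le_abs_self _).trans (Complex.abs_re_le_norm (zt p - w))
  have := hp.1.1
  simp only [Complex.sub_re, zt] at a b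
  change _ ≤ ‖zt p - w‖ at b
  linarith

lemma T_diff_right [FiniteDimensional ℂ E] [CompleteSpace F] {Ω : Set E} (hΩ : IsOpen Ω) {f : ℂ × E → F} {M : ℝ}
    (h : Q.Good Ω f M) {z : ℂ} {r : E} (hr : r ∈ Ω) (hz : Q.β < z.re) :
    DifferentiableAt ℂ (fun q : ℂ × E => Q.Tt (fun w => f (w, q.2)) q.1) (z, r) := by
  refine Q.T_diff_out hΩ h hr (δ := (z.re - Q.β) / 2) (by linarith) ?_
  intro p hp w hw
  rw [mem_ball, dist_eq_norm] at hw
  have a := abs_lt.1 ((Complex.abs_re_le_norm (w - z)).trans_lt hw)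
  have b := (neg_le_abs _).trans (Complex.abs_re_le_norm (zt p - w))
  have := hp.1.2
  simp only [Complex.sub_re, zt] at a b
  change _ ≤ ‖zt p - w‖ at b
  linarith

lemma PL_diff_in [FiniteDimensional ℂ E] [CompleteSpace F] {Ω : Set E} (hΩ : IsOpen Ω) {f : ℂ × E → F} {M : ℝ}
    (h : Q.Good Ω f M) {z : ℂ} {r : E} (hr : r ∈ Ω) (hz : z ∈ Q.O) :
    DifferentiableAt ℂ (fun q : ℂ × E => Q.PL (fun w => f (w, q.2)) q.1) (z, r) := by
  have hOΩ : IsOpen (Q.O ×ˢ Ω) := Q.isOpen_O.prod hΩ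
  obtain ⟨ε, hε, hsub⟩ := Metric.isOpen_iff.1 hOΩ (z, r) ⟨hz, hr⟩
  set ρ := ε / 3 with hρ
  have hρ0 : 0 < ρ := by positivity
  rw [← ball_prod_same] at hsub
  have hM0 : 0 ≤ M := (norm_nonneg _).trans (h.2 (z, r) ⟨hz, hr⟩)
  have hb : ∀ q ∈ ball (z, r) ρ, q ∈ Q.O ×ˢ Ω := by
    intro q hq
    refine hsub ?_
    rw [ball_prod_same]; exact ball_subset_ball (by linarith) hq
  have hadd : ∀ q ∈ Q.O ×ˢ Ω, ∀ᵐ p ∂(volume.restrict Q.S),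
      (zt p - q.1)⁻¹ • f (zt p, q.2) - (zt p - q.1)⁻¹ • f q = dslope (fun w => f (w, q.2)) (zt p) q.1 := by
    intro q hq
    filter_upwards [ae_ne' Q.S q.1] with p hp
    rw [dslope_of_ne _ hp.symm, slope_def_module, ← smul_sub, ← neg_sub (zt p), inv_neg, neg_smul, ← smul_neg, neg_sub]
  have hI1 : ∀ q ∈ Q.O ×ˢ Ω, Integrable (fun p => (zt p - q.1)⁻¹ • f (zt p, q.2)) (volume.restrict Q.S) := 
    fun q hq => Q.kf_int (h.slice_cont hq.2) (fun w hw => h.2 (w, q.2) ⟨hw, hq.2⟩) q.1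
  have hI2 : ∀ q ∈ Q.O ×ˢ Ω, Integrable (fun p => (zt p - q.1)⁻¹ • f q) (volume.restrict Q.S) := 
    fun q hq => Integrable.smul_const (kernel_int Q.S_fin q.1) _
  have key : ∀ q ∈ Q.O ×ˢ Ω, Q.PL (fun w => f (w, q.2)) q.1 =
      (Q.kap : ℂ)⁻¹ • ((∫ p in Q.S, dslope (fun w => f (w, q.2)) (zt p) q.1) + Q.L q.1 • f q) := by
    intro q hq
    have e : ∫ p in Q.S, (zt p - q.1)⁻¹ • f (zt p, q.2) =
        (∫ p in Q.S, dslope (fun w => f (w, q.2)) (zt p) q.1) + (∫ p in Q.S, (zt p - q.1)⁻¹) • f q := by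
      rw [← integral_congr_ae (hadd q hq), integral_sub (hI1 q hq) (hI2 q hq), integral_smul_const]
      abel
    have hk : (Q.kap : ℂ) ≠ 0 := by exact_mod_cast Q.kap_pos.ne'
    rw [PL, Tt, e, Q.kernel_formula hq.1.2.2.1 hq.1.2.2.2, sub_smul]
    have : (Q.chi q.1.re : ℂ) • f (q.1, q.2) = (Q.kap : ℂ)⁻¹ • (((Q.kap * Q.chi q.1.re : ℝ) : ℂ) • f q) := by
      rw [smul_smul]; push_cast; rw [inv_mul_cancel_left₀ hk]
    rw [this, ← smul_add]
    congr 1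
    abel
  have hPI : DifferentiableAt ℂ (fun q : ℂ × E => ∫ p in Q.S, dslope (fun w => f (w, q.2)) (zt p) q.1) (z, r) := by
    refine param_integral (r := ρ) (M := (2 * M) / ρ) hρ0 ?_ ?_ ?_
    · intro q hq
      have hq := hb q hq
      exact ((hI1 q hq).sub (hI2 q hq)).aestronglyMeasurable.congr (hadd q hq)
    · refine (ae_restrict_mem Q.S_meas).mono fun p hp q hq => ?_
      have hq := hb q hq
      refine dslope_diff (w1 := q.1) (r0 := q.2) ?_ (h.1 q hq)
      filter_upwards [hOΩ.mem_nhds (show (zt p, q.2) ∈ Q.O ×ˢ Ω from ⟨Q.S_sub hp, hq.2⟩)] with x hx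
        using h.1 x hx
    · refine (ae_restrict_mem Q.S_meas).mono fun p hp q hq => ?_
      have hq' := hb q hq
      rw [← ball_prod_same] at hq
      have hfb : ∀ w ∈ Q.O, ‖f (w, q.2) - f (zt p, q.2)‖ ≤ 2 * M := by
        intro w hw
        have h1 := h.2 (w, q.2) ⟨hw, hq'.2⟩
        have h2 := h.2 (zt p, q.2) ⟨Q.S_sub hp, hq'.2⟩
        exact (norm_sub_le _ _).trans (by linarith)
      by_cases hd : dist q.1 (zt p) < ρ
      · have hbO : ball (zt p) ρ ⊆ Q.O := by
          intro w hw
          have hz1 := hq.1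
          rw [mem_ball] at hw hz1
          refine (hsub (show (w, r) ∈ ball z ε ×ˢ ball r ε from ⟨?_, mem_ball_self hε⟩)).1
          rw [mem_ball]
          have t1 := dist_triangle w (zt p) z
          have t2 := dist_triangle (zt p) q.1 z
          rw [dist_comm (zt p) q.1] at t2
          linarith
        refine Complex.norm_dslope_le_div_of_mapsTo_ball (R₁ := ρ) ?_ ?_ hd
        · intro w hw
          exact (DifferentiableAt.comp (g := f) (f := fun w : ℂ => (w, q.2)) w
            (h.1 _ ⟨hbO hw, hq'.2⟩) (by fun_prop)).differentiableWithinAt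
        · intro w hw
          rw [mem_closedBall, dist_eq_norm]
          exact hfb w (hbO hw)
      · push Not at hd
        have hne : q.1 ≠ zt p := by
          intro h; rw [h, dist_self] at hd; linarith
        rw [dslope_of_ne _ hne, slope_def_module, norm_smul, norm_inv, ← dist_eq_norm, div_eq_inv_mul]
        have := hfb q.1 hq'.1
        gcongr
  refine DifferentiableAt.congr_of_eventuallyEq ?_
    (show _ =ᶠ[𝓝 (z, r)] _ by filter_upwards [hOΩ.mem_nhds ⟨hz, hr⟩] with q hq using key q hq)
  refine DifferentiableAt.const_smul (hPI.add (DifferentiableAt.smul ?_ (h.1 (z, r) ⟨hz, hr⟩))) _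
  exact DifferentiableAt.comp (g := Q.L) (f := Prod.fst) (z, r) (Q.L_diff hz.2.2.1 hz.2.2.2) differentiableAt_fst

lemma PL_diff [FiniteDimensional ℂ E] [CompleteSpace F] {Ω : Set E} (hΩ : IsOpen Ω) {f : ℂ × E → F} {M : ℝ}
    (h : Q.Good Ω f M) {z : ℂ} {r : E} (hr : r ∈ Ω) (hz : z ∈ Q.OL) :
    DifferentiableAt ℂ (fun q : ℂ × E => Q.PL (fun w => f (w, q.2)) q.1) (z, r) := by
  by_cases hx : z.re < Q.α
  · refine (Q.T_diff_left hΩ h hr hx).congr_of_eventuallyEq ?_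
    have : ∀ᶠ q : ℂ × E in 𝓝 (z, r), q.1.re < Q.α :=
      ((Complex.continuous_re.comp continuous_fst).continuousAt (x := (z, r))).eventually_lt continuousAt_const hx
    filter_upwards [this] with q hq
    simp [PL, Q.chi_left hq.le]
  · exact Q.PL_diff_in hΩ h hr ⟨by have := Q.h1; linarith, hz⟩

lemma PR_diff [FiniteDimensional ℂ E] [CompleteSpace F] {Ω : Set E} (hΩ : IsOpen Ω) {f : ℂ × E → F} {M : ℝ}
    (h : Q.Good Ω f M) {z : ℂ} {r : E} (hr : r ∈ Ω) (hz : z ∈ Q.OR) :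
    DifferentiableAt ℂ (fun q : ℂ × E => Q.PR (fun w => f (w, q.2)) q.1) (z, r) := by
  by_cases hx : Q.β < z.re
  · refine (Q.T_diff_right hΩ h hr hx).congr_of_eventuallyEq ?_
    have : ∀ᶠ q : ℂ × E in 𝓝 (z, r), Q.β < q.1.re :=
      continuousAt_const.eventually_lt ((Complex.continuous_re.comp continuous_fst).continuousAt (x := (z, r))) hx
    filter_upwards [this] with q hq
    simp [PR, Q.chi_right hq.le]
  · have hzO : z ∈ Q.O := ⟨hz.1, by have := Q.h3; linarith, hz.2⟩
    have : (fun q : ℂ × E => Q.PR (fun w => f (w, q.2)) q.1) =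
        fun q => Q.PL (fun w => f (w, q.2)) q.1 - f q := by
      funext q; rw [← Q.PL_sub_PR (fun w => f (w, q.2)) q.1]; abel
    rw [this]
    exact (Q.PL_diff_in hΩ h hr hzO).sub (h.1 _ ⟨hzO, hr⟩)

end Strip
end UC

namespace UC
open Set Filter Topology Metric

namespace Strip
variable (Q : Strip)
lemma O_sub_OR : Q.O ⊆ Q.OR := fun _ hz => ⟨hz.1, hz.2.2⟩
lemma O_sub_OL : Q.O ⊆ Q.OL := fun _ hz => hz.2

section rh
variable {E R : Type*} [NormedAddCommGroup E] [NormedSpace ℂ E]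
  [NormedRing R] [NormedAlgebra ℂ R]

def rhIter (A : ℂ × E → R) : ℕ → ℂ × E → R
  | 0 => fun _ => 0
  | n + 1 => fun q => Q.PR (fun w => (1 + rhIter A n (w, q.2)) * A (w, q.2)) q.1

theorem rh [FiniteDimensional ℂ E] [CompleteSpace R] (hone : ‖(1 : R)‖ ≤ 1) {Ω : Set E} (hΩ : IsOpen Ω)
    {A : ℂ × E → R} {ε : ℝ} (hε0 : 0 ≤ ε) (hε : Q.C1 * ε ≤ 1 / 4) (hA : Q.Good Ω A ε) :
    ∃ X' X'' : ℂ × E → R,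
      (∀ q ∈ Q.OL ×ˢ Ω, DifferentiableAt ℂ X' q ∧ ‖X' q - 1‖ ≤ 1 / 2) ∧
      (∀ q ∈ Q.OR ×ˢ Ω, DifferentiableAt ℂ X'' q ∧ ‖X'' q - 1‖ ≤ 1 / 2) ∧
      ∀ q ∈ Q.O ×ˢ Ω, X'' q * (1 + A q) = X' q := by
  have hC := Q.C1_pos
  have good : ∀ b : ℂ × E → R, (∀ q ∈ Q.OR ×ˢ Ω, DifferentiableAt ℂ b q ∧ ‖b q‖ ≤ 1 / 2) →
      Q.Good Ω (fun q => (1 + b q) * A q) (2 * ε) := by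
    intro b hb
    refine ⟨fun q hq => ?_, fun q hq => ?_⟩
    · exact ((hb q ⟨Q.O_sub_OR hq.1, hq.2⟩).1.const_add 1).mul (hA.1 q hq)
    · have h1 := (hb q ⟨Q.O_sub_OR hq.1, hq.2⟩).2
      have h2 := hA.2 q hq
      refine (norm_mul_le _ _).trans (mul_le_mul ?_ h2 (norm_nonneg _) (by norm_num))
      exact (norm_add_le _ _).trans (by linarith)
  have hb : ∀ n, ∀ q ∈ Q.OR ×ˢ Ω, DifferentiableAt ℂ (Q.rhIter A n) q ∧ ‖Q.rhIter A n q‖ ≤ 1 / 2 := by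
    intro n
    induction n with
    | zero => intro q _; exact ⟨differentiableAt_const _, by simp [rhIter]⟩
    | succ n ih =>
      intro q hq
      have g := good _ ih
      refine ⟨Q.PR_diff hΩ g hq.2 hq.1, ?_⟩
      refine (Q.PR_bound (M := 2 * ε) (fun w hw => g.2 (w, q.2) ⟨hw, hq.2⟩) hq.1).trans ?_
      linarith
  have hdist : ∀ b c : ℂ × E → R, (∀ q ∈ Q.OR ×ˢ Ω, DifferentiableAt ℂ b q ∧ ‖b q‖ ≤ 1 / 2) →
      (∀ q ∈ Q.OR ×ˢ Ω, DifferentiableAt ℂ c q ∧ ‖c q‖ ≤ 1 / 2) → ∀ d, 0 ≤ d →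
      (∀ q ∈ Q.OR ×ˢ Ω, ‖b q - c q‖ ≤ d) → ∀ q ∈ Q.OR ×ˢ Ω, 
      ‖Q.PR (fun w => (1 + b (w, q.2)) * A (w, q.2)) q.1 - Q.PR (fun w => (1 + c (w, q.2)) * A (w, q.2)) q.1‖ ≤ d / 4 := by
    intro b c h1 h2 d hd hbc q hq
    have g1 := good b h1
    have g2 := good c h2
    rw [← Q.PR_sub (g1.slice_cont hq.2) (g2.slice_cont hq.2) (fun w hw => g1.2 (w, q.2) ⟨hw, hq.2⟩)
      (fun w hw => g2.2 (w, q.2) ⟨hw, hq.2⟩)]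
    refine (Q.PR_bound (M := d * ε) (fun w hw => ?_) hq.1).trans ?_
    · rw [← sub_mul, add_sub_add_left_eq_sub]
      exact (norm_mul_le _ _).trans (mul_le_mul (hbc _ ⟨Q.O_sub_OR hw, hq.2⟩) (hA.2 _ ⟨hw, hq.2⟩) (norm_nonneg _) hd)
    · nlinarith
  have hstep : ∀ n, ∀ q ∈ Q.OR ×ˢ Ω, dist (Q.rhIter A n q) (Q.rhIter A (n+1) q) ≤ 1 / 2 * (1/4) ^ n := by
    intro n
    induction n with
    | zero => intro q hq; simpa [rhIter] using (hb 1 q hq).2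
    | succ n ih =>
      intro q hq
      have := hdist _ _ (hb n) (hb (n+1)) (1 / 2 * (1/4) ^ n) (by positivity) (fun q hq => by
        rw [← dist_eq_norm]; exact ih q hq) q hq
      rw [dist_eq_norm]
      refine this.trans (le_of_eq ?_)
      rw [pow_succ]; ring
  have hlim : ∀ q ∈ Q.OR ×ˢ Ω, ∃ L, Tendsto (fun n => Q.rhIter A n q) atTop (𝓝 L) := fun q hq =>
    cauchySeq_tendsto_of_complete (cauchySeq_of_le_geometric (1/4) (1/2) (by norm_num) (fun n => hstep n q hq))
  choose! b hbl using hlim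
  have hrate : ∀ n, ∀ q ∈ Q.OR ×ˢ Ω, dist (Q.rhIter A n q) (b q) ≤ (1/4) ^ n := by
    intro n q hq
    have := dist_le_of_le_geometric_of_tendsto (1/4) (1/2) (by norm_num) (fun n => hstep n q hq) (hbl q hq) n
    refine this.trans ?_
    have : (0:ℝ) < (1/4)^n := by positivity
    rw [div_le_iff₀ (by norm_num)]; linarith
  have hp4 : Tendsto (fun n : ℕ => ((1:ℝ)/4)^n) atTop (𝓝 0) :=
    tendsto_pow_atTop_nhds_zero_of_lt_one (by norm_num) (by norm_num)
  have hunif : TendstoUniformlyOn (Q.rhIter A) b atTop (Q.OR ×ˢ Ω) := by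
    rw [Metric.tendstoUniformlyOn_iff]
    intro e he
    filter_upwards [hp4.eventually (gt_mem_nhds he)] with n hn q hq
    rw [dist_comm]; exact (hrate n q hq).trans_lt hn
  have hopen : IsOpen (Q.OR ×ˢ Ω) := Q.isOpen_OR.prod hΩ
  have hbb : ∀ q ∈ Q.OR ×ˢ Ω, DifferentiableAt ℂ b q ∧ ‖b q‖ ≤ 1 / 2 := fun q hq =>
    ⟨differentiableAt_of_uniform_limit hopen (fun n z hz => (hb n z hz).1) hunif hq,
      le_of_tendsto (hbl q hq).norm (Eventually.of_forall fun n => (hb n q hq).2)⟩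
  have hfix : ∀ q ∈ Q.OR ×ˢ Ω, b q = Q.PR (fun w => (1 + b (w, q.2)) * A (w, q.2)) q.1 := by
    intro q hq
    refine tendsto_nhds_unique ((tendsto_add_atTop_iff_nat 1).2 (hbl q hq)) ?_
    rw [tendsto_iff_dist_tendsto_zero]
    have h0 := hp4.div_const 4
    rw [zero_div] at h0
    refine squeeze_zero (fun _ => dist_nonneg) (fun n => ?_) h0
    rw [dist_eq_norm]
    exact hdist _ _ (hb n) hbb ((1/4) ^ n) (by positivity) (fun q hq => by
        rw [← dist_eq_norm]; exact hrate n q hq) q hq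
  have g := good b hbb
  refine ⟨fun q => 1 + Q.PL (fun w => (1 + b (w, q.2)) * A (w, q.2)) q.1, fun q => 1 + b q,
    fun q hq => ⟨(Q.PL_diff hΩ g hq.2 hq.1).const_add 1, ?_⟩,
    fun q hq => ⟨(hbb q hq).1.const_add 1, by simpa using (hbb q hq).2⟩, fun q hq => ?_⟩
  · rw [add_sub_cancel_left]
    refine (Q.PL_bound (M := 2 * ε) (fun w hw => g.2 (w, q.2) ⟨hw, hq.2⟩) hq.1).trans ?_
    linarith
  · have h1 := hfix q ⟨Q.O_sub_OR hq.1, hq.2⟩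
    have h2 := Q.PL_sub_PR (fun w => (1 + b (w, q.2)) * A (w, q.2)) q.1
    rw [← h1] at h2
    simp only [Prod.mk.eta] at h2 ⊢
    rw [mul_add, mul_one, ← h2]; abel

end rh

section runge
variable {E F : Type*} [NormedAddCommGroup E] [NormedSpace ℂ E]
  [NormedAddCommGroup F] [NormedSpace ℂ F]

/-- truncated geometric kernel -/
def gk (b : ℂ) (N : ℕ) (ζ z : ℂ) : ℂ := ∑ n ∈ Finset.range N, (z - b) ^ n * ((ζ - b)⁻¹) ^ (n + 1)

lemma gk_err {b ζ z : ℂ} (N : ℕ) (h1 : ζ ≠ b) (h2 : ζ ≠ z) :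
    (ζ - z)⁻¹ - gk b N ζ z = ((z - b) * (ζ - b)⁻¹) ^ N * (ζ - z)⁻¹ := by
  have h1' := sub_ne_zero.2 h1
  have h2' := sub_ne_zero.2 h2
  induction N with
  | zero => simp [gk]
  | succ N ih =>
    have : gk b (N+1) ζ z = gk b N ζ z + (z - b) ^ N * ((ζ - b)⁻¹) ^ (N + 1) := Finset.sum_range_succ _ _
    rw [this, ← sub_sub, ih]
    rw [mul_pow, mul_pow]
    have : (z - b) = (ζ - b) - (ζ - z) := by ring
    have e : (ζ - z)⁻¹ - (ζ - b)⁻¹ = (z - b) * (ζ - b)⁻¹ * (ζ - z)⁻¹ := by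
      field_simp; ring
    linear_combination (z - b) ^ N * ((ζ - b)⁻¹) ^ N * e

lemma gk_diff (b : ℂ) (N : ℕ) (ζ : ℂ) (q : ℂ × E) : DifferentiableAt ℂ (fun q : ℂ × E => gk b N ζ q.1) q := by
  unfold gk
  exact DifferentiableAt.fun_sum fun n _ => ((differentiableAt_fst.sub_const b).pow n).mul_const _

set_option maxHeartbeats 1000000 in
theorem runge [FiniteDimensional ℂ E] [CompleteSpace F] {Ω : Set E} (hΩ : IsOpen Ω) {f : ℂ × E → F} {M : ℝ}
    (hM0 : 0 ≤ M)
    (hf : Q.Good Ω f M) {d : ℝ} (hd : d < Q.α) {ε : ℝ} (hε : 0 < ε) :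
    ∃ q : ℂ × E → F, (∀ p ∈ Q.OR ×ˢ Ω, DifferentiableAt ℂ q p) ∧
      ∀ p ∈ Q.OR ×ˢ Ω, p.1.re ≤ d → ‖f p - q p‖ ≤ ε := by
  have hk := Q.kap_pos
  -- choice of the base point
  obtain ⟨R, hR1, hR2, hR3⟩ : ∃ R : ℝ, 0 < d + R ∧ 0 < Q.xL + R ∧ (Q.y1 - Q.y0)^2 + 1 ≤ (Q.α - d) * (Q.α + d + 2 * R) := by
    have h : ∀ᶠ R : ℝ in atTop, (Q.y1 - Q.y0)^2 + 1 ≤ (Q.α - d) * (Q.α + d + 2 * R) := by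
      have : Tendsto (fun R : ℝ => (Q.α - d) * (Q.α + d + 2 * R)) atTop atTop := by
        refine Tendsto.const_mul_atTop (by linarith) ?_
        exact tendsto_atTop_add_const_left _ _ (Tendsto.const_mul_atTop (by norm_num) tendsto_id)
      exact this.eventually_ge_atTop _
    obtain ⟨R, h1, h2, h3⟩ := (h.and ((eventually_gt_atTop (-d)).and (eventually_gt_atTop (-Q.xL)))).exists
    exact ⟨R, by linarith, by linarith, h1⟩
  set b : ℂ := ⟨-R, Q.y0⟩ with hb
  set B := Real.sqrt ((d + R)^2 + (Q.y1 - Q.y0)^2) with hB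
  have hαR : 0 < Q.α + R := by linarith
  have hBlt : B < Q.α + R := by
    rw [hB, Real.sqrt_lt' hαR]; nlinarith
  have hB0 : 0 ≤ B := Real.sqrt_nonneg _
  have hζ : ∀ p ∈ Q.S, Q.α + R ≤ ‖zt p - b‖ := by
    intro p hp
    have b' := (le_abs_self _).trans (Complex.abs_re_le_norm (zt p - b))
    have := hp.1.1
    simp only [Complex.sub_re, zt, hb] at b'
    change _ ≤ ‖zt p - b‖ at b'
    linarith
  have hζ0 : ∀ p ∈ Q.S, zt p ≠ b := fun p hp h => by
    have := hζ p hp; rw [h, sub_self, norm_zero] at this; linarith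
  have hzb : ∀ z ∈ Q.OR, z.re ≤ d → ‖z - b‖ ≤ B := by
    intro z hz hzd
    rw [hB, Complex.norm_eq_sqrt_sq_add_sq]
    refine Real.sqrt_le_sqrt ?_
    simp only [Complex.sub_re, Complex.sub_im, hb]
    have := hz.1; have := hz.2.1; have := hz.2.2
    nlinarith
  set θ := B * (Q.α + R)⁻¹ with hθ
  have hθ0 : 0 ≤ θ := by positivity
  have hθ1 : θ < 1 := by
    rw [hθ, ← div_eq_mul_inv, div_lt_one hαR]; exact hBlt
  obtain ⟨N, hN⟩ : ∃ N : ℕ, θ ^ N * (Q.kap⁻¹ * Q.C0 * M) ≤ ε := by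
    have : Tendsto (fun N : ℕ => θ ^ N * (Q.kap⁻¹ * Q.C0 * M)) atTop (𝓝 (0 * (Q.kap⁻¹ * Q.C0 * M))) :=
      (tendsto_pow_atTop_nhds_zero_of_lt_one hθ0 hθ1).mul_const _
    rw [zero_mul] at this
    obtain ⟨N, hN⟩ := (this.eventually (gt_mem_nhds hε)).exists
    exact ⟨N, hN.le⟩
  have gkm : ∀ z, Measurable (fun p => gk b N (zt p) z) := by
    intro z
    unfold gk
    refine Finset.measurable_sum _ fun n _ => ?_
    exact ((kernel_meas b).pow_const _).const_mul _
  have gkb : ∀ B' z, ‖z - b‖ ≤ B' → ∀ p ∈ Q.S, ‖gk b N (zt p) z‖ ≤ ∑ n ∈ Finset.range N, B' ^ n * ((Q.α + R)⁻¹) ^ (n + 1) := by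
    intro B' z hz p hp
    refine norm_sum_le_of_le _ fun n _ => ?_
    rw [norm_mul, norm_pow, norm_pow, norm_inv]
    have := hζ p hp
    have : 0 ≤ B' := (norm_nonneg _).trans hz
    gcongr
  have gint : ∀ p ∈ Q.OR ×ˢ Ω, Integrable (fun t => gk b N (zt t) p.1 • f (zt t, p.2)) (volume.restrict Q.S) := by
    intro p hp
    refine Integrable.of_bound (C := (∑ n ∈ Finset.range N, ‖p.1 - b‖ ^ n * ((Q.α + R)⁻¹) ^ (n + 1)) * M)
      ((gkm _).aestronglyMeasurable.smul (Q.f_aesm (hf.slice_cont hp.2))) ?_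
    refine (ae_restrict_mem Q.S_meas).mono fun t ht => ?_
    rw [norm_smul]
    refine mul_le_mul (gkb _ _ le_rfl t ht) (hf.2 _ ⟨Q.S_sub ht, hp.2⟩) (norm_nonneg _) ?_
    positivity
  refine ⟨fun p => (Q.kap : ℂ)⁻¹ • (∫ t in Q.S, gk b N (zt t) p.1 • f (zt t, p.2))
    - Q.PR (fun w => f (w, p.2)) p.1, fun p hp => ?_, fun p hp hpd => ?_⟩
  · refine DifferentiableAt.sub (DifferentiableAt.const_smul ?_ _) (Q.PR_diff hΩ hf hp.2 hp.1)
    have hopen : IsOpen (Q.OR ×ˢ Ω) := Q.isOpen_OR.prod hΩ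
    obtain ⟨r, hr, hsub⟩ := Metric.isOpen_iff.1 hopen p hp
    refine param_integral (r := r) (M := (∑ n ∈ Finset.range N, (r + ‖p.1 - b‖) ^ n * ((Q.α + R)⁻¹) ^ (n + 1)) * M) hr ?_ ?_ ?_
    · intro q hq
      exact (gint q (hsub hq)).aestronglyMeasurable
    · refine (ae_restrict_mem Q.S_meas).mono fun t ht q hq => ?_
      have d1 : DifferentiableAt ℂ (fun q : ℂ × E => f (zt t, q.2)) q :=
        DifferentiableAt.comp (g := f) (f := fun q : ℂ × E => (zt t, q.2)) q
          (hf.1 _ ⟨Q.S_sub ht, (hsub hq).2⟩) (by fun_prop)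
      refine DifferentiableAt.smul ?_ d1
      exact gk_diff _ _ _ _
    · refine (ae_restrict_mem Q.S_meas).mono fun t ht q hq => ?_
      rw [norm_smul]
      refine mul_le_mul (gkb _ _ ?_ t ht) (hf.2 _ ⟨Q.S_sub ht, (hsub hq).2⟩) (norm_nonneg _) (by positivity)
      rw [← Prod.mk.eta (p := p), ← ball_prod_same] at hq
      have h1 := hq.1
      rw [mem_ball, dist_eq_norm] at h1
      have := norm_add_le (q.1 - p.1) (p.1 - b)
      rw [sub_add_sub_cancel] at this
      linarith
  · have hchi : Q.chi p.1.re = 0 := Q.chi_left (by linarith)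
    have e : f p = Q.Tt (fun w => f (w, p.2)) p.1 - Q.PR (fun w => f (w, p.2)) p.1 := by
      have := Q.PL_sub_PR (fun w => f (w, p.2)) p.1
      rw [PL, hchi] at this
      simpa using this.symm
    have hcont := hf.slice_cont hp.2
    have hfb : ∀ w ∈ Q.O, ‖f (w, p.2)‖ ≤ M := fun w hw => hf.2 _ ⟨hw, hp.2⟩
    rw [e, sub_sub_sub_cancel_right, Tt, ← smul_sub, ← integral_sub (Q.kf_int hcont hfb _) (gint p hp),
      norm_smul, norm_inv, Complex.norm_real, Real.norm_of_nonneg hk.le]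
    have h1 : Integrable (fun t => (zt t - p.1)⁻¹) (volume.restrict Q.S) := kernel_int Q.S_fin p.1
    have : ‖∫ t in Q.S, ((zt t - p.1)⁻¹ • f (zt t, p.2) - gk b N (zt t) p.1 • f (zt t, p.2))‖ ≤
        ∫ t in Q.S, ‖(zt t - p.1)⁻¹‖ * (θ ^ N * M) := by
      refine norm_integral_le_of_norm_le (h1.norm.mul_const _) ?_
      filter_upwards [ae_restrict_mem Q.S_meas, ae_ne' Q.S p.1] with t ht htne
      rw [← sub_smul, gk_err N (hζ0 t ht) htne, norm_smul, norm_mul, norm_pow, norm_mul, norm_inv (zt t - b)]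
      have a1 : ‖p.1 - b‖ * ‖zt t - b‖⁻¹ ≤ θ := by
        have := hζ t ht
        have := hzb _ hp.1 hpd
        rw [hθ]; gcongr
      have a2 := hfb _ (Q.S_sub ht)
      calc _ ≤ θ ^ N * ‖(zt t - p.1)⁻¹‖ * M := by gcongr
        _ = _ := by ring
    rw [integral_mul_const] at this
    have h3 := Q.C0_spec p.1
    calc _ ≤ Q.kap⁻¹ * ((∫ t in Q.S, ‖(zt t - p.1)⁻¹‖) * (θ ^ N * M)) := by gcongr
      _ ≤ Q.kap⁻¹ * (Q.C0 * (θ ^ N * M)) := by gcongr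
      _ = θ ^ N * (Q.kap⁻¹ * Q.C0 * M) := by ring
      _ ≤ ε := hN

end runge
end Strip
end UC

namespace UC
open Set Filter Topology Metric

section ring
variable {V' V'' : Type*} [NormedAddCommGroup V'] [NormedSpace ℂ V'] [NormedAddCommGroup V''] [NormedSpace ℂ V'']

def e12 (x : V'' →L[ℂ] V') : (V' × V'') →L[ℂ] (V' × V'') :=
  1 + (ContinuousLinearMap.inl ℂ V' V'').comp (x.comp (ContinuousLinearMap.snd ℂ V' V''))
def e21 (x : V' →L[ℂ] V'') : (V' × V'') →L[ℂ] (V' × V'') :=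
  1 + (ContinuousLinearMap.inr ℂ V' V'').comp (x.comp (ContinuousLinearMap.fst ℂ V' V''))

lemma e12_apply (x : V'' →L[ℂ] V') (v : V' × V'') : e12 x v = (v.1 + x v.2, v.2) := by
  simp [e12, Prod.ext_iff]
lemma e21_apply (x : V' →L[ℂ] V'') (v : V' × V'') : e21 x v = (v.1, v.2 + x v.1) := by
  simp [e21, Prod.ext_iff]

lemma e12_inv (x : V'' →L[ℂ] V') : e12 x * e12 (-x) = 1 := by
  ext v <;> simp [e12_apply]
lemma e12_inv' (x : V'' →L[ℂ] V') : e12 (-x) * e12 (x) = 1 := by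
  ext v <;> simp [e12_apply]
lemma e21_inv (x : V' →L[ℂ] V'') : e21 x * e21 (-x) = 1 := by
  ext v <;> simp [e21_apply]
lemma e21_inv' (x : V' →L[ℂ] V'') : e21 (-x) * e21 (x) = 1 := by
  ext v <;> simp [e21_apply]

lemma norm_inlsnd (x : V'' →L[ℂ] V') : 
    ‖(ContinuousLinearMap.inl ℂ V' V'').comp (x.comp (ContinuousLinearMap.snd ℂ V' V''))‖ ≤ ‖x‖ := by
  refine ContinuousLinearMap.opNorm_le_bound _ (norm_nonneg _) fun v => ?_
  simp only [ContinuousLinearMap.comp_apply, ContinuousLinearMap.inl_apply, ContinuousLinearMap.coe_snd', Prod.norm_mk, norm_zero]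
  rw [max_eq_left (norm_nonneg _)]
  exact (x.le_opNorm _).trans (mul_le_mul_of_nonneg_left (norm_snd_le v) (norm_nonneg _))
lemma norm_inrfst (x : V' →L[ℂ] V'') : 
    ‖(ContinuousLinearMap.inr ℂ V' V'').comp (x.comp (ContinuousLinearMap.fst ℂ V' V''))‖ ≤ ‖x‖ := by
  refine ContinuousLinearMap.opNorm_le_bound _ (norm_nonneg _) fun v => ?_
  simp only [ContinuousLinearMap.comp_apply, ContinuousLinearMap.inr_apply, ContinuousLinearMap.coe_fst', Prod.norm_mk, norm_zero]
  rw [max_eq_right (norm_nonneg _)]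
  exact (x.le_opNorm _).trans (mul_le_mul_of_nonneg_left (norm_fst_le v) (norm_nonneg _))

lemma norm_one_le' {V : Type*} [NormedAddCommGroup V] [NormedSpace ℂ V] : ‖(1 : V →L[ℂ] V)‖ ≤ 1 :=
  ContinuousLinearMap.norm_id_le

lemma norm_e12 (x : V'' →L[ℂ] V') : ‖e12 x‖ ≤ 1 + ‖x‖ :=
  (norm_add_le _ _).trans (add_le_add norm_one_le' (norm_inlsnd x))
lemma norm_e21 (x : V' →L[ℂ] V'') : ‖e21 x‖ ≤ 1 + ‖x‖ :=
  (norm_add_le _ _).trans (add_le_add norm_one_le' (norm_inrfst x))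
lemma norm_e12_sub (x y : V'' →L[ℂ] V') : ‖e12 x - e12 y‖ ≤ ‖x - y‖ := by
  have : e12 x - e12 y = (ContinuousLinearMap.inl ℂ V' V'').comp ((x - y).comp (ContinuousLinearMap.snd ℂ V' V'')) := by
    ext v <;> simp [e12_apply]
  rw [this]; exact norm_inlsnd _
lemma norm_e21_sub (x y : V' →L[ℂ] V'') : ‖e21 x - e21 y‖ ≤ ‖x - y‖ := by
  have : e21 x - e21 y = (ContinuousLinearMap.inr ℂ V' V'').comp ((x - y).comp (ContinuousLinearMap.fst ℂ V' V'')) := by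
    ext v <;> simp [e21_apply]
  rw [this]; exact norm_inrfst _

def HH (φ : V' →L[ℂ] V'') (ψ : V'' →L[ℂ] V') : (V' × V'') →L[ℂ] (V' × V'') := e12 (-ψ) * e21 φ * e12 (-ψ)
def HI (φ : V' →L[ℂ] V'') (ψ : V'' →L[ℂ] V') : (V' × V'') →L[ℂ] (V' × V'') := e12 ψ * e21 (-φ) * e12 ψ

lemma HI_HH (φ : V' →L[ℂ] V'') (ψ : V'' →L[ℂ] V') : HI φ ψ * HH φ ψ = 1 := by
  unfold HI HH
  calc _ = e12 ψ * e21 (-φ) * (e12 ψ * e12 (-ψ)) * e21 φ * e12 (-ψ) := by simp only [mul_assoc]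
    _ = e12 ψ * (e21 (-φ) * e21 φ) * e12 (-ψ) := by rw [e12_inv, mul_one]; simp only [mul_assoc]
    _ = 1 := by rw [e21_inv', mul_one, e12_inv]
lemma HH_HI (φ : V' →L[ℂ] V'') (ψ : V'' →L[ℂ] V') : HH φ ψ * HI φ ψ = 1 := by
  unfold HI HH
  calc _ = e12 (-ψ) * e21 φ * (e12 (-ψ) * e12 ψ) * e21 (-φ) * e12 ψ := by simp only [mul_assoc]
    _ = e12 (-ψ) * (e21 φ * e21 (-φ)) * e12 ψ := by rw [e12_inv', mul_one]; simp only [mul_assoc]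
    _ = 1 := by rw [e21_inv, mul_one, e12_inv']

lemma norm_prod3_sub {R : Type*} [NormedRing R] {a b c a' b' c' : R} {B η : ℝ} 
    (ha : ‖a‖ ≤ B) (hb : ‖b‖ ≤ B) (hb' : ‖b'‖ ≤ B) (hc' : ‖c'‖ ≤ B) (ha' : ‖a'‖ ≤ B)
    (h1 : ‖a - a'‖ ≤ η) (h2 : ‖b - b'‖ ≤ η) (h3 : ‖c - c'‖ ≤ η) :
    ‖a * b * c - a' * b' * c'‖ ≤ 3 * η * B ^ 2 := by
  have hB : 0 ≤ B := (norm_nonneg _).trans ha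
  have hη : 0 ≤ η := (norm_nonneg _).trans h1
  have e : a * b * c - a' * b' * c' = a * b * (c - c') + a * (b - b') * c' + (a - a') * b' * c' := by
    noncomm_ring
  rw [e]
  have n3 : ∀ x y z : R, ‖x * y * z‖ ≤ ‖x‖ * ‖y‖ * ‖z‖ := fun x y z =>
    (norm_mul_le _ _).trans (mul_le_mul_of_nonneg_right (norm_mul_le _ _) (norm_nonneg _))
  have t1 : ‖a * b * (c - c')‖ ≤ B * B * η := (n3 _ _ _).trans (by gcongr)
  have t2 : ‖a * (b - b') * c'‖ ≤ B * η * B := (n3 _ _ _).trans (by gcongr)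
  have t3 : ‖(a - a') * b' * c'‖ ≤ η * B * B := (n3 _ _ _).trans (by gcongr)
  refine (norm_add_le _ _).trans ((add_le_add ((norm_add_le _ _).trans (add_le_add t1 t2)) t3).trans (le_of_eq ?_))
  ring

lemma HH_sub {φ q : V' →L[ℂ] V''} {ψ r : V'' →L[ℂ] V'} {M η : ℝ} (h1 : ‖φ‖ ≤ M) (h2 : ‖ψ‖ ≤ M)
    (h3 : ‖φ - q‖ ≤ η) (h4 : ‖ψ - r‖ ≤ η) : 
    ‖HI q r * HH φ ψ - 1‖ ≤ (1 + M + η) ^ 3 * (3 * η * (1 + M + η) ^ 2) := by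
  have hη : 0 ≤ η := (norm_nonneg _).trans h3
  have hM : 0 ≤ M := (norm_nonneg _).trans h1
  have hq : ‖q‖ ≤ M + η := by
    have := norm_sub_norm_le q φ; rw [norm_sub_rev] at this; linarith
  have hr : ‖r‖ ≤ M + η := by
    have := norm_sub_norm_le r ψ; rw [norm_sub_rev] at this; linarith
  have e : HI q r * HH φ ψ - 1 = HI q r * (HH φ ψ - HH q r) := by rw [mul_sub, HI_HH]
  rw [e]
  refine (norm_mul_le _ _).trans (mul_le_mul ?_ ?_ (norm_nonneg _) (by positivity))
  · unfold HI
    have a1 := norm_e12 r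
    have a2 := norm_e21 (-q)
    rw [norm_neg] at a2
    calc _ ≤ ‖e12 r‖ * ‖e21 (-q)‖ * ‖e12 r‖ := (norm_mul_le _ _).trans (mul_le_mul_of_nonneg_right (norm_mul_le _ _) (norm_nonneg _))
      _ ≤ (1 + M + η) * (1 + M + η) * (1 + M + η) := by gcongr <;> linarith
      _ = _ := by ring
  · have b1 := norm_e12 (-ψ)
    have b2 := norm_e12 (-r)
    have b3 := norm_e21 φ
    have b4 := norm_e21 q
    have b5 := norm_e12_sub (-ψ) (-r)
    have b6 := norm_e21_sub φ q
    rw [norm_neg] at b1 b2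
    rw [neg_sub_neg, norm_sub_rev r ψ] at b5
    exact norm_prod3_sub (by linarith) (by linarith) (by linarith) (by linarith) (by linarith) (by linarith) (by linarith) (by linarith)

variable {E : Type*} [NormedAddCommGroup E] [NormedSpace ℂ E]
lemma e12_diff {f : E → V'' →L[ℂ] V'} {z : E} (h : DifferentiableAt ℂ f z) : DifferentiableAt ℂ (fun z => e12 (f z)) z := by
  unfold e12
  exact (DifferentiableAt.clm_comp (differentiableAt_const _) (h.clm_comp (differentiableAt_const _))).const_add _
lemma e21_diff {f : E → V' →L[ℂ] V''} {z : E} (h : DifferentiableAt ℂ f z) : DifferentiableAt ℂ (fun z => e21 (f z)) z := by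
  unfold e21
  exact (DifferentiableAt.clm_comp (differentiableAt_const _) (h.clm_comp (differentiableAt_const _))).const_add _
lemma HH_diff {f : E → V' →L[ℂ] V''} {g : E → V'' →L[ℂ] V'} {z : E} (h : DifferentiableAt ℂ f z) (h' : DifferentiableAt ℂ g z) :
    DifferentiableAt ℂ (fun z => HH (f z) (g z)) z := by
  unfold HH
  exact ((e12_diff h'.neg).mul (e21_diff h)).mul (e12_diff h'.neg)
lemma HI_diff {f : E → V' →L[ℂ] V''} {g : E → V'' →L[ℂ] V'} {z : E} (h : DifferentiableAt ℂ f z) (h' : DifferentiableAt ℂ g z) :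
    DifferentiableAt ℂ (fun z => HI (f z) (g z)) z := by
  unfold HI
  exact ((e12_diff h').mul (e21_diff h.neg)).mul (e12_diff h')

lemma near_one_inv {R : Type*} [NormedRing R] [NormedAlgebra ℂ R] [CompleteSpace R] {X : E → R} {z : E} 
    (h : DifferentiableAt ℂ X z) (h1 : ‖X z - 1‖ ≤ 1/2) :
    DifferentiableAt ℂ (fun z => Ring.inverse (X z)) z ∧ Ring.inverse (X z) * X z = 1 ∧ X z * Ring.inverse (X z) = 1 := by
  have hu : IsUnit (X z) := by
    have := isUnit_one_sub_of_norm_lt_one (x := 1 - X z) (by rw [norm_sub_rev]; linarith)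
    simpa using this
  obtain ⟨u, hu'⟩ := hu
  refine ⟨?_, Ring.inverse_mul_cancel _ ⟨u, hu'⟩, Ring.mul_inverse_cancel _ ⟨u, hu'⟩⟩
  have := differentiableAt_inverse (𝕜 := ℂ) (x := X z) ⟨u, hu'⟩
  exact this.comp z h
end ring

section prod
variable {E : Type*} [NormedAddCommGroup E] [NormedSpace ℂ E] [FiniteDimensional ℂ E]
variable {V' V'' : Type*} [NormedAddCommGroup V'] [NormedSpace ℂ V'] [NormedAddCommGroup V''] [NormedSpace ℂ V'']
  [CompleteSpace V'] [CompleteSpace V'']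

theorem factor_prod {c δ y0 y1 : ℝ} (hδ : 0 < δ) (hy : y0 < y1) {Ω : Set E} (hΩ : IsOpen Ω)
    {φ : ℂ × E → V' →L[ℂ] V''} {ψ : ℂ × E → V'' →L[ℂ] V'} {M : ℝ}
    (hM : ∀ ζ r, |ζ.re - c| < δ → y0 < ζ.im → ζ.im < y1 → r ∈ Ω → 
      DifferentiableAt ℂ φ (ζ, r) ∧ DifferentiableAt ℂ ψ (ζ, r) ∧ ‖φ (ζ, r)‖ ≤ M ∧ ‖ψ (ζ, r)‖ ≤ M) :
    ∃ δ' > 0, ∃ Y' Z' Y'' Z'' : ℂ × E → (V' × V'') →L[ℂ] (V' × V''),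
      (∀ ζ r, ζ.re < c + δ' → y0 < ζ.im → ζ.im < y1 → r ∈ Ω → DifferentiableAt ℂ Y' (ζ, r) ∧
        DifferentiableAt ℂ Z' (ζ, r) ∧ Y' (ζ, r) * Z' (ζ, r) = 1 ∧ Z' (ζ, r) * Y' (ζ, r) = 1) ∧
      (∀ ζ r, c - δ' < ζ.re → y0 < ζ.im → ζ.im < y1 → r ∈ Ω → DifferentiableAt ℂ Y'' (ζ, r) ∧
        DifferentiableAt ℂ Z'' (ζ, r) ∧ Y'' (ζ, r) * Z'' (ζ, r) = 1 ∧ Z'' (ζ, r) * Y'' (ζ, r) = 1) ∧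
      (∀ ζ r, |ζ.re - c| < δ' → y0 < ζ.im → ζ.im < y1 → r ∈ Ω → 
        HH (φ (ζ, r)) (ψ (ζ, r)) * Y' (ζ, r) = Y'' (ζ, r)) := by
  rcases Ω.eq_empty_or_nonempty with h | ⟨r0, hr0⟩
  · subst h
    exact ⟨1, one_pos, 0, 0, 0, 0, by simp, by simp, by simp⟩
  have hM0 : 0 ≤ M := (norm_nonneg _).trans (hM ⟨c, (y0 + y1) / 2⟩ r0 (by simpa using hδ) (by simp; linarith) (by simp; linarith) hr0).2.2.1
  let Q1 : Strip := ⟨c - δ, c + δ / 3, c + 2 * δ / 3, c + δ, y0, y1, by linarith, by linarith, by linarith, hy⟩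
  let Q2 : Strip := ⟨c - δ/6, c - δ / 12, c + δ / 12, c + δ/6, y0, y1, by linarith, by linarith, by linarith, hy⟩
  have hO : ∀ z ∈ Q1.O, |z.re - c| < δ ∧ y0 < z.im ∧ z.im < y1 := fun z hz => by
    have h1 : c - δ < z.re := hz.1
    have h2 : z.re < c + δ := hz.2.1
    exact ⟨by rw [abs_lt]; constructor <;> linarith, hz.2.2⟩
  have gφ : Q1.Good Ω φ M := ⟨fun q hq => (hM q.1 q.2 (hO _ hq.1).1 (hO _ hq.1).2.1 (hO _ hq.1).2.2 hq.2).1,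
    fun q hq => (hM q.1 q.2 (hO _ hq.1).1 (hO _ hq.1).2.1 (hO _ hq.1).2.2 hq.2).2.2.1⟩
  have gψ : Q1.Good Ω ψ M := ⟨fun q hq => (hM q.1 q.2 (hO _ hq.1).1 (hO _ hq.1).2.1 (hO _ hq.1).2.2 hq.2).2.1,
    fun q hq => (hM q.1 q.2 (hO _ hq.1).1 (hO _ hq.1).2.1 (hO _ hq.1).2.2 hq.2).2.2.2⟩
  have hC := Q2.C1_pos
  obtain ⟨η, hη0, hη⟩ : ∃ η > 0, Q2.C1 * ((1 + M + η) ^ 3 * (3 * η * (1 + M + η) ^ 2)) ≤ 1/4 := by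
    have : Tendsto (fun η : ℝ => Q2.C1 * ((1 + M + η) ^ 3 * (3 * η * (1 + M + η) ^ 2))) (𝓝[>] 0) (𝓝 0) := by
      refine Tendsto.mono_left ?_ nhdsWithin_le_nhds
      have : Continuous (fun η : ℝ => Q2.C1 * ((1 + M + η) ^ 3 * (3 * η * (1 + M + η) ^ 2))) := by fun_prop
      simpa using this.tendsto 0
    obtain ⟨η, h1, h2⟩ := ((this.eventually (gt_mem_nhds (show (0:ℝ) < 1/4 by norm_num))).and self_mem_nhdsWithin).exists
    exact ⟨η, h2, h1.le⟩
  have hdα : c + δ / 6 < Q1.α := by change c + δ/6 < c + δ/3; linarith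
  obtain ⟨q, hq1, hq2⟩ := Q1.runge hΩ hM0 gφ hdα hη0
  obtain ⟨r, hr1, hr2⟩ := Q1.runge hΩ hM0 gψ hdα hη0
  have hORs : Q2.OR ⊆ Q1.OR := fun z hz => ⟨by have : c - δ/6 < z.re := hz.1; change c - δ < z.re; linarith, hz.2⟩
  have hOs : Q2.O ⊆ Q1.O := fun z hz => ⟨(hORs (Q2.O_sub_OR hz)).1, by 
    have : z.re < c + δ/6 := hz.2.1; change z.re < c + δ; linarith, hz.2.2⟩
  have hA : Q2.Good Ω (fun p => HI (q p) (r p) * HH (φ p) (ψ p) - 1) ((1 + M + η) ^ 3 * (3 * η * (1 + M + η) ^ 2)) := by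
    refine ⟨fun p hp => ?_, fun p hp => ?_⟩
    · have hp1 : p ∈ Q1.O ×ˢ Ω := ⟨hOs hp.1, hp.2⟩
      have hp2 : p ∈ Q1.OR ×ˢ Ω := ⟨Q1.O_sub_OR hp1.1, hp.2⟩
      exact ((HI_diff (hq1 p hp2) (hr1 p hp2)).mul (HH_diff (gφ.1 p hp1) (gψ.1 p hp1))).sub_const _
    · have hp1 : p ∈ Q1.O ×ˢ Ω := ⟨hOs hp.1, hp.2⟩
      have hp2 : p ∈ Q1.OR ×ˢ Ω := ⟨Q1.O_sub_OR hp1.1, hp.2⟩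
      have hre : p.1.re < c + δ/6 := hp.1.2.1
      exact HH_sub (gφ.2 p hp1) (gψ.2 p hp1) (hq2 p hp2 hre.le) (hr2 p hp2 hre.le)
  obtain ⟨X', X'', h1, h2, h3⟩ := Q2.rh norm_one_le' hΩ (by positivity) hη hA
  refine ⟨δ/6, by positivity, fun p => Ring.inverse (X' p), X', fun p => HH (q p) (r p) * Ring.inverse (X'' p),
    fun p => X'' p * HI (q p) (r p), fun ζ p a b c' d => ?_, fun ζ p a b c' d => ?_, fun ζ p a b c' d => ?_⟩
  · obtain ⟨k1, k2⟩ := h1 (ζ, p) ⟨⟨a, b, c'⟩, d⟩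
    obtain ⟨k3, k4, k5⟩ := near_one_inv k1 k2
    exact ⟨k3, k1, k4, k5⟩
  · have hp2 : (ζ, p) ∈ Q2.OR ×ˢ Ω := ⟨⟨a, b, c'⟩, d⟩
    have hp1 : (ζ, p) ∈ Q1.OR ×ˢ Ω := ⟨hORs hp2.1, d⟩
    obtain ⟨k1, k2⟩ := h2 (ζ, p) hp2
    obtain ⟨k3, k4, k5⟩ := near_one_inv k1 k2
    refine ⟨(HH_diff (hq1 _ hp1) (hr1 _ hp1)).mul k3, k1.mul (HI_diff (hq1 _ hp1) (hr1 _ hp1)), ?_, ?_⟩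
    · rw [mul_assoc, ← mul_assoc (Ring.inverse _), k4, one_mul, HH_HI]
    · rw [mul_assoc, ← mul_assoc (HI _ _), HI_HH, one_mul, k5]
  · rw [abs_lt] at a
    have hp : (ζ, p) ∈ Q2.O ×ˢ Ω := ⟨⟨show c - δ/6 < ζ.re by linarith, show ζ.re < c + δ/6 by linarith, b, c'⟩, d⟩
    have hpl : (ζ, p) ∈ Q2.OL ×ˢ Ω := ⟨Q2.O_sub_OL hp.1, d⟩
    have hpr : (ζ, p) ∈ Q2.OR ×ˢ Ω := ⟨Q2.O_sub_OR hp.1, d⟩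
    obtain ⟨k1, k2⟩ := h1 (ζ, p) hpl
    obtain ⟨-, k4, k5⟩ := near_one_inv k1 k2
    obtain ⟨k1', k2'⟩ := h2 (ζ, p) hpr
    obtain ⟨-, k4', k5'⟩ := near_one_inv k1' k2'
    have h := h3 _ hp
    rw [add_sub_cancel] at h
    change HH _ _ * Ring.inverse (X' _) = HH _ _ * Ring.inverse (X'' _)
    have e1 : Ring.inverse (X'' (ζ, p)) = HI (q (ζ, p)) (r (ζ, p)) * HH (φ (ζ, p)) (ψ (ζ, p)) * Ring.inverse (X' (ζ, p)) := by
      calc _ = Ring.inverse (X'' (ζ, p)) * (X' (ζ, p) * Ring.inverse (X' (ζ, p))) := by rw [k5, mul_one]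
        _ = Ring.inverse (X'' (ζ, p)) * X'' (ζ, p) * (HI (q (ζ, p)) (r (ζ, p)) * HH (φ (ζ, p)) (ψ (ζ, p))) * Ring.inverse (X' (ζ, p)) := by
            rw [← h]; simp only [mul_assoc]
        _ = _ := by rw [k4', one_mul]
    rw [e1, ← mul_assoc, ← mul_assoc, HH_HI, one_mul]

theorem cousin_prod {F : Type*} [NormedAddCommGroup F] [NormedSpace ℂ F] [CompleteSpace F]
    {c δ y0 y1 : ℝ} (hδ : 0 < δ) (hy : y0 < y1) {Ω : Set E} (hΩ : IsOpen Ω)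
    {f : ℂ × E → F} {M : ℝ}
    (hM : ∀ ζ r, |ζ.re - c| < δ → y0 < ζ.im → ζ.im < y1 → r ∈ Ω → 
      DifferentiableAt ℂ f (ζ, r) ∧ ‖f (ζ, r)‖ ≤ M) :
    ∃ f' f'' : ℂ × E → F,
      (∀ ζ r, ζ.re < c + δ → y0 < ζ.im → ζ.im < y1 → r ∈ Ω → DifferentiableAt ℂ f' (ζ, r)) ∧
      (∀ ζ r, c - δ < ζ.re → y0 < ζ.im → ζ.im < y1 → r ∈ Ω → DifferentiableAt ℂ f'' (ζ, r)) ∧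
      ∀ q, f q = f' q - f'' q := by
  let Q1 : Strip := ⟨c - δ, c - δ / 3, c + δ / 3, c + δ, y0, y1, by linarith, by linarith, by linarith, hy⟩
  have hO : ∀ z ∈ Q1.O, |z.re - c| < δ ∧ y0 < z.im ∧ z.im < y1 := fun z hz => by
    have h1 : c - δ < z.re := hz.1
    have h2 : z.re < c + δ := hz.2.1
    exact ⟨by rw [abs_lt]; constructor <;> linarith, hz.2.2⟩
  have gf : Q1.Good Ω f M := ⟨fun q hq => (hM q.1 q.2 (hO _ hq.1).1 (hO _ hq.1).2.1 (hO _ hq.1).2.2 hq.2).1,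
    fun q hq => (hM q.1 q.2 (hO _ hq.1).1 (hO _ hq.1).2.1 (hO _ hq.1).2.2 hq.2).2⟩
  refine ⟨fun q => Q1.PL (fun w => f (w, q.2)) q.1, fun q => Q1.PR (fun w => f (w, q.2)) q.1, 
    fun ζ r a b c d => Q1.PL_diff hΩ gf (z := ζ) d ⟨a, b, c⟩, fun ζ r a b c d => Q1.PR_diff hΩ gf (z := ζ) d ⟨a, b, c⟩, fun q => ?_⟩
  exact (Q1.PL_sub_PR (fun w => f (w, q.2)) q.1).symm
end prod
end UC

namespace UC
open Set Filter Topology Metric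

section holnear
variable {E F G : Type*} [NormedAddCommGroup E] [NormedSpace ℂ E] [NormedAddCommGroup F] [NormedSpace ℂ F]
  [NormedAddCommGroup G] [NormedSpace ℂ G]

def HolNear (f : E → F) (S : Set E) : Prop := ∀ᶠ z in 𝓝ˢ S, DifferentiableAt ℂ f z

lemma HolNear.mono {f : E → F} {S S' : Set E} (h : HolNear f S) (hs : S' ⊆ S) : HolNear f S' :=
  Filter.Eventually.filter_mono (nhdsSet_mono hs) h

lemma ev_nested {X : Type*} [TopologicalSpace X] {S : Set X} {p : X → Prop} (h : ∀ᶠ z in 𝓝ˢ S, p z) : ∀ᶠ z in 𝓝ˢ S, ∀ᶠ w in 𝓝 z, p w := by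
  rw [eventually_nhdsSet_iff_forall] at h ⊢
  exact fun x hx => eventually_eventually_nhds.2 (h x hx)

lemma HolNear.congr {f g : E → F} {S : Set E} (h : HolNear f S) (hg : ∀ᶠ z in 𝓝ˢ S, g z = f z) : HolNear g S := by
  filter_upwards [h, ev_nested hg] with z h1 h2
  exact h1.congr_of_eventuallyEq h2

lemma HolNear.comp {f : E → F} {g : G → E} {S : Set E} {S' : Set G} (h : HolNear f S) (hg : Differentiable ℂ g) 
    (hm : MapsTo g S' S) : HolNear (fun z => f (g z)) S' := by
  have := (hg.continuous.tendsto_nhdsSet hm).eventually h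
  filter_upwards [this] with z hz
  exact hz.comp z (hg z)

lemma HolNear.of_isOpen {f : E → F} {S U : Set E} (hU : IsOpen U) (hS : S ⊆ U) (h : ∀ z ∈ U, DifferentiableAt ℂ f z) : HolNear f S :=
  Filter.mem_of_superset (hU.mem_nhdsSet.2 hS) h

lemma ev_of_isOpen {S U : Set E} {p : E → Prop} (hU : IsOpen U) (hS : S ⊆ U) (h : ∀ z ∈ U, p z) : ∀ᶠ z in 𝓝ˢ S, p z :=
  Filter.mem_of_superset (hU.mem_nhdsSet.2 hS) h

lemma glue_germs {X Y : Type*} [TopologicalSpace X] [T2Space X] {K' K'' : Set X} (h' : IsCompact K') (h'' : IsCompact K'') {f' f'' : X → Y}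
    (h : ∀ᶠ z in 𝓝ˢ (K' ∩ K''), f' z = f'' z) : ∃ f : X → Y, (∀ᶠ z in 𝓝ˢ K', f z = f' z) ∧ (∀ᶠ z in 𝓝ˢ K'', f z = f'' z) := by
  classical
  rw [h'.nhdsSet_inter_eq h''] at h
  obtain ⟨U, hU, V, hV, hUV⟩ := Filter.eventually_inf.1 h
  refine ⟨fun z => if z ∈ U then f' z else f'' z, ?_, ?_⟩
  · filter_upwards [hU] with z hz; simp [hz]
  · filter_upwards [hV] with z hz
    by_cases hzU : z ∈ U
    · simp [hzU, hUV z ⟨hzU, hz⟩]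
    · simp [hzU]

variable [FiniteDimensional ℂ E]

theorem slice_tube {f : E → F} {S D : Set E} (hf : HolNear f S) (hD : IsCompact D) (ℓ : E →L[ℂ] ℂ) (e : E) {c Y0 Y1 : ℝ} (hY : Y0 ≤ Y1)
    (hS : ∀ r ∈ D, ∀ ζ : ℂ, ζ.re = c → Y0 ≤ ζ.im → ζ.im ≤ Y1 → r + (ζ - ℓ r) • e ∈ S) :
    ∃ δ > 0, ∃ Ω : Set E, IsOpen Ω ∧ D ⊆ Ω ∧ ∃ M, ∀ ζ : ℂ, ∀ r : E, |ζ.re - c| < δ → Y0 - δ < ζ.im → ζ.im < Y1 + δ → r ∈ Ω → 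
      DifferentiableAt ℂ (fun q : ℂ × E => f (q.2 + (q.1 - ℓ q.2) • e)) (ζ, r) ∧ ‖f (r + (ζ - ℓ r) • e)‖ ≤ M := by
  set g : (ℝ × ℝ) × E → E := fun q => q.2 + (zt q.1 - ℓ q.2) • e with hg
  have hgc : Continuous g := by
    have := continuous_zt
    fun_prop
  have hC1 : IsCompact (({c} : Set ℝ) ×ˢ Icc Y0 Y1) := isCompact_singleton.prod isCompact_Icc
  have hC : IsCompact ((({c} : Set ℝ) ×ˢ Icc Y0 Y1) ×ˢ D) := hC1.prod hD
  have hsub : g '' ((({c} : Set ℝ) ×ˢ Icc Y0 Y1) ×ˢ D) ⊆ S := by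
    rintro _ ⟨⟨⟨x, y⟩, r⟩, ⟨⟨h1, h2⟩, h3⟩, rfl⟩
    exact hS r h3 _ h1 h2.1 h2.2
  have hf1 : HolNear f (g '' ((({c} : Set ℝ) ×ˢ Icc Y0 Y1) ×ˢ D)) := hf.mono hsub
  have hcont : ContinuousOn f (g '' ((({c} : Set ℝ) ×ˢ Icc Y0 Y1) ×ˢ D)) := fun z hz =>
    ((eventually_nhdsSet_iff_forall.1 hf1 z hz).self_of_nhds).continuousAt.continuousWithinAt
  obtain ⟨M, hM⟩ := (hC.image hgc).exists_bound_of_continuousOn hcont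
  have hN : ∀ᶠ z in 𝓝ˢ (g '' ((({c} : Set ℝ) ×ˢ Icc Y0 Y1) ×ˢ D)), DifferentiableAt ℂ f z ∧ ‖f z‖ < M + 1 := by
    refine hf1.and ?_
    rw [eventually_nhdsSet_iff_forall]
    intro z hz
    have hc : ContinuousAt f z := ((eventually_nhdsSet_iff_forall.1 hf1 z hz).self_of_nhds).continuousAt
    exact hc.norm.eventually (gt_mem_nhds ((hM z hz).trans_lt (lt_add_one _)))
  have hpre := (hgc.tendsto_nhdsSet (mapsTo_image _ _)).eventually hN
  obtain ⟨N, hNo, hNs, hNp⟩ := mem_nhdsSet_iff_exists.1 hpre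
  obtain ⟨u, v, hu, hv, h1, h2, h3⟩ := generalized_tube_lemma hC1 hD hNo hNs
  obtain ⟨δ, hδ, hδu⟩ := hC1.exists_thickening_subset_open hu h1
  refine ⟨δ, hδ, v, hv, h2, M + 1, fun ζ r a b c' d => ?_⟩
  have hmem : ((ζ.re, ζ.im), r) ∈ u ×ˢ v := by
    refine ⟨hδu ?_, d⟩
    rw [mem_thickening_iff]
    refine ⟨(c, max Y0 (min Y1 ζ.im)), ⟨rfl, le_max_left _ _, max_le hY (min_le_left _ _)⟩, ?_⟩
    rw [Prod.dist_eq, max_lt_iff]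
    refine ⟨by rw [Real.dist_eq]; exact a, ?_⟩
    rw [Real.dist_eq, abs_lt]
    constructor
    · rcases max_cases Y0 (min Y1 ζ.im) with h | h <;> rcases min_cases Y1 ζ.im with h' | h' <;> linarith
    · rcases max_cases Y0 (min Y1 ζ.im) with h | h <;> rcases min_cases Y1 ζ.im with h' | h' <;> linarith
  have hz := hNp (h3 hmem)
  simp only [mem_setOf_eq, hg] at hz
  have hzt : zt (ζ.re, ζ.im) = ζ := rfl
  rw [hzt] at hz
  refine ⟨?_, hz.2.le⟩
  exact DifferentiableAt.comp (g := f) (f := fun q : ℂ × E => (q.2 + (q.1 - ℓ q.2) • e)) (ζ, r) hz.1 (by fun_prop)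

lemma slice_pull {f : ℂ × E → F} {S : Set E} (ℓ : E →L[ℂ] ℂ) {U : Set E} (hU : IsOpen U) (hS : S ⊆ U)
    (h : ∀ r ∈ U, DifferentiableAt ℂ f (ℓ r, r)) : HolNear (fun r => f (ℓ r, r)) S :=
  HolNear.of_isOpen hU hS fun r hr => DifferentiableAt.comp (g := f) (f := fun r : E => (ℓ r, r)) r (h r hr) (by fun_prop)

lemma op_lt (ℓ : E →L[ℂ] ℂ) {Ω : Set E} (hΩ : IsOpen Ω) (a b c : ℝ) : 
    IsOpen {r : E | (ℓ r).re < a ∧ b < (ℓ r).im ∧ (ℓ r).im < c ∧ r ∈ Ω} := by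
  have h1 : Continuous fun r => (ℓ r).re := by fun_prop
  have h2 : Continuous fun r => (ℓ r).im := by fun_prop
  exact (isOpen_lt h1 continuous_const).inter ((isOpen_lt continuous_const h2).inter ((isOpen_lt h2 continuous_const).inter hΩ))
lemma op_gt (ℓ : E →L[ℂ] ℂ) {Ω : Set E} (hΩ : IsOpen Ω) (a b c : ℝ) : 
    IsOpen {r : E | a < (ℓ r).re ∧ b < (ℓ r).im ∧ (ℓ r).im < c ∧ r ∈ Ω} := by
  have h1 : Continuous fun r => (ℓ r).re := by fun_prop
  have h2 : Continuous fun r => (ℓ r).im := by fun_prop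
  exact (isOpen_lt continuous_const h1).inter ((isOpen_lt continuous_const h2).inter ((isOpen_lt h2 continuous_const).inter hΩ))
lemma op_abs (ℓ : E →L[ℂ] ℂ) {Ω : Set E} (hΩ : IsOpen Ω) (a d b c : ℝ) : 
    IsOpen {r : E | |(ℓ r).re - a| < d ∧ b < (ℓ r).im ∧ (ℓ r).im < c ∧ r ∈ Ω} := by
  have h1 : Continuous fun r => |(ℓ r).re - a| := by fun_prop
  have h2 : Continuous fun r => (ℓ r).im := by fun_prop
  exact (isOpen_lt h1 continuous_const).inter ((isOpen_lt continuous_const h2).inter ((isOpen_lt h2 continuous_const).inter hΩ))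

theorem cousin_slice [CompleteSpace F] {f : E → F} {S D : Set E} (hf : HolNear f S) (hD : IsCompact D) (ℓ : E →L[ℂ] ℂ) (e : E) 
    {c Y0 Y1 : ℝ} (hY : Y0 ≤ Y1)
    (hS : ∀ r ∈ D, ∀ ζ : ℂ, ζ.re = c → Y0 ≤ ζ.im → ζ.im ≤ Y1 → r + (ζ - ℓ r) • e ∈ S) 
    (him : ∀ r ∈ D, Y0 ≤ (ℓ r).im ∧ (ℓ r).im ≤ Y1)
    {D' D'' D0 : Set E} (h' : ∀ r ∈ D', r ∈ D ∧ (ℓ r).re ≤ c) (h'' : ∀ r ∈ D'', r ∈ D ∧ c ≤ (ℓ r).re) 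
    (h0 : ∀ r ∈ D0, r ∈ D ∧ (ℓ r).re = c) :
    ∃ f' f'' : E → F, HolNear f' D' ∧ HolNear f'' D'' ∧ ∀ᶠ z in 𝓝ˢ D0, f z = f' z - f'' z := by
  obtain ⟨δ, hδ, Ω, hΩ, hDΩ, M, hM⟩ := slice_tube hf hD ℓ e hY hS
  obtain ⟨g', g'', k1, k2, k3⟩ := cousin_prod hδ (by linarith : Y0 - δ < Y1 + δ) hΩ (f := fun q : ℂ × E => f (q.2 + (q.1 - ℓ q.2) • e)) hM
  refine ⟨fun r => g' (ℓ r, r), fun r => g'' (ℓ r, r), ?_, ?_, ?_⟩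
  · refine slice_pull ℓ (op_lt ℓ hΩ (c + δ) (Y0 - δ) (Y1 + δ)) (fun r hr => ?_) fun r hr => k1 _ _ hr.1 hr.2.1 hr.2.2.1 hr.2.2.2
    obtain ⟨a, b⟩ := h' r hr
    have := him r a
    exact ⟨by linarith, by linarith, by linarith, hDΩ a⟩
  · refine slice_pull ℓ (op_gt ℓ hΩ (c - δ) (Y0 - δ) (Y1 + δ)) (fun r hr => ?_) fun r hr => k2 _ _ hr.1 hr.2.1 hr.2.2.1 hr.2.2.2
    obtain ⟨a, b⟩ := h'' r hr
    have := him r a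
    exact ⟨by linarith, by linarith, by linarith, hDΩ a⟩
  · refine Eventually.of_forall fun r => ?_
    have := k3 (ℓ r, r)
    simpa using this

def FactorOn {V' V'' : Type*} [NormedAddCommGroup V'] [NormedSpace ℂ V'] [NormedAddCommGroup V''] [NormedSpace ℂ V'']
    (φ : E → V' →L[ℂ] V'') (ψ : E → V'' →L[ℂ] V') (D' D'' D0 : Set E) : Prop :=
  ∃ Y' Z' Y'' Z'' : E → (V' × V'') →L[ℂ] (V' × V''),
      HolNear Y' D' ∧ HolNear Z' D' ∧ (∀ᶠ z in 𝓝ˢ D', Y' z * Z' z = 1 ∧ Z' z * Y' z = 1) ∧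
      HolNear Y'' D'' ∧ HolNear Z'' D'' ∧ (∀ᶠ z in 𝓝ˢ D'', Y'' z * Z'' z = 1 ∧ Z'' z * Y'' z = 1) ∧
      ∀ᶠ z in 𝓝ˢ D0, HH (φ z) (ψ z) * Y' z = Y'' z

theorem factor_slice {V' V'' : Type*} [NormedAddCommGroup V'] [NormedSpace ℂ V'] [NormedAddCommGroup V''] [NormedSpace ℂ V'']
    [CompleteSpace V'] [CompleteSpace V'']
    {φ : E → V' →L[ℂ] V''} {ψ : E → V'' →L[ℂ] V'} {S D : Set E} (hφ : HolNear φ S) (hψ : HolNear ψ S)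
    (hD : IsCompact D) (ℓ : E →L[ℂ] ℂ) (e : E) 
    {c Y0 Y1 : ℝ} (hY : Y0 ≤ Y1)
    (hS : ∀ r ∈ D, ∀ ζ : ℂ, ζ.re = c → Y0 ≤ ζ.im → ζ.im ≤ Y1 → r + (ζ - ℓ r) • e ∈ S) 
    (him : ∀ r ∈ D, Y0 ≤ (ℓ r).im ∧ (ℓ r).im ≤ Y1)
    {D' D'' D0 : Set E} (h' : ∀ r ∈ D', r ∈ D ∧ (ℓ r).re ≤ c) (h'' : ∀ r ∈ D'', r ∈ D ∧ c ≤ (ℓ r).re) 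
    (h0 : ∀ r ∈ D0, r ∈ D ∧ (ℓ r).re = c) : FactorOn φ ψ D' D'' D0 := by
  obtain ⟨δ1, hδ1, Ω1, hΩ1, hDΩ1, M1, hM1⟩ := slice_tube hφ hD ℓ e hY hS
  obtain ⟨δ2, hδ2, Ω2, hΩ2, hDΩ2, M2, hM2⟩ := slice_tube hψ hD ℓ e hY hS
  set δ := min δ1 δ2 with hδd
  have hδ : 0 < δ := lt_min hδ1 hδ2
  have hd1 : δ ≤ δ1 := min_le_left _ _
  have hd2 : δ ≤ δ2 := min_le_right _ _
  have hΩ := hΩ1.inter hΩ2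
  have hDΩ : D ⊆ Ω1 ∩ Ω2 := subset_inter hDΩ1 hDΩ2
  obtain ⟨δ', hδ', Y', Z', Y'', Z'', k1, k2, k3⟩ := factor_prod (c := c) hδ (by linarith : Y0 - δ < Y1 + δ) hΩ 
    (φ := fun q : ℂ × E => φ (q.2 + (q.1 - ℓ q.2) • e)) (ψ := fun q : ℂ × E => ψ (q.2 + (q.1 - ℓ q.2) • e)) (M := max M1 M2)
    (fun ζ r a b c d => by
      obtain ⟨u1, u2⟩ := hM1 ζ r (by linarith) (by linarith) (by linarith) d.1
      obtain ⟨v1, v2⟩ := hM2 ζ r (by linarith) (by linarith) (by linarith) d.2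
      exact ⟨u1, v1, u2.trans (le_max_left _ _), v2.trans (le_max_right _ _)⟩)
  have s' : D' ⊆ {r : E | (ℓ r).re < c + δ' ∧ Y0 - δ < (ℓ r).im ∧ (ℓ r).im < Y1 + δ ∧ r ∈ Ω1 ∩ Ω2} := fun r hr => by
    obtain ⟨a, b⟩ := h' r hr
    have := him r a
    exact ⟨by linarith, by linarith, by linarith, hDΩ a⟩
  have s'' : D'' ⊆ {r : E | c - δ' < (ℓ r).re ∧ Y0 - δ < (ℓ r).im ∧ (ℓ r).im < Y1 + δ ∧ r ∈ Ω1 ∩ Ω2} := fun r hr => by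
    obtain ⟨a, b⟩ := h'' r hr
    have := him r a
    exact ⟨by linarith, by linarith, by linarith, hDΩ a⟩
  have s0 : D0 ⊆ {r : E | |(ℓ r).re - c| < δ' ∧ Y0 - δ < (ℓ r).im ∧ (ℓ r).im < Y1 + δ ∧ r ∈ Ω1 ∩ Ω2} := fun r hr => by
    obtain ⟨a, b⟩ := h0 r hr
    have := him r a
    exact ⟨by rw [b]; simpa using hδ', by linarith, by linarith, hDΩ a⟩
  have o' := op_lt ℓ hΩ (c + δ') (Y0 - δ) (Y1 + δ)
  have o'' := op_gt ℓ hΩ (c - δ') (Y0 - δ) (Y1 + δ)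
  have o0 := op_abs ℓ hΩ c δ' (Y0 - δ) (Y1 + δ)
  refine ⟨fun r => Y' (ℓ r, r), fun r => Z' (ℓ r, r), fun r => Y'' (ℓ r, r), fun r => Z'' (ℓ r, r), ?_, ?_, ?_, ?_, ?_, ?_, ?_⟩
  · exact slice_pull ℓ o' s' fun r hr => (k1 _ _ hr.1 hr.2.1 hr.2.2.1 hr.2.2.2).1
  · exact slice_pull ℓ o' s' fun r hr => (k1 _ _ hr.1 hr.2.1 hr.2.2.1 hr.2.2.2).2.1
  · exact ev_of_isOpen o' s' fun r hr => (k1 _ _ hr.1 hr.2.1 hr.2.2.1 hr.2.2.2).2.2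
  · exact slice_pull ℓ o'' s'' fun r hr => (k2 _ _ hr.1 hr.2.1 hr.2.2.1 hr.2.2.2).1
  · exact slice_pull ℓ o'' s'' fun r hr => (k2 _ _ hr.1 hr.2.1 hr.2.2.1 hr.2.2.2).2.1
  · exact ev_of_isOpen o'' s'' fun r hr => (k2 _ _ hr.1 hr.2.1 hr.2.2.1 hr.2.2.2).2.2
  · refine ev_of_isOpen o0 s0 fun r hr => ?_
    have := k3 _ _ hr.1 hr.2.1 hr.2.2.1 hr.2.2.2
    simpa using this

end holnear
end UC

namespace UC
open Set Filter Topology Metric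

section bisect
variable {J : Type*} [Fintype J] [DecidableEq J]

theorem bisection {lo0 hi0 : J → ℝ} {P : (J → ℝ) → (J → ℝ) → Prop}
    (hglue : ∀ lo hi, lo0 ≤ lo → hi ≤ hi0 → lo ≤ hi → ∀ j c, lo j ≤ c → c ≤ hi j → 
      P lo (Function.update hi j c) → P (Function.update lo j c) hi → P lo hi)
    (hloc : ∀ x ∈ Icc lo0 hi0, ∃ ε > 0, ∀ lo hi, lo0 ≤ lo → hi ≤ hi0 → lo ≤ hi → (∀ j, x j - ε ≤ lo j ∧ hi j ≤ x j + ε) → P lo hi)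
    (h0 : lo0 ≤ hi0) : P lo0 hi0 := by
  choose! ε hε hP using hloc
  obtain ⟨δ, hδ, hδ'⟩ := lebesgue_number_lemma_of_metric (isCompact_Icc (a := lo0) (b := hi0)) (ι := Icc lo0 hi0) (c := fun x => ball x.1 (ε x.1))
    (fun _ => isOpen_ball) (fun x hx => mem_iUnion.2 ⟨⟨x, hx⟩, mem_ball_self (hε x hx)⟩)
  have claim : ∀ s : Finset J, ∀ lo hi, lo0 ≤ lo → hi ≤ hi0 → lo ≤ hi → (∀ j, j ∉ s → hi j - lo j ≤ δ / 2) → P lo hi := by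
    intro s
    induction s using Finset.induction_on with
    | empty =>
      intro lo hi h1 h2 h3 h4
      obtain ⟨⟨x, hx⟩, hsub⟩ := hδ' lo ⟨h1, h3.trans h2⟩
      have hlo : lo ∈ ball x (ε x) := hsub (mem_ball_self hδ)
      have hhi : hi ∈ ball x (ε x) := hsub (by
        rw [mem_ball]
        refine ((dist_pi_le_iff (by positivity)).2 fun j => ?_).trans_lt (half_lt_self hδ)
        rw [Real.dist_eq, abs_of_nonneg (sub_nonneg.2 (h3 j))]
        exact h4 j (by simp))
      refine hP x hx lo hi h1 h2 h3 fun j => ?_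
      have a := (dist_le_pi_dist lo x j).trans_lt hlo
      have b := (dist_le_pi_dist hi x j).trans_lt hhi
      rw [Real.dist_eq, abs_lt] at a b
      constructor <;> linarith
    | insert i s his ih =>
      have key : ∀ m : ℕ, ∀ lo hi, lo0 ≤ lo → hi ≤ hi0 → lo ≤ hi → (∀ j, j ∉ insert i s → hi j - lo j ≤ δ / 2) → 
          hi i - lo i ≤ (m + 1) * (δ / 2) → P lo hi := by
        intro m
        induction m with
        | zero =>
          intro lo hi h1 h2 h3 h4 h5
          refine ih lo hi h1 h2 h3 fun j hj => ?_
          by_cases hji : j = i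
          · subst hji; simpa using h5
          · exact h4 j (by simp [hji, hj])
        | succ m ihm =>
          intro lo hi h1 h2 h3 h4 h5
          by_cases hside : hi i - lo i ≤ δ / 2
          · refine ih lo hi h1 h2 h3 fun j hj => ?_
            by_cases hji : j = i
            · subst hji; exact hside
            · exact h4 j (by simp [hji, hj])
          push Not at hside
          have hc1 : lo i ≤ lo i + δ / 2 := by linarith
          have hc2 : lo i + δ / 2 ≤ hi i := by linarith
          refine hglue lo hi h1 h2 h3 i (lo i + δ / 2) hc1 hc2 ?_ ?_
          · refine ih _ _ h1 (fun j => ?_) (fun j => ?_) fun j hj => ?_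
            · by_cases hji : j = i
              · subst hji; simp only [Function.update_self]; exact hc2.trans (h2 _)
              · simpa [hji] using h2 j
            · by_cases hji : j = i
              · subst hji; simp only [Function.update_self]; exact hc1
              · simpa [hji] using h3 j
            · by_cases hji : j = i
              · subst hji; simp
              · simpa [hji] using h4 j (by simp [hji, hj])
          · refine ihm _ _ (fun j => ?_) h2 (fun j => ?_) (fun j hj => ?_) ?_
            · by_cases hji : j = i
              · subst hji; simp only [Function.update_self]; exact (h1 _).trans hc1
              · simpa [hji] using h1 j
            · by_cases hji : j = i
              · subst hji; simpa using hc2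
              · simpa [hji] using h3 j
            · have hji : j ≠ i := fun h => hj (by simp [h])
              simpa [hji] using h4 j hj
            · simp only [Function.update_self]; push_cast at h5; linarith
      intro lo hi h1 h2 h3 h4
      obtain ⟨m, hm⟩ := exists_nat_ge ((hi i - lo i) / (δ / 2))
      refine key m lo hi h1 h2 h3 h4 ?_
      rw [div_le_iff₀ (by positivity)] at hm
      nlinarith
  exact claim Finset.univ lo0 hi0 le_rfl le_rfl h0 (by simp)
end bisect

section boxes
variable {n : ℕ}

def co (j : Fin n × Bool) (z : Fin n → ℂ) : ℝ := if j.2 then (z j.1).im else (z j.1).re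

lemma continuous_co (j : Fin n × Bool) : Continuous (co j) := by
  unfold co
  split_ifs <;> fun_prop

def box (lo hi : Fin n × Bool → ℝ) : Set (Fin n → ℂ) := {z | ∀ j, lo j ≤ co j z ∧ co j z ≤ hi j}

def inR (w : ℂ) : Prop := (-1 ≤ w.re ∧ w.re ≤ 1) ∧ (-1 ≤ w.im ∧ w.im ≤ 1)

lemma isClosed_inR : IsClosed {w | inR w} := by
  have h1 := Complex.continuous_re
  have h2 := Complex.continuous_im
  exact ((isClosed_le continuous_const h1).inter (isClosed_le h1 continuous_const)).inter
    ((isClosed_le continuous_const h2).inter (isClosed_le h2 continuous_const))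

def KK (ps : List (MvPolynomial (Fin n) ℂ)) (lo hi : Fin n × Bool → ℝ) : Set (Fin n → ℂ) :=
  {z | z ∈ box lo hi ∧ ∀ p ∈ ps, inR (MvPolynomial.eval z p)}

lemma isClosed_box (lo hi : Fin n × Bool → ℝ) : IsClosed (box lo hi) := by
  have : box lo hi = ⋂ j, {z | lo j ≤ co j z ∧ co j z ≤ hi j} := by ext; simp [box]
  rw [this]
  exact isClosed_iInter fun j => (isClosed_le continuous_const (continuous_co j)).inter (isClosed_le (continuous_co j) continuous_const)

lemma isCompact_box (lo hi : Fin n × Bool → ℝ) : IsCompact (box lo hi) := by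
  have : IsCompact (Set.pi univ fun i : Fin n => (Icc (lo (i, false)) (hi (i, false)) ×ℂ Icc (lo (i, true)) (hi (i, true)))) :=
    isCompact_univ_pi fun i => isCompact_Icc.reProdIm isCompact_Icc
  refine this.of_isClosed_subset (isClosed_box lo hi) fun z hz i _ => ?_
  rw [Complex.mem_reProdIm]
  exact ⟨hz (i, false), hz (i, true)⟩

lemma isClosed_KK (ps : List (MvPolynomial (Fin n) ℂ)) (lo hi : Fin n × Bool → ℝ) : IsClosed (KK ps lo hi) := by
  have : KK ps lo hi = box lo hi ∩ ⋂ p ∈ ps, {z | inR (MvPolynomial.eval z p)} := by ext; simp [KK]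
  rw [this]
  refine (isClosed_box lo hi).inter (isClosed_biInter fun p _ => ?_)
  exact isClosed_inR.preimage (MvPolynomial.continuous_eval p)

lemma isCompact_KK (ps : List (MvPolynomial (Fin n) ℂ)) (lo hi : Fin n × Bool → ℝ) : IsCompact (KK ps lo hi) :=
  (isCompact_box lo hi).of_isClosed_subset (isClosed_KK ps lo hi) fun _ h => h.1

lemma box_mono {lo hi lo' hi' : Fin n × Bool → ℝ} (h1 : lo' ≤ lo) (h2 : hi ≤ hi') : box lo hi ⊆ box lo' hi' :=
  fun _ hz j => ⟨(h1 j).trans (hz j).1, (hz j).2.trans (h2 j)⟩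

lemma KK_mono {ps : List (MvPolynomial (Fin n) ℂ)} {lo hi lo' hi' : Fin n × Bool → ℝ} (h1 : lo' ≤ lo) (h2 : hi ≤ hi') : KK ps lo hi ⊆ KK ps lo' hi' :=
  fun _ hz => ⟨box_mono h1 h2 hz.1, hz.2⟩

open Function in
lemma mem_box_upd_hi {lo hi : Fin n × Bool → ℝ} {j : Fin n × Bool} {c : ℝ} (hc : c ≤ hi j) {z : Fin n → ℂ} :
    z ∈ box lo (update hi j c) ↔ z ∈ box lo hi ∧ co j z ≤ c := by
  constructor
  · intro h
    have hj := (h j).2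
    rw [update_self] at hj
    refine ⟨fun i => ⟨(h i).1, ?_⟩, hj⟩
    by_cases hi : i = j
    · subst hi; exact hj.trans hc
    · simpa [hi] using (h i).2
  · rintro ⟨h, hj⟩ i
    refine ⟨(h i).1, ?_⟩
    by_cases hi : i = j
    · subst hi; simpa using hj
    · simpa [hi] using (h i).2

open Function in
lemma mem_box_upd_lo {lo hi : Fin n × Bool → ℝ} {j : Fin n × Bool} {c : ℝ} (hc : lo j ≤ c) {z : Fin n → ℂ} :
    z ∈ box (update lo j c) hi ↔ z ∈ box lo hi ∧ c ≤ co j z := by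
  constructor
  · intro h
    have hj := (h j).1
    rw [update_self] at hj
    refine ⟨fun i => ⟨?_, (h i).2⟩, hj⟩
    by_cases hi : i = j
    · subst hi; exact hc.trans hj
    · simpa [hi] using (h i).1
  · rintro ⟨h, hj⟩ i
    refine ⟨?_, (h i).2⟩
    by_cases hi : i = j
    · subst hi; simpa using hj
    · simpa [hi] using (h i).1

open Function in
lemma mem_box_upd_both {lo hi : Fin n × Bool → ℝ} {j : Fin n × Bool} {c : ℝ} (hc : lo j ≤ c) (hc' : c ≤ hi j) {z : Fin n → ℂ} :
    z ∈ box (update lo j c) (update hi j c) ↔ z ∈ box lo hi ∧ co j z = c := by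
  rw [mem_box_upd_lo hc, mem_box_upd_hi hc', and_assoc, le_antisymm_iff]

open Function in
lemma KK_inter {ps : List (MvPolynomial (Fin n) ℂ)} {lo hi : Fin n × Bool → ℝ} {j : Fin n × Bool} {c : ℝ} (hc : lo j ≤ c) (hc' : c ≤ hi j) :
    KK ps lo (update hi j c) ∩ KK ps (update lo j c) hi = KK ps (update lo j c) (update hi j c) := by
  ext z
  simp only [KK, mem_inter_iff, mem_ofPred_eq, mem_box_upd_both hc hc', mem_box_upd_lo hc, mem_box_upd_hi hc', le_antisymm_iff]
  tauto

open Function in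
lemma KK_union {ps : List (MvPolynomial (Fin n) ℂ)} {lo hi : Fin n × Bool → ℝ} {j : Fin n × Bool} {c : ℝ} (hc : lo j ≤ c) (hc' : c ≤ hi j) :
    KK ps lo (update hi j c) ∪ KK ps (update lo j c) hi = KK ps lo hi := by
  ext z
  simp only [KK, mem_union, mem_ofPred_eq, mem_box_upd_lo hc, mem_box_upd_hi hc']
  have := le_total (co j z) c
  tauto

/-- linear coordinate attached to j -/
def ell (j : Fin n × Bool) : (Fin n → ℂ) →L[ℂ] ℂ :=
  (if j.2 then (-Complex.I) else 1 : ℂ) • ContinuousLinearMap.proj j.1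
def ev (j : Fin n × Bool) : Fin n → ℂ := Pi.single j.1 (if j.2 then Complex.I else 1)

lemma ell_re (j : Fin n × Bool) (z : Fin n → ℂ) : (ell j z).re = co j z := by
  rcases j with ⟨i, b⟩; cases b <;> simp [ell, co]
lemma ell_im_true (i : Fin n) (z : Fin n → ℂ) : (ell (i, true) z).im = - co (i, false) z := by
  simp [ell, co]
lemma ell_im_false (i : Fin n) (z : Fin n → ℂ) : (ell (i, false) z).im = co (i, true) z := by
  simp [ell, co]

def Ylo (lo hi : Fin n × Bool → ℝ) (j : Fin n × Bool) : ℝ := if j.2 then - hi (j.1, false) else lo (j.1, true)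
def Yhi (lo hi : Fin n × Bool → ℝ) (j : Fin n × Bool) : ℝ := if j.2 then - lo (j.1, false) else hi (j.1, true)

lemma Ylo_le {lo hi : Fin n × Bool → ℝ} (h : lo ≤ hi) (j : Fin n × Bool) : Ylo lo hi j ≤ Yhi lo hi j := by
  unfold Ylo Yhi; split_ifs
  · exact neg_le_neg (h _)
  · exact h _

lemma box_im {lo hi : Fin n × Bool → ℝ} (j : Fin n × Bool) {r : Fin n → ℂ} (hr : r ∈ box lo hi) : 
    Ylo lo hi j ≤ (ell j r).im ∧ (ell j r).im ≤ Yhi lo hi j := by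
  rcases j with ⟨i, b⟩; cases b
  · rw [ell_im_false]; simpa [Ylo, Yhi] using hr (i, true)
  · rw [ell_im_true]; simpa [Ylo, Yhi, and_comm] using hr (i, false)

open Function in
lemma box_slice {lo hi : Fin n × Bool → ℝ} {j : Fin n × Bool} {c : ℝ} (hc : lo j ≤ c) (hc' : c ≤ hi j) :
    ∀ r ∈ box lo hi, ∀ ζ : ℂ, ζ.re = c → Ylo lo hi j ≤ ζ.im → ζ.im ≤ Yhi lo hi j → 
      r + (ζ - ell j r) • ev j ∈ box (update lo j c) (update hi j c) := by
  intro r hr ζ h1 h2 h3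
  rw [mem_box_upd_both hc hc']
  have hj : co j (r + (ζ - ell j r) • ev j) = c := by
    rcases j with ⟨i, b⟩; cases b <;> simp [ell, co, ev, h1]
  refine ⟨fun i => ?_, hj⟩
  by_cases hij : i = j
  · subst hij; rw [hj]; exact ⟨hc, hc'⟩
  by_cases hi1 : i.1 = j.1
  · rcases j with ⟨j, b⟩; rcases i with ⟨i, b'⟩
    simp only at hi1
    subst hi1
    cases b <;> cases b' <;> simp at hij <;> simp [ell, co, ev] <;> simp [Ylo, Yhi] at h2 h3 <;> constructor <;> linarith
  · have : co i (r + (ζ - ell j r) • ev j) = co i r := by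
      simp [co, ev, Pi.single_eq_of_ne hi1]
    rw [this]; exact hr i

open Function

def CousinP (m : ℕ) : Prop := ∀ (n : ℕ) (ps : List (MvPolynomial (Fin n) ℂ)), ps.length = m → ∀ lo hi, lo ≤ hi → 
  ∀ j c, lo j ≤ c → c ≤ hi j → ∀ (F : Type) [NormedAddCommGroup F] [NormedSpace ℂ F] [CompleteSpace F] (f : (Fin n → ℂ) → F),
  HolNear f (KK ps (update lo j c) (update hi j c)) → 
  ∃ f' f'' : (Fin n → ℂ) → F, HolNear f' (KK ps lo (update hi j c)) ∧ HolNear f'' (KK ps (update lo j c) hi) ∧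
    ∀ᶠ z in 𝓝ˢ (KK ps (update lo j c) (update hi j c)), f z = f' z - f'' z

def FactorP (m : ℕ) : Prop := ∀ (n : ℕ) (ps : List (MvPolynomial (Fin n) ℂ)), ps.length = m → ∀ lo hi, lo ≤ hi → 
  ∀ j c, lo j ≤ c → c ≤ hi j → ∀ (V' V'' : Type) [NormedAddCommGroup V'] [NormedSpace ℂ V'] [CompleteSpace V'] 
  [NormedAddCommGroup V''] [NormedSpace ℂ V''] [CompleteSpace V''] (φ : (Fin n → ℂ) → V' →L[ℂ] V'') (ψ : (Fin n → ℂ) → V'' →L[ℂ] V'),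
  HolNear φ (KK ps (update lo j c) (update hi j c)) → HolNear ψ (KK ps (update lo j c) (update hi j c)) → 
  FactorOn φ ψ (KK ps lo (update hi j c)) (KK ps (update lo j c) hi) (KK ps (update lo j c) (update hi j c))

lemma KK_nil (lo hi : Fin n × Bool → ℝ) : KK [] lo hi = box lo hi := by simp [KK]

theorem cousinP_zero : CousinP 0 := by
  intro n ps hps lo hi hlh j c hc hc' F _ _ _ f hf
  obtain rfl := List.length_eq_zero_iff.1 hps
  simp only [KK_nil] at *
  refine cousin_slice hf (isCompact_box lo hi) (ell j) (ev j) (Ylo_le hlh j) (box_slice hc hc') (fun r hr => box_im j hr) ?_ ?_ ?_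
  · intro r hr; rw [ell_re]; exact (mem_box_upd_hi hc').1 hr
  · intro r hr; rw [ell_re]; exact (mem_box_upd_lo hc).1 hr
  · intro r hr; rw [ell_re]; exact (mem_box_upd_both hc hc').1 hr

theorem factorP_zero : FactorP 0 := by
  intro n ps hps lo hi hlh j c hc hc' V' V'' _ _ _ _ _ _ φ ψ hφ hψ
  obtain rfl := List.length_eq_zero_iff.1 hps
  simp only [KK_nil] at *
  refine factor_slice hφ hψ (isCompact_box lo hi) (ell j) (ev j) (Ylo_le hlh j) (box_slice hc hc') (fun r hr => box_im j hr) ?_ ?_ ?_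
  · intro r hr; rw [ell_re]; exact (mem_box_upd_hi hc').1 hr
  · intro r hr; rw [ell_re]; exact (mem_box_upd_lo hc).1 hr
  · intro r hr; rw [ell_re]; exact (mem_box_upd_both hc hc').1 hr
end boxes
end UC

namespace UC
open Set Filter Topology Metric Function

section ext
variable {n : ℕ}

def liftB (a : ℝ) (lo : Fin n × Bool → ℝ) : Fin (n+1) × Bool → ℝ := fun j => Fin.cases a (fun i => lo (i, j.2)) j.1
def sj (j : Fin n × Bool) : Fin (n+1) × Bool := (j.1.succ, j.2)
def liftP (ps : List (MvPolynomial (Fin n) ℂ)) : List (MvPolynomial (Fin (n+1)) ℂ) := ps.map (MvPolynomial.rename Fin.succ)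
def gr (p : MvPolynomial (Fin n) ℂ) (z : Fin n → ℂ) : Fin (n+1) → ℂ := Fin.cons (MvPolynomial.eval z p) z

lemma liftB_sj (a : ℝ) (lo : Fin n × Bool → ℝ) (j : Fin n × Bool) : liftB a lo (sj j) = lo j := rfl
lemma liftB_zero (a : ℝ) (lo : Fin n × Bool → ℝ) (b : Bool) : liftB a lo (0, b) = a := rfl

lemma liftB_update (a : ℝ) (lo : Fin n × Bool → ℝ) (j : Fin n × Bool) (c : ℝ) : 
    liftB a (update lo j c) = update (liftB a lo) (sj j) c := by
  ext ⟨i, b⟩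
  refine Fin.cases ?_ (fun i => ?_) i
  · rw [liftB_zero, update_of_ne, liftB_zero]
    intro h; exact (Fin.succ_ne_zero _ (congrArg Prod.fst h).symm)
  · change update lo j c (i, b) = _
    by_cases h : (i, b) = j
    · subst h; simp [sj]
    · rw [update_of_ne h, update_of_ne]
      · rfl
      · intro h'; apply h
        rcases j with ⟨j1, j2⟩
        simp only [sj, Prod.mk.injEq, Fin.succ_inj] at h'
        simp [h']

lemma liftB_le {lo hi : Fin n × Bool → ℝ} (h : lo ≤ hi) : liftB (-1) lo ≤ liftB 1 hi := by
  rintro ⟨i, b⟩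
  refine Fin.cases ?_ (fun i => ?_) i
  · rw [liftB_zero, liftB_zero]; norm_num
  · exact h (i, b)

lemma eval_lift (p : MvPolynomial (Fin n) ℂ) (v : Fin (n+1) → ℂ) : 
    MvPolynomial.eval v (MvPolynomial.rename Fin.succ p) = MvPolynomial.eval (fun i => v i.succ) p := by
  rw [MvPolynomial.eval_rename]; rfl

lemma mem_KK_lift {ps : List (MvPolynomial (Fin n) ℂ)} {lo hi : Fin n × Bool → ℝ} {v : Fin (n+1) → ℂ} :
    v ∈ KK (liftP ps) (liftB (-1) lo) (liftB 1 hi) ↔ inR (v 0) ∧ (fun i => v i.succ) ∈ KK ps lo hi := by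
  have hb : v ∈ box (liftB (-1) lo) (liftB 1 hi) ↔ inR (v 0) ∧ (fun i => v i.succ) ∈ box lo hi := by
    constructor
    · intro h
      refine ⟨⟨?_, ?_⟩, fun j => ?_⟩
      · have := h (0, false); simpa [liftB_zero, co] using this
      · have := h (0, true); simpa [liftB_zero, co] using this
      · exact h (sj j)
    · rintro ⟨⟨h1, h2⟩, h⟩ ⟨i, b⟩
      refine Fin.cases ?_ (fun i => ?_) i
      · rw [liftB_zero, liftB_zero]; cases b <;> simpa [co] 
      · exact h (i, b)
  simp only [KK, mem_ofPred_eq, hb, liftP, List.forall_mem_map, eval_lift, and_assoc]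

lemma mem_KK_cons {p : MvPolynomial (Fin n) ℂ} {ps : List (MvPolynomial (Fin n) ℂ)} {lo hi : Fin n × Bool → ℝ} {z : Fin n → ℂ} :
    z ∈ KK (p :: ps) lo hi ↔ inR (MvPolynomial.eval z p) ∧ z ∈ KK ps lo hi := by
  simp only [KK, mem_ofPred_eq, List.forall_mem_cons]; tauto

lemma gr_mem {p : MvPolynomial (Fin n) ℂ} {ps : List (MvPolynomial (Fin n) ℂ)} {lo hi : Fin n × Bool → ℝ} :
    MapsTo (gr p) (KK (p :: ps) lo hi) (KK (liftP ps) (liftB (-1) lo) (liftB 1 hi)) := by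
  intro z hz
  rw [mem_KK_lift]
  exact mem_KK_cons.1 hz

lemma eval_diff (p : MvPolynomial (Fin n) ℂ) : Differentiable ℂ (fun z : Fin n → ℂ => MvPolynomial.eval z p) := by
  induction p using MvPolynomial.induction_on with
  | C a => simp
  | add p q hp hq => simp only [map_add]; exact hp.add hq
  | mul_X p i hp => simp only [map_mul, MvPolynomial.eval_X]; exact hp.mul (differentiable_apply i)

lemma gr_diff (p : MvPolynomial (Fin n) ℂ) : Differentiable ℂ (gr p) := by
  rw [differentiable_pi]
  intro i
  refine Fin.cases ?_ (fun i => ?_) i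
  · exact eval_diff p
  · exact differentiable_apply (𝕜 := ℂ) i

lemma cons_diff : Differentiable ℂ (fun q : ℂ × (Fin n → ℂ) => (Fin.cons q.1 q.2 : Fin (n+1) → ℂ)) := by
  rw [differentiable_pi]
  intro i
  refine Fin.cases ?_ (fun i => ?_) i
  · exact differentiable_fst
  · have : Differentiable ℂ (fun q : ℂ × (Fin n → ℂ) => q.2 i) := by fun_prop
    exact this

lemma tail_diff : Differentiable ℂ (fun v : Fin (n+1) → ℂ => (fun i : Fin n => v i.succ)) := by fun_prop

/-- division by w - p(z) -/
lemma division {F : Type*} [NormedAddCommGroup F] [NormedSpace ℂ F] [CompleteSpace F] (p : MvPolynomial (Fin n) ℂ)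
    {D : (Fin (n+1) → ℂ) → F} {S : Set (Fin (n+1) → ℂ)} (hD : HolNear D S) 
    (h0 : ∀ v ∈ S, v 0 = MvPolynomial.eval (fun i => v i.succ) p → ∀ᶠ z in 𝓝 (fun i : Fin n => v i.succ), D (gr p z) = 0) :
    ∃ G : (Fin (n+1) → ℂ) → F, HolNear G S ∧ ∀ᶠ v in 𝓝ˢ S, D v = (v 0 - MvPolynomial.eval (fun i => v i.succ) p) • G v := by
  classical
  set π : (Fin (n+1) → ℂ) → (Fin n → ℂ) := fun v i => v i.succ with hπ
  set P : (Fin n → ℂ) → ℂ := fun z => MvPolynomial.eval z p with hP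
  have hPd : Differentiable ℂ P := eval_diff p
  have hπd : Differentiable ℂ π := tail_diff
  set h : ℂ × (Fin n → ℂ) → F := fun q => D (Fin.cons (q.1 + P q.2) q.2) with hh
  have hth : ∀ v, v 0 = P (π v) → gr p (π v) = v := by
    intro v hv
    ext i
    refine Fin.cases ?_ (fun i => ?_) i
    · exact hv.symm
    · rfl
  have hcons : ∀ v, (Fin.cons (v 0 - P (π v) + P (π v)) (π v) : Fin (n+1) → ℂ) = v := by
    intro v
    rw [sub_add_cancel]
    exact Fin.cons_self_tail v
  have hcont : Continuous fun v : Fin (n+1) → ℂ => v 0 - P (π v) := 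
    ((differentiable_apply (𝕜 := ℂ) (0 : Fin (n+1))).sub (hPd.comp hπd)).continuous
  have hdiff0 : Differentiable ℂ fun v : Fin (n+1) → ℂ => v 0 - P (π v) := 
    ((differentiable_apply (𝕜 := ℂ) (0 : Fin (n+1))).sub (hPd.comp hπd))
  refine ⟨fun v => if v 0 - P (π v) = 0 then deriv (fun w => h (w, π v)) 0 else (v 0 - P (π v))⁻¹ • D v, ?_, ?_⟩
  · refine Filter.Eventually.mono (ev_nested (p := fun v => DifferentiableAt ℂ D v ∧ (v 0 = P (π v) → ∀ᶠ z in 𝓝 (π v), D (gr p z) = 0)) ?_) ?_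
    · refine hD.and ?_
      rw [eventually_nhdsSet_iff_forall]
      intro v hv
      by_cases hv0 : v 0 - P (π v) = 0
      · have := h0 v hv (sub_eq_zero.1 hv0)
        filter_upwards [hπd.continuous.continuousAt.eventually (eventually_eventually_nhds.2 this)] with v' hv' _
        exact hv'
      · filter_upwards [hcont.continuousAt.eventually (isOpen_ne.mem_nhds hv0)] with v' hv' h
        exact absurd (sub_eq_zero.2 h) hv'
    · intro v hev
      by_cases hv0 : v 0 - P (π v) = 0
      · have hz := hev.self_of_nhds.2 (sub_eq_zero.1 hv0)
        have hgv := hth v (sub_eq_zero.1 hv0)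
        -- agree with dslope near v
        have e1 : (fun v => if v 0 - P (π v) = 0 then deriv (fun w => h (w, π v)) 0 else (v 0 - P (π v))⁻¹ • D v) =ᶠ[𝓝 v]
            fun v => dslope (fun w => h (w, π v)) 0 (v 0 - P (π v)) := by
          filter_upwards [hπd.continuous.continuousAt.eventually hz] with v' hv'
          by_cases h1 : v' 0 - P (π v') = 0
          · simp [h1]
          · have h2 : D (Fin.cons (P (π v')) (π v')) = 0 := hv'
            simp only [h1, if_false, dslope_of_ne _ h1, slope, sub_zero, vsub_eq_sub, hh, hcons, zero_add, h2]
        refine DifferentiableAt.congr_of_eventuallyEq ?_ e1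
        have d1 : ∀ᶠ q in 𝓝 ((0 : ℂ), π v), DifferentiableAt ℂ h q := by
          have c0 : Differentiable ℂ (fun q : ℂ × (Fin n → ℂ) => (Fin.cons (q.1 + P q.2) q.2 : Fin (n+1) → ℂ)) :=
            cons_diff.comp ((differentiable_fst.add (hPd.comp differentiable_snd)).prodMk differentiable_snd)
          have e : (Fin.cons ((0:ℂ) + P (π v)) (π v) : Fin (n+1) → ℂ) = v := by rw [zero_add]; exact hgv
          have : Tendsto (fun q : ℂ × (Fin n → ℂ) => (Fin.cons (q.1 + P q.2) q.2 : Fin (n+1) → ℂ)) (𝓝 ((0 : ℂ), π v)) (𝓝 v) := by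
            have := c0.continuous.tendsto ((0:ℂ), π v)
            simpa only [e] using this
          filter_upwards [this.eventually (hev.mono fun _ h => h.1)] with q hq
          exact hq.comp q (c0 q)
        have d2 := dslope_diff d1 (w1 := 0) d1.self_of_nhds
        rw [← hv0] at d2
        refine DifferentiableAt.comp (g := fun q : ℂ × (Fin n → ℂ) => dslope (fun w => h (w, q.2)) 0 q.1) (f := fun v => (v 0 - P (π v), π v)) v ?_ 
          ((hdiff0 v).prodMk (hπd v))
        rw [hv0] at d2 ⊢
        exact d2
      · have e1 : (fun v => if v 0 - P (π v) = 0 then deriv (fun w => h (w, π v)) 0 else (v 0 - P (π v))⁻¹ • D v) =ᶠ[𝓝 v]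
            fun v => (v 0 - P (π v))⁻¹ • D v := by
          filter_upwards [hcont.continuousAt.eventually (isOpen_ne.mem_nhds hv0)] with v' hv' 
          simp only [if_neg hv']
        refine DifferentiableAt.congr_of_eventuallyEq ?_ e1
        exact ((hdiff0 v).inv hv0).smul hev.self_of_nhds.1
  · rw [eventually_nhdsSet_iff_forall]
    intro v hv
    by_cases hv0 : v 0 - P (π v) = 0
    · filter_upwards [hπd.continuous.continuousAt.eventually (h0 v hv (sub_eq_zero.1 hv0))] with v' hv'
      by_cases h1 : v' 0 - P (π v') = 0
      · rw [h1, zero_smul, ← hv', hth v' (sub_eq_zero.1 h1)]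
      · simp only [h1, if_false]; rw [smul_inv_smul₀ h1]
    · filter_upwards [hcont.continuousAt.eventually (isOpen_ne.mem_nhds hv0)] with v' h1
      have h1 : v' 0 - P (π v') ≠ 0 := h1
      simp only [h1, if_false]; rw [smul_inv_smul₀ h1]

def ptx (x : Fin n × Bool → ℝ) : Fin n → ℂ := fun i => ⟨x (i, false), x (i, true)⟩

lemma box_local (x : Fin n × Bool → ℝ) {N : Set (Fin n → ℂ)} (hN : N ∈ 𝓝 (ptx x)) : ∃ ε > 0, ∀ lo hi : Fin n × Bool → ℝ, 
    (∀ j, x j - ε ≤ lo j ∧ hi j ≤ x j + ε) → box lo hi ⊆ N := by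
  obtain ⟨r, hr, hrN⟩ := Metric.mem_nhds_iff.1 hN
  refine ⟨r / 4, by positivity, fun lo hi h z hz => hrN ?_⟩
  rw [mem_ball]
  refine ((dist_pi_le_iff (by positivity)).2 fun i => ?_).trans_lt (half_lt_self hr)
  rw [dist_eq_norm]
  have h1 := hz (i, false)
  have h2 := hz (i, true)
  have h3 := h (i, false)
  have h4 := h (i, true)
  simp only [co] at h1 h2
  refine (Complex.norm_le_abs_re_add_abs_im _).trans ?_
  have a1 : |(z i - ptx x i).re| ≤ r / 4 := by
    rw [abs_le]; simp only [Complex.sub_re, ptx]; simp at h1; constructor <;> linarith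
  have a2 : |(z i - ptx x i).im| ≤ r / 4 := by
    rw [abs_le]; simp only [Complex.sub_im, ptx]; simp at h2; constructor <;> linarith
  linarith

lemma ptx_mem {lo hi x : Fin n × Bool → ℝ} (hx : x ∈ Icc lo hi) : ptx x ∈ box lo hi := by
  rintro ⟨i, b⟩
  cases b
  · exact ⟨hx.1 _, hx.2 _⟩
  · exact ⟨hx.1 _, hx.2 _⟩

lemma KK_local_empty {ps : List (MvPolynomial (Fin n) ℂ)} {lo0 hi0 x : Fin n × Bool → ℝ} (hx : x ∈ Icc lo0 hi0) (h : ptx x ∉ KK ps lo0 hi0) :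
    ∃ ε > 0, ∀ lo hi : Fin n × Bool → ℝ, lo0 ≤ lo → hi ≤ hi0 → 
    (∀ j, x j - ε ≤ lo j ∧ hi j ≤ x j + ε) → KK ps lo hi = ∅ := by
  obtain ⟨ε, hε, hN⟩ := box_local x ((isClosed_KK ps lo0 hi0).isOpen_compl.mem_nhds h)
  refine ⟨ε, hε, fun lo hi h1 h2 h3 => ?_⟩
  rw [eq_empty_iff_forall_notMem]
  intro z hz
  exact hN lo hi h3 hz.1 (KK_mono h1 h2 hz)

def ExtP (m : ℕ) : Prop := ∀ (n : ℕ) (p : MvPolynomial (Fin n) ℂ) (ps : List (MvPolynomial (Fin n) ℂ)), ps.length = m → ∀ lo hi, lo ≤ hi → 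
  ∀ (F : Type) [NormedAddCommGroup F] [NormedSpace ℂ F] [CompleteSpace F] (f : (Fin n → ℂ) → F),
  HolNear f (KK (p :: ps) lo hi) → ∃ G : (Fin (n+1) → ℂ) → F, HolNear G (KK (liftP ps) (liftB (-1) lo) (liftB 1 hi)) ∧
    ∀ᶠ z in 𝓝ˢ (KK (p :: ps) lo hi), G (gr p z) = f z

theorem extP_of_cousin {m : ℕ} (hC : CousinP m) : ExtP m := by
  intro n p ps hps lo0 hi0 hlh F _ _ _ f hf
  refine bisection (lo0 := lo0) (hi0 := hi0) (P := fun lo hi => ∃ G : (Fin (n+1) → ℂ) → F, HolNear G (KK (liftP ps) (liftB (-1) lo) (liftB 1 hi)) ∧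
    ∀ᶠ z in 𝓝ˢ (KK (p :: ps) lo hi), G (gr p z) = f z) ?_ ?_ hlh
  · rintro lo hi h1 h2 h3 j c hc hc' ⟨G', g1', g2'⟩ ⟨G'', g1'', g2''⟩
    set P : (Fin (n+1) → ℂ) → ℂ := fun v => v 0 - MvPolynomial.eval (fun i : Fin n => v i.succ) p with hP
    have hPd : Differentiable ℂ P := (differentiable_apply (𝕜 := ℂ) (0 : Fin (n+1))).sub ((eval_diff p).comp tail_diff)
    have hPgr : ∀ z, P (gr p z) = 0 := fun z => by simp [hP, gr]
    have hlp : (liftP ps).length = m := by simp [liftP, hps]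
    have hle := liftB_le h3
    have hcj : liftB (-1) lo (sj j) ≤ c := hc
    have hcj' : c ≤ liftB 1 hi (sj j) := hc'
    rw [liftB_update] at g1' g1''
    have i1 := KK_inter (ps := liftP ps) hcj hcj'
    have u1 := KK_union (ps := liftP ps) hcj hcj'
    have i2 := KK_inter (ps := p :: ps) hc hc'
    have u2 := KK_union (ps := p :: ps) hc hc'
    obtain ⟨q, q1, q2⟩ := division p (D := fun v => G' v - G'' v) (S := KK (liftP ps) (update (liftB (-1) lo) (sj j) c) (update (liftB 1 hi) (sj j) c)) 
      (by rw [← i1]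
          filter_upwards [g1'.mono inter_subset_left, g1''.mono inter_subset_right] with z a b
          exact a.sub b)
      (by intro v hv hv0
          rw [← liftB_update, ← liftB_update, mem_KK_lift] at hv
          have hz : (fun i : Fin n => v i.succ) ∈ KK (p :: ps) (update lo j c) (update hi j c) := mem_KK_cons.2 ⟨hv0 ▸ hv.1, hv.2⟩
          rw [← i2] at hz
          filter_upwards [eventually_nhdsSet_iff_forall.1 g2' _ hz.1, eventually_nhdsSet_iff_forall.1 g2'' _ hz.2] with z a b
          rw [a, b, sub_self])
    obtain ⟨a', a'', A1, A2, A3⟩ := hC (n+1) (liftP ps) hlp _ _ hle (sj j) c hcj hcj' F q q1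
    obtain ⟨G, k1, k2⟩ := glue_germs (isCompact_KK (liftP ps) (liftB (-1) lo) (update (liftB 1 hi) (sj j) c))
      (isCompact_KK (liftP ps) (update (liftB (-1) lo) (sj j) c) (liftB 1 hi)) (f' := fun v => G' v - P v • a' v) (f'' := fun v => G'' v - P v • a'' v) 
      (by rw [i1]
          filter_upwards [q2, A3] with v e1 e2
          rw [e2, smul_sub] at e1
          rw [sub_eq_sub_iff_sub_eq_sub, e1])
    refine ⟨G, ?_, ?_⟩
    · rw [← u1]
      unfold HolNear
      rw [nhdsSet_union, eventually_sup]
      exact ⟨HolNear.congr (by filter_upwards [g1', A1] with v b1 b2; exact b1.sub ((hPd v).smul b2)) k1, 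
        HolNear.congr (by filter_upwards [g1'', A2] with v b1 b2; exact b1.sub ((hPd v).smul b2)) k2⟩
    · rw [← u2, nhdsSet_union, eventually_sup]
      constructor
      · have m1 : MapsTo (gr p) (KK (p :: ps) lo (update hi j c)) (KK (liftP ps) (liftB (-1) lo) (update (liftB 1 hi) (sj j) c)) := by
          rw [← liftB_update]; exact gr_mem
        filter_upwards [((gr_diff p).continuous.tendsto_nhdsSet m1).eventually k1, g2'] with z e1 e2
        rw [e1, hPgr, zero_smul, sub_zero, e2]
      · have m1 : MapsTo (gr p) (KK (p :: ps) (update lo j c) hi) (KK (liftP ps) (update (liftB (-1) lo) (sj j) c) (liftB 1 hi)) := by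
          rw [← liftB_update]; exact gr_mem
        filter_upwards [((gr_diff p).continuous.tendsto_nhdsSet m1).eventually k2, g2''] with z e1 e2
        rw [e1, hPgr, zero_smul, sub_zero, e2]
  · intro x hx
    by_cases hxK : ptx x ∈ KK (p :: ps) lo0 hi0
    · obtain ⟨ε, hε, hN⟩ := box_local x (eventually_eventually_nhds.2 (eventually_nhdsSet_iff_forall.1 hf _ hxK))
      refine ⟨ε, hε, fun lo hi h1 h2 h3 h4 => ⟨fun v => f (fun i => v i.succ), ?_, Eventually.of_forall fun z => rfl⟩⟩
      have : HolNear f (box lo hi) := by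
        unfold HolNear
        rw [eventually_nhdsSet_iff_forall]
        exact fun z hz => hN lo hi h4 hz
      exact this.comp tail_diff fun v hv => (mem_KK_lift.1 hv).2.1
    · obtain ⟨ε, hε, hN⟩ := KK_local_empty hx hxK
      refine ⟨ε, hε, fun lo hi h1 h2 h3 h4 => ⟨0, Eventually.of_forall fun v => differentiableAt_const _, ?_⟩⟩
      rw [hN lo hi h1 h2 h4]; simp

theorem cousin_succ {m : ℕ} (hC : CousinP m) : CousinP (m+1) := by
  intro n ps hps lo hi hlh j c hc hc' F _ _ _ f hf
  obtain ⟨p, ps, rfl⟩ := List.exists_cons_of_length_eq_add_one hps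
  have hps : ps.length = m := by simpa using hps
  have hlp : (liftP ps).length = m := by simp [liftP, hps]
  have hle : update lo j c ≤ update hi j c := by
    rw [update_le_update_iff]; exact ⟨le_rfl, fun i _ => hlh i⟩
  obtain ⟨G, G1, G2⟩ := extP_of_cousin hC n p ps hps _ _ hle F f hf
  rw [liftB_update, liftB_update] at G1
  obtain ⟨a', a'', A1, A2, A3⟩ := hC (n+1) (liftP ps) hlp _ _ (liftB_le hlh) (sj j) c hc hc' F G G1
  rw [← liftB_update] at A1 A2 A3
  rw [← liftB_update] at A3
  refine ⟨_, _, A1.comp (gr_diff p) gr_mem, A2.comp (gr_diff p) gr_mem, ?_⟩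
  filter_upwards [((gr_diff p).continuous.tendsto_nhdsSet gr_mem).eventually A3, G2] with z e1 e2
  rw [← e2, e1]

theorem factor_succ {m : ℕ} (hC : CousinP m) (hF : FactorP m) : FactorP (m+1) := by
  intro n ps hps lo hi hlh j c hc hc' V' V'' _ _ _ _ _ _ φ ψ hφ hψ
  obtain ⟨p, ps, rfl⟩ := List.exists_cons_of_length_eq_add_one hps
  have hps : ps.length = m := by simpa using hps
  have hlp : (liftP ps).length = m := by simp [liftP, hps]
  have hle : update lo j c ≤ update hi j c := by
    rw [update_le_update_iff]; exact ⟨le_rfl, fun i _ => hlh i⟩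
  obtain ⟨G, G1, G2⟩ := extP_of_cousin hC n p ps hps _ _ hle _ φ hφ
  obtain ⟨H, H1, H2⟩ := extP_of_cousin hC n p ps hps _ _ hle _ ψ hψ
  rw [liftB_update, liftB_update] at G1 H1
  obtain ⟨Y', Z', Y'', Z'', A1, A2, A3, A4, A5, A6, A7⟩ := hF (n+1) (liftP ps) hlp _ _ (liftB_le hlh) (sj j) c hc hc' V' V'' G H G1 H1
  rw [← liftB_update] at A1 A2 A3 A4 A5 A6 A7
  rw [← liftB_update] at A7
  refine ⟨_, _, _, _, A1.comp (gr_diff p) gr_mem, A2.comp (gr_diff p) gr_mem, ?_, A4.comp (gr_diff p) gr_mem, A5.comp (gr_diff p) gr_mem, ?_, ?_⟩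
  · exact ((gr_diff p).continuous.tendsto_nhdsSet gr_mem).eventually A3
  · exact ((gr_diff p).continuous.tendsto_nhdsSet gr_mem).eventually A6
  filter_upwards [((gr_diff p).continuous.tendsto_nhdsSet gr_mem).eventually A7, G2, H2] with z e1 e2 e3
  rw [← e2, ← e3, e1]

theorem cousinP (m : ℕ) : CousinP m := by
  induction m with
  | zero => exact cousinP_zero
  | succ m ih => exact cousin_succ ih
theorem factorP (m : ℕ) : FactorP m := by
  induction m with
  | zero => exact factorP_zero
  | succ m ih => exact factor_succ (cousinP m) ih
theorem extP (m : ℕ) : ExtP m := extP_of_cousin (cousinP m)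

end ext
end UC

namespace UC
open Set Filter Topology Metric Function

section twist
variable {n : ℕ} {V0 : Type} [NormedAddCommGroup V0] [NormedSpace ℂ V0]
variable {V V' V'' : Type} [NormedAddCommGroup V] [NormedSpace ℂ V]
  [NormedAddCommGroup V'] [NormedSpace ℂ V'] [NormedAddCommGroup V''] [NormedSpace ℂ V'']

def LocTriv (ρ : (Fin n → ℂ) → (Fin n → ℂ) → V0 →L[ℂ] V0) (x : Fin n → ℂ) : Prop :=
  ∃ r > 0, ∀ z0 ∈ ball x r, ρ z0 z0 = 1 ∧ ∀ z1 ∈ ball x r, ∀ z2 ∈ ball x r, (ρ z0 z1).comp (ρ z1 z2) = ρ z0 z2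

variable {ρ : (Fin n → ℂ) → (Fin n → ℂ) → V0 →L[ℂ] V0}

def TD (ρ : (Fin n → ℂ) → (Fin n → ℂ) → V0 →L[ℂ] V0) (g : (Fin n → ℂ) → V0 →L[ℂ] V) (z0 : Fin n → ℂ) : Prop := 
  DifferentiableAt ℂ (fun z => (g z).comp (ρ z z0)) z0
def TE (ρ : (Fin n → ℂ) → (Fin n → ℂ) → V0 →L[ℂ] V0) (e : (Fin n → ℂ) → V →L[ℂ] V0) (z0 : Fin n → ℂ) : Prop := 
  DifferentiableAt ℂ (fun z => (ρ z0 z).comp (e z)) z0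

lemma LocTriv.inv {z0 : Fin n → ℂ} (h : LocTriv ρ z0) : ∀ᶠ z in 𝓝 z0, (ρ z z0).comp (ρ z0 z) = 1 := by
  obtain ⟨r, hr, h⟩ := h
  filter_upwards [ball_mem_nhds z0 hr] with z hz
  rw [(h z hz).2 z0 (mem_ball_self hr) z hz, (h z hz).1]

lemma TD.mulE {g : (Fin n → ℂ) → V0 →L[ℂ] V} {e : (Fin n → ℂ) → V' →L[ℂ] V0} {z0 : Fin n → ℂ} (hU : LocTriv ρ z0) (hg : TD ρ g z0) (he : TE ρ e z0) :
    DifferentiableAt ℂ (fun z => (g z).comp (e z)) z0 := by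
  refine (DifferentiableAt.clm_comp hg he).congr_of_eventuallyEq ?_
  filter_upwards [hU.inv] with z hz
  have : (((g z).comp (ρ z z0)).comp ((ρ z0 z).comp (e z))) = (g z).comp (((ρ z z0).comp (ρ z0 z)).comp (e z)) := rfl
  rw [this, hz]; rfl

lemma TD.lmul {g : (Fin n → ℂ) → V0 →L[ℂ] V} {Y : (Fin n → ℂ) → V →L[ℂ] V'} {z0 : Fin n → ℂ} (hg : TD ρ g z0) (hY : DifferentiableAt ℂ Y z0) :
    TD ρ (fun z => (Y z).comp (g z)) z0 := by
  have : DifferentiableAt ℂ (fun z => (Y z).comp ((g z).comp (ρ z z0))) z0 := DifferentiableAt.clm_comp hY hg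
  exact this
lemma TE.rmul {e : (Fin n → ℂ) → V →L[ℂ] V0} {Y : (Fin n → ℂ) → V' →L[ℂ] V} {z0 : Fin n → ℂ} (he : TE ρ e z0) (hY : DifferentiableAt ℂ Y z0) :
    TE ρ (fun z => (e z).comp (Y z)) z0 := by
  have : DifferentiableAt ℂ (fun z => ((ρ z0 z).comp (e z)).comp (Y z)) z0 := DifferentiableAt.clm_comp he hY
  exact this
lemma TD.congr {g g' : (Fin n → ℂ) → V0 →L[ℂ] V} {z0 : Fin n → ℂ} (hg : TD ρ g z0) (h : ∀ᶠ z in 𝓝 z0, g' z = g z) : TD ρ g' z0 :=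
  DifferentiableAt.congr_of_eventuallyEq hg (h.mono fun z hz => by simp only [hz])
lemma TE.congr {g g' : (Fin n → ℂ) → V →L[ℂ] V0} {z0 : Fin n → ℂ} (hg : TE ρ g z0) (h : ∀ᶠ z in 𝓝 z0, g' z = g z) : TE ρ g' z0 :=
  DifferentiableAt.congr_of_eventuallyEq hg (h.mono fun z hz => by simp only [hz])

lemma HH_right {g' : V0 →L[ℂ] V'} {e' : V' →L[ℂ] V0} {g'' : V0 →L[ℂ] V''} {e'' : V'' →L[ℂ] V0} (h' : e'.comp g' = 1) (h'' : e''.comp g'' = 1) :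
    (HH (g''.comp e') (g'.comp e'')).comp ((ContinuousLinearMap.inl ℂ V' V'').comp g') = (ContinuousLinearMap.inr ℂ V' V'').comp g'' := by
  have a' : ∀ v, e' (g' v) = v := fun v => congrArg (fun L : V0 →L[ℂ] V0 => L v) h'
  have a'' : ∀ v, e'' (g'' v) = v := fun v => congrArg (fun L : V0 →L[ℂ] V0 => L v) h''
  ext v <;> simp [HH, e12_apply, e21_apply, a', a'']
lemma HH_left {g' : V0 →L[ℂ] V'} {e' : V' →L[ℂ] V0} {g'' : V0 →L[ℂ] V''} {e'' : V'' →L[ℂ] V0} (h' : e'.comp g' = 1) (h'' : e''.comp g'' = 1) :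
    (e''.comp (ContinuousLinearMap.snd ℂ V' V'')).comp (HH (g''.comp e') (g'.comp e'')) = e'.comp (ContinuousLinearMap.fst ℂ V' V'') := by
  have a' : ∀ v, e' (g' v) = v := fun v => congrArg (fun L : V0 →L[ℂ] V0 => L v) h'
  have a'' : ∀ v, e'' (g'' v) = v := fun v => congrArg (fun L : V0 →L[ℂ] V0 => L v) h''
  ext v <;> simp [HH, e12_apply, e21_apply, a', a'']

def Triv (ρ : (Fin n → ℂ) → (Fin n → ℂ) → V0 →L[ℂ] V0) (K : Set (Fin n → ℂ)) : Prop :=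
  ∃ (V : Type) (_ : NormedAddCommGroup V) (_ : NormedSpace ℂ V) (_ : CompleteSpace V) (g : (Fin n → ℂ) → V0 →L[ℂ] V) (e : (Fin n → ℂ) → V →L[ℂ] V0),
    ∀ᶠ z in 𝓝ˢ K, TD ρ g z ∧ TE ρ e z ∧ (e z).comp (g z) = 1

theorem triv_glue {ps : List (MvPolynomial (Fin n) ℂ)} {lo hi : Fin n × Bool → ℝ} (hlh : lo ≤ hi) {j : Fin n × Bool} {c : ℝ} (hc : lo j ≤ c) (hc' : c ≤ hi j)
    (hU : ∀ᶠ z in 𝓝ˢ (KK ps lo hi), LocTriv ρ z)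
    (h' : Triv ρ (KK ps lo (update hi j c))) (h'' : Triv ρ (KK ps (update lo j c) hi)) : Triv ρ (KK ps lo hi) := by
  obtain ⟨V', _, _, _, g', e', G'⟩ := h'
  obtain ⟨V'', _, _, _, g'', e'', G''⟩ := h''
  have i1 := KK_inter (ps := ps) hc hc'
  have u1 := KK_union (ps := ps) hc hc'
  set K' := KK ps lo (update hi j c)
  set K'' := KK ps (update lo j c) hi
  set K0 := KK ps (update lo j c) (update hi j c)
  have s' : 𝓝ˢ K0 ≤ 𝓝ˢ K' := nhdsSet_mono (i1 ▸ inter_subset_left)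
  have s'' : 𝓝ˢ K0 ≤ 𝓝ˢ K'' := nhdsSet_mono (i1 ▸ inter_subset_right)
  have sK : 𝓝ˢ K0 ≤ 𝓝ˢ (KK ps lo hi) := s'.trans (nhdsSet_mono (u1 ▸ subset_union_left))
  obtain ⟨Y', Z', Y'', Z'', y', z', yz', y'', z'', yz'', hH⟩ := factorP ps.length n ps rfl lo hi hlh j c hc hc' V' V'' (fun z => (g'' z).comp (e' z)) (fun z => (g' z).comp (e'' z))
    (by filter_upwards [s' G', s'' G'', sK hU] with z a b c; exact b.1.mulE c a.2.1)
    (by filter_upwards [s' G', s'' G'', sK hU] with z a b c; exact a.1.mulE c b.2.1)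
  have hpair : ∀ᶠ z in 𝓝ˢ K0, 
      (((Z' z).comp ((ContinuousLinearMap.inl ℂ V' V'').comp (g' z)), ((e' z).comp (ContinuousLinearMap.fst ℂ V' V'')).comp (Y' z))
        : (V0 →L[ℂ] V' × V'') × (V' × V'' →L[ℂ] V0)) = 
      ((Z'' z).comp ((ContinuousLinearMap.inr ℂ V' V'').comp (g'' z)), ((e'' z).comp (ContinuousLinearMap.snd ℂ V' V'')).comp (Y'' z)) := by
    filter_upwards [s' G', s'' G'', s' yz', s'' yz'', hH] with z a b c d e
    have hr := HH_right a.2.2 b.2.2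
    have hl := HH_left a.2.2 b.2.2
    rw [Prod.mk.injEq]
    constructor
    · rw [← hr]
      set H := HH ((g'' z).comp (e' z)) ((g' z).comp (e'' z))
      have : (Z'' z) * H = Z' z := by
        calc _ = Z'' z * H * (Y' z * Z' z) := by rw [c.1, mul_one]
          _ = Z'' z * (H * Y' z) * Z' z := by simp only [mul_assoc]
          _ = _ := by rw [e, d.2, one_mul]
      rw [← this]; rfl
    · rw [← e, ← hl]; rfl
  obtain ⟨F, k1, k2⟩ := glue_germs (isCompact_KK ps lo (update hi j c)) (isCompact_KK ps (update lo j c) hi) (by rw [i1]; exact hpair)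
  refine ⟨V' × V'', inferInstance, inferInstance, inferInstance, fun z => (F z).1, fun z => (F z).2, ?_⟩
  rw [← u1, nhdsSet_union, eventually_sup]
  constructor
  · filter_upwards [G', ev_nested k1, y', z', yz'] with z a b c d e
    refine ⟨?_, ?_, ?_⟩
    · refine TD.congr ?_ (b.mono fun w hw => by rw [hw])
      exact (a.1.lmul (differentiableAt_const _)).lmul d
    · refine TE.congr ?_ (b.mono fun w hw => by rw [hw])
      exact (a.2.1.rmul (differentiableAt_const _)).rmul c
    · rw [b.self_of_nhds]
      calc _ = ((e' z).comp (ContinuousLinearMap.fst ℂ V' V'')).comp ((Y' z * Z' z).comp ((ContinuousLinearMap.inl ℂ V' V'').comp (g' z))) := rfl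
        _ = (e' z).comp (g' z) := by rw [e.1]; rfl
        _ = 1 := a.2.2
  · filter_upwards [G'', ev_nested k2, y'', z'', yz''] with z a b c d e
    refine ⟨?_, ?_, ?_⟩
    · refine TD.congr ?_ (b.mono fun w hw => by rw [hw])
      exact (a.1.lmul (differentiableAt_const _)).lmul d
    · refine TE.congr ?_ (b.mono fun w hw => by rw [hw])
      exact (a.2.1.rmul (differentiableAt_const _)).rmul c
    · rw [b.self_of_nhds]
      calc _ = ((e'' z).comp (ContinuousLinearMap.snd ℂ V' V'')).comp ((Y'' z * Z'' z).comp ((ContinuousLinearMap.inr ℂ V' V'').comp (g'' z))) := rfl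
        _ = (e'' z).comp (g'' z) := by rw [e.1]; rfl
        _ = 1 := a.2.2

theorem triv [CompleteSpace V0] {ps : List (MvPolynomial (Fin n) ℂ)} {lo hi : Fin n × Bool → ℝ} (hlh : lo ≤ hi) 
    {U : Set (Fin n → ℂ)} (hUo : IsOpen U) (hK : KK ps lo hi ⊆ U) (hU : ∀ z ∈ U, LocTriv ρ z) : Triv ρ (KK ps lo hi) := by
  refine bisection (P := fun lo hi => Triv ρ (KK ps lo hi)) ?_ ?_ hlh
  · intro lo' hi' h1 h2 h3 j c hc hc' h' h''
    exact triv_glue h3 hc hc' (ev_of_isOpen hUo ((KK_mono h1 h2).trans hK) hU) h' h''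
  · intro x hx
    by_cases hxK : ptx x ∈ KK ps lo hi
    · obtain ⟨r, hr, hρ⟩ := hU _ (hK hxK)
      obtain ⟨ε, hε, hN⟩ := box_local x (ball_mem_nhds (ptx x) hr)
      refine ⟨ε, hε, fun lo' hi' h1 h2 h3 h4 => ⟨V0, inferInstance, inferInstance, inferInstance, fun z => ρ (ptx x) z, fun z => ρ z (ptx x), ?_⟩⟩
      have hc := mem_ball_self (x := ptx x) hr
      refine ev_of_isOpen (isOpen_ball (x := ptx x) (ε := r)) (fun z hz => hN lo' hi' h4 hz.1) fun z hz => ⟨?_, ?_, ?_⟩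
      · refine (differentiableAt_const (ρ (ptx x) z)).congr_of_eventuallyEq ?_
        filter_upwards [isOpen_ball.mem_nhds hz] with w hw
        exact (hρ _ hc).2 w hw z hz
      · refine (differentiableAt_const (ρ z (ptx x))).congr_of_eventuallyEq ?_
        filter_upwards [isOpen_ball.mem_nhds hz] with w hw
        exact (hρ _ hz).2 w hw _ hc
      · rw [(hρ _ hz).2 _ hc _ hz, (hρ _ hz).1]
    · obtain ⟨ε, hε, hN⟩ := KK_local_empty hx hxK
      refine ⟨ε, hε, fun lo' hi' h1 h2 h3 h4 => ⟨V0, inferInstance, inferInstance, inferInstance, fun z => ρ (ptx x) z, fun z => ρ z (ptx x), ?_⟩⟩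
      rw [hN lo' hi' h1 h2 h4]; simp

/-- connection form -/
def omg (ρ : (Fin n → ℂ) → (Fin n → ℂ) → V0 →L[ℂ] V0) (g : (Fin n → ℂ) → V0 →L[ℂ] V) (e : (Fin n → ℂ) → V →L[ℂ] V0) (i : Fin n) (z : Fin n → ℂ) : V →L[ℂ] V :=
  (fderiv ℂ (fun w => (g w).comp (ρ w z)) z (Pi.single i 1)).comp (e z)

lemma omg_diff [CompleteSpace V] {g : (Fin n → ℂ) → V0 →L[ℂ] V} {e : (Fin n → ℂ) → V →L[ℂ] V0} {z0 : Fin n → ℂ} (hU : LocTriv ρ z0)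
    (hg : ∀ᶠ z in 𝓝 z0, TD ρ g z) (he : TE ρ e z0) (i : Fin n) : DifferentiableAt ℂ (omg ρ g e i) z0 := by
  obtain ⟨r, hr, hρ⟩ := hU
  have hc := mem_ball_self (x := z0) hr
  set G : (Fin n → ℂ) → V0 →L[ℂ] V := fun w => (g w).comp (ρ w z0) with hG
  have hGd : ∀ᶠ z in 𝓝 z0, DifferentiableAt ℂ G z := by
    filter_upwards [hg, ball_mem_nhds z0 hr] with z h1 h2
    refine (DifferentiableAt.clm_comp h1 (differentiableAt_const (ρ z z0))).congr_of_eventuallyEq ?_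
    filter_upwards [isOpen_ball.mem_nhds h2] with w hw
    rw [hG]; simp only
    rw [ContinuousLinearMap.comp_assoc, (hρ w hw).2 z h2 z0 hc]
  have hfd := fderiv_diff hGd
  have d1 : DifferentiableAt ℂ (fun z => (fderiv ℂ G z (Pi.single i 1)).comp ((ρ z0 z).comp (e z))) z0 :=
    DifferentiableAt.clm_comp (hfd.clm_apply (differentiableAt_const _)) he
  refine d1.congr_of_eventuallyEq ?_
  filter_upwards [hGd, ball_mem_nhds z0 hr] with z h1 h2
  rw [omg, ← ContinuousLinearMap.comp_assoc]
  congr 1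
  have e1 : (fun w => (g w).comp (ρ w z)) =ᶠ[𝓝 z] fun w => (G w).comp (ρ z0 z) := by
    filter_upwards [isOpen_ball.mem_nhds h2] with w hw
    rw [hG]; simp only
    rw [ContinuousLinearMap.comp_assoc, (hρ w hw).2 z0 hc z h2]
  rw [e1.fderiv_eq]
  have := (h1.hasFDerivAt.clm_comp (hasFDerivAt_const (ρ z0 z) z)).fderiv
  rw [this]
  simp

theorem bundle [CompleteSpace V0] {ps : List (MvPolynomial (Fin n) ℂ)} {lo hi : Fin n × Bool → ℝ} (hlh : lo ≤ hi) 
    {U : Set (Fin n → ℂ)} (hUo : IsOpen U) (hK : KK ps lo hi ⊆ U) (hU : ∀ z ∈ U, LocTriv ρ z) : 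
    ∃ (V : Type) (_ : NormedAddCommGroup V) (_ : NormedSpace ℂ V) (_ : CompleteSpace V) (g : (Fin n → ℂ) → V0 →L[ℂ] V) (e : (Fin n → ℂ) → V →L[ℂ] V0),
    (∀ z ∈ KK ps lo hi, TD ρ g z ∧ (e z).comp (g z) = 1) ∧ ∀ i, HolNear (omg ρ g e i) (KK ps lo hi) := by
  obtain ⟨V, i1, i2, i3, g, e, h⟩ := triv hlh hUo hK hU
  refine ⟨V, i1, i2, i3, g, e, fun z hz => ?_, fun i => ?_⟩
  · have := (eventually_nhdsSet_iff_forall.1 h z hz).self_of_nhds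
    exact ⟨this.1, this.2.2⟩
  · filter_upwards [ev_nested h, ev_of_isOpen hUo hK hU] with z h1 h2
    exact omg_diff h2 (h1.mono fun _ h => h.1) h1.self_of_nhds.2.1 i
end twist
end UC

namespace UC
open Set Filter Topology Metric Function

lemma norm_of_inR {w : ℂ} (h : inR w) : ‖w‖ ≤ 2 := by
  have := Complex.norm_le_abs_re_add_abs_im w
  have h1 : |w.re| ≤ 1 := abs_le.2 h.1
  have h2 : |w.im| ≤ 1 := abs_le.2 h.2
  linarith

theorem poly_choice {n : ℕ} {Γ U : Set (Fin n → ℂ)} (hΓ : IsCompact Γ) (hne : Γ.Nonempty) (hU : IsOpen U) (hh : polyHull Γ ⊆ U) :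
    ∃ h : ℝ, 0 < h ∧ ∃ ps : List (MvPolynomial (Fin n) ℂ), KK ps (fun _ => -h) (fun _ => h) ⊆ U ∧
      ∀ z ∈ Γ, (∀ i, 2 * ‖z i‖ ≤ h) ∧ ∀ p ∈ ps, ‖MvPolynomial.eval z p‖ ≤ 1 / 2 := by
  obtain ⟨R, hR0, hR⟩ := hΓ.isBounded.exists_pos_norm_le
  refine ⟨2 * R, by positivity, ?_⟩
  have hc : IsCompact (box (n := n) (fun _ => -(2 * R)) (fun _ => 2 * R) \ U) := (isCompact_box _ _).diff hU
  have key : ∃ ps : List (MvPolynomial (Fin n) ℂ), (∀ p ∈ ps, ∀ z ∈ Γ, ‖MvPolynomial.eval z p‖ ≤ 1 / 2) ∧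
      ∀ z ∈ (box (n := n) (fun _ => -(2 * R)) (fun _ => 2 * R) \ U), ∃ p ∈ ps, 2 < ‖MvPolynomial.eval z p‖ := by
    refine hc.induction_on (p := fun s => ∃ ps : List (MvPolynomial (Fin n) ℂ), (∀ p ∈ ps, ∀ z ∈ Γ, ‖MvPolynomial.eval z p‖ ≤ 1 / 2) ∧
      ∀ z ∈ s, ∃ p ∈ ps, 2 < ‖MvPolynomial.eval z p‖) ⟨[], by simp, by simp⟩ ?_ ?_ ?_
    · rintro s t hst ⟨ps, h1, h2⟩
      exact ⟨ps, h1, fun z hz => h2 z (hst hz)⟩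
    · rintro s t ⟨ps, h1, h2⟩ ⟨qs, h3, h4⟩
      refine ⟨ps ++ qs, fun p hp => ?_, ?_⟩
      · rcases List.mem_append.1 hp with h | h
        exacts [h1 p h, h3 p h]
      · rintro z (hz | hz)
        · obtain ⟨p, hp, h⟩ := h2 z hz
          exact ⟨p, List.mem_append_left _ hp, h⟩
        · obtain ⟨p, hp, h⟩ := h4 z hz
          exact ⟨p, List.mem_append_right _ hp, h⟩
    · intro z hz
      have hz' : z ∉ polyHull Γ := fun h => hz.2 (hh h)
      simp only [polyHull, mem_ofPred_eq] at hz'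
      push Not at hz'
      obtain ⟨p, M, hM, hMz⟩ := hz'
      obtain ⟨w0, hw0⟩ := hne
      have hM0 : 0 ≤ M := (norm_nonneg _).trans (hM w0 hw0)
      obtain ⟨M', h1, h2⟩ := exists_between hMz
      have hM'0 : 0 < M' := hM0.trans_lt h1
      obtain ⟨N, hN⟩ := pow_unbounded_of_one_lt 4 ((one_lt_div hM'0).2 h2)
      rw [div_pow, lt_div_iff₀ (by positivity)] at hN
      set q : MvPolynomial (Fin n) ℂ := MvPolynomial.C (((1 / (2 * M' ^ N) : ℝ)) : ℂ) * p ^ N with hq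
      have hqn : ∀ w, ‖MvPolynomial.eval w q‖ = 1 / (2 * M' ^ N) * ‖MvPolynomial.eval w p‖ ^ N := by
        intro w
        rw [hq, map_mul, map_pow, MvPolynomial.eval_C, norm_mul, norm_pow, Complex.norm_real, Real.norm_of_nonneg (by positivity)]
      refine ⟨{w | 2 < ‖MvPolynomial.eval w q‖}, mem_nhdsWithin_of_mem_nhds ((isOpen_lt continuous_const ?_).mem_nhds ?_), [q], ?_, ?_⟩
      · exact (MvPolynomial.continuous_eval q).norm
      · simp only [mem_ofPred_eq]
        rw [hqn, div_mul_eq_mul_div, one_mul, lt_div_iff₀ (by positivity)]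
        linarith
      · simp only [List.mem_singleton, forall_eq]
        intro w hw
        rw [hqn, div_mul_eq_mul_div, one_mul, div_le_div_iff₀ (by positivity) (by positivity)]
        have := pow_le_pow_left₀ (norm_nonneg _) ((hM w hw).trans h1.le) N
        linarith
      · intro w hw
        exact ⟨q, by simp, hw⟩
  obtain ⟨ps, h1, h2⟩ := key
  refine ⟨ps, fun z hz => ?_, fun z hz => ⟨fun i => ?_, fun p hp => h1 p hp z hz⟩⟩
  · by_contra hzU
    obtain ⟨p, hp, hpz⟩ := h2 z ⟨hz.1, hzU⟩
    exact absurd (norm_of_inR (hz.2 p hp)) (not_le.2 hpz)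
  · have := (norm_le_pi_norm z i).trans (hR z hz)
    linarith
end UC

namespace UC
open Set Filter Topology Metric Function

structure Bd (b : ℕ → ℝ → ℂ) : Prop where
  meas : ∀ i, Measurable (b i)
  bdd : ∀ i, ∃ C, 0 ≤ C ∧ ∀ x, ‖b i x‖ ≤ C

variable {E F G : Type} [NormedAddCommGroup E] [NormedSpace ℂ E] [NormedAddCommGroup F] [NormedSpace ℂ F] [NormedAddCommGroup G] [NormedSpace ℂ G]
variable {b : ℕ → ℝ → ℂ}

lemma Bd.ii (hb : Bd b) (i : ℕ) (x y : ℝ) : IntervalIntegrable (b i) volume x y := by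
  obtain ⟨C, _, hC⟩ := hb.bdd i
  exact (intervalIntegrable_const (c := C)).mono_fun (hb.meas i).aestronglyMeasurable (Eventually.of_forall fun x => (hC x).trans (le_abs_self C))

lemma Bd.iis (hb : Bd b) (i : ℕ) {x y : ℝ} {f : ℝ → F} (hf : ContinuousOn f (uIcc x y)) : IntervalIntegrable (fun s => b i s • f s) volume x y :=
  (hb.ii i x y).smul_continuousOn hf

/-- primitive is continuous -/
lemma Bd.prim (hb : Bd b) (i : ℕ) {T : ℝ} (hT : 0 ≤ T) {f : ℝ → F} (hf : ContinuousOn f (Icc 0 T)) :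
    ContinuousOn (fun x => ∫ s in (0:ℝ)..x, b i s • f s) (Icc 0 T) := by
  rw [← uIcc_of_le hT] at hf ⊢
  exact intervalIntegral.continuousOn_primitive_interval' (hb.iis i hf) (by simp)

lemma Bd.prim' (hb : Bd b) (i : ℕ) {f : ℝ → F} (hf : Continuous f) :
    Continuous (fun x => ∫ s in (0:ℝ)..x, b i s • f s) :=
  intervalIntegral.continuous_primitive (fun _ _ => hb.iis i hf.continuousOn) 0

lemma it_cont (hb : Bd b) : ∀ l, Continuous (itIntAux b l)
  | [] => by
    have : itIntAux b [] = fun _ => 1 := by funext x; simp [itIntAux]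
    rw [this]; exact continuous_const
  | i :: l => by
    have : itIntAux b (i :: l) = fun x => ∫ s in (0:ℝ)..x, b i s • itIntAux b l s := by funext x; simp [itIntAux]
    rw [this]; exact hb.prim' i (it_cont hb l)

lemma const_of_small {D : ℝ → F} (h : ∀ x, HasDerivAt D 0 x) (x y : ℝ) : D x = D y :=
  is_const_of_deriv_eq_zero (fun x => (h x).differentiableAt) (fun x => (h x).deriv) x y

lemma hasDeriv_of_sq {D : ℝ → F} {x : ℝ} {K : ℝ} (h : ∀ y, |y - x| ≤ 1 → ‖D y - D x‖ ≤ K * |y - x| ^ 2) : HasDerivAt D 0 x := by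
  rw [hasDerivAt_iff_isLittleO]
  simp only [smul_zero, sub_zero]
  have h1 : (fun y => D y - D x) =O[𝓝 x] fun y => (y - x) ^ 2 := by
    refine Asymptotics.IsBigO.of_bound K ?_
    filter_upwards [closedBall_mem_nhds x one_pos] with y hy
    have := h y (by simpa [Real.dist_eq] using hy)
    simpa using this
  refine h1.trans_isLittleO ?_
  exact (Asymptotics.isLittleO_pow_sub_sub x (m := 2) (by norm_num)).congr_left fun y => by simp

lemma ibp {f g : ℝ → ℂ} (hf : Measurable f) (hg : Measurable g) {C : ℝ} (hfC : ∀ x, ‖f x‖ ≤ C) (hgC : ∀ x, ‖g x‖ ≤ C) (x : ℝ) :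
    (∫ s in (0:ℝ)..x, f s) * (∫ s in (0:ℝ)..x, g s) = (∫ s in (0:ℝ)..x, f s * ∫ t in (0:ℝ)..s, g t) + ∫ s in (0:ℝ)..x, g s * ∫ t in (0:ℝ)..s, f t := by
  have fi : ∀ x y, IntervalIntegrable f volume x y := fun x y => 
    (intervalIntegrable_const (c := C)).mono_fun hf.aestronglyMeasurable (Eventually.of_forall fun x => (hfC x).trans (le_abs_self C))
  have gi : ∀ x y, IntervalIntegrable g volume x y := fun x y => 
    (intervalIntegrable_const (c := C)).mono_fun hg.aestronglyMeasurable (Eventually.of_forall fun x => (hgC x).trans (le_abs_self C))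
  set P : ℝ → ℂ := fun x => ∫ s in (0:ℝ)..x, f s with hP
  set Q : ℝ → ℂ := fun x => ∫ s in (0:ℝ)..x, g s with hQ
  have Pc : Continuous P := intervalIntegral.continuous_primitive fi 0
  have Qc : Continuous Q := intervalIntegral.continuous_primitive gi 0
  have fQ : ∀ x y, IntervalIntegrable (fun s => f s * Q s) volume x y := fun x y => (fi x y).mul_continuousOn Qc.continuousOn
  have gP : ∀ x y, IntervalIntegrable (fun s => g s * P s) volume x y := fun x y => (gi x y).mul_continuousOn Pc.continuousOn
  have Pd : ∀ x y, P y - P x = ∫ s in x..y, f s := fun x y => intervalIntegral.integral_interval_sub_left (fi _ _) (fi _ _)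
  have Qd : ∀ x y, Q y - Q x = ∫ s in x..y, g s := fun x y => intervalIntegral.integral_interval_sub_left (gi _ _) (gi _ _)
  have C0 : 0 ≤ C := (norm_nonneg _).trans (hfC 0)
  have Pn : ∀ x y, ‖P y - P x‖ ≤ C * |y - x| := fun x y => by
    rw [Pd]; exact intervalIntegral.norm_integral_le_of_norm_le_const fun s _ => hfC s
  have Qn : ∀ x y, ‖Q y - Q x‖ ≤ C * |y - x| := fun x y => by
    rw [Qd]; exact intervalIntegral.norm_integral_le_of_norm_le_const fun s _ => hgC s
  set D : ℝ → ℂ := fun x => P x * Q x - ((∫ s in (0:ℝ)..x, f s * Q s) + ∫ s in (0:ℝ)..x, g s * P s) with hD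
  have key : ∀ x y, ‖D y - D x‖ ≤ (2 * C ^ 2) * |y - x| ^ 2 := by
    intro x y
    have e : D y - D x = ∫ s in x..y, (f s * (Q y - Q s) + g s * (P x - P s)) := by
      have e1 : D y - D x = (P y - P x) * Q y + P x * (Q y - Q x) - ((∫ s in x..y, f s * Q s) + ∫ s in x..y, g s * P s) := by
        rw [← intervalIntegral.integral_interval_sub_left (fQ 0 y) (fQ 0 x), ← intervalIntegral.integral_interval_sub_left (gP 0 y) (gP 0 x)]
        simp only [hD]; ring
      have e2 : (∫ s in x..y, (f s * (Q y - Q s) + g s * (P x - P s))) = 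
          ∫ s in x..y, ((f s * Q y - f s * Q s) + (g s * P x - g s * P s)) := by
        congr 1; funext s; ring
      rw [e1, e2, intervalIntegral.integral_add (((fi _ _).mul_const _).sub (fQ _ _)) (((gi _ _).mul_const _).sub (gP _ _)),
        intervalIntegral.integral_sub ((fi _ _).mul_const _) (fQ _ _), intervalIntegral.integral_sub ((gi _ _).mul_const _) (gP _ _),
        intervalIntegral.integral_mul_const, intervalIntegral.integral_mul_const, Pd, Qd]
      ring
    rw [e]
    refine (intervalIntegral.norm_integral_le_of_norm_le_const (C := 2 * C ^ 2 * |y - x|) fun s hs => ?_).trans (by rw [sq |y - x|]; linarith)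
    have hs' : s ∈ uIcc x y := uIoc_subset_uIcc hs
    have b1 : |y - s| ≤ |y - x| := abs_sub_right_of_mem_uIcc hs'
    have b2 : |x - s| ≤ |y - x| := by rw [abs_sub_comm x s]; exact abs_sub_left_of_mem_uIcc hs'
    calc _ ≤ ‖f s‖ * ‖Q y - Q s‖ + ‖g s‖ * ‖P x - P s‖ := (norm_add_le _ _).trans (by rw [norm_mul, norm_mul])
      _ ≤ C * (C * |y - x|) + C * (C * |y - x|) := by
        gcongr
        · exact hfC s
        · exact (Qn s y).trans (by gcongr)
        · exact hgC s
        · exact (Pn s x).trans (by gcongr)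
      _ = _ := by ring
  have := const_of_small (fun x => hasDeriv_of_sq (fun y _ => key x y)) x 0
  simp only [hD, hP, hQ, intervalIntegral.integral_same, mul_zero, add_zero, sub_zero] at this
  exact sub_eq_zero.1 this

lemma ibp' {f g : ℝ → ℂ} (hf : Measurable f) (hg : Measurable g) {C : ℝ} (x : ℝ) (hfC : ∀ s ∈ uIcc 0 x, ‖f s‖ ≤ C) (hgC : ∀ s ∈ uIcc 0 x, ‖g s‖ ≤ C) :
    (∫ s in (0:ℝ)..x, f s) * (∫ s in (0:ℝ)..x, g s) = (∫ s in (0:ℝ)..x, f s * ∫ t in (0:ℝ)..s, g t) + ∫ s in (0:ℝ)..x, g s * ∫ t in (0:ℝ)..s, f t := by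
  have C0 : 0 ≤ C := (norm_nonneg _).trans (hfC 0 (by simp))
  have := ibp (f := (uIcc 0 x).indicator f) (g := (uIcc 0 x).indicator g) (hf.indicator measurableSet_uIcc) (hg.indicator measurableSet_uIcc) (C := C)
    (fun s => by by_cases h : s ∈ uIcc 0 x <;> simp [h, hfC, C0]) (fun s => by by_cases h : s ∈ uIcc 0 x <;> simp [h, hgC, C0]) x
  have e : ∀ q : ℝ → ℂ, ∀ s ∈ uIcc 0 x, (∫ t in (0:ℝ)..s, (uIcc 0 x).indicator q t) = ∫ t in (0:ℝ)..s, q t := by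
    intro q s hs
    refine intervalIntegral.integral_congr fun t ht => ?_
    rw [indicator_of_mem (uIcc_subset_uIcc (by simp) hs ht)]
  rw [e f x (by simp), e g x (by simp)] at this
  rw [this]
  congr 1
  · refine intervalIntegral.integral_congr fun s hs => ?_
    rw [indicator_of_mem hs, e g s hs]
  · refine intervalIntegral.integral_congr fun s hs => ?_
    rw [indicator_of_mem hs, e f s hs]

/-- span of iterated integrals with coefficients in `F` -/
def SP (b : ℕ → ℝ → ℂ) (F : Type) [NormedAddCommGroup F] [NormedSpace ℂ F] : Submodule ℂ (ℝ → F) :=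
  Submodule.span ℂ {f | ∃ l, ∃ c : F, f = fun x => itIntAux b l x • c}
def SP0 (b : ℕ → ℝ → ℂ) (F : Type) [NormedAddCommGroup F] [NormedSpace ℂ F] : Submodule ℂ (ℝ → F) :=
  Submodule.span ℂ {f | ∃ l, l ≠ [] ∧ ∃ c : F, f = fun x => itIntAux b l x • c}

lemma SP.cont (hb : Bd b) {f : ℝ → F} (hf : f ∈ SP b F) : Continuous f := by
  induction hf using Submodule.span_induction with
  | mem f h => obtain ⟨l, c, rfl⟩ := h; exact (it_cont hb l).smul continuous_const
  | zero => exact continuous_const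
  | add f g _ _ h1 h2 => exact h1.add h2
  | smul r f _ h => exact h.const_smul r

lemma SP.word (l : List ℕ) (c : F) : (fun x => itIntAux b l x • c) ∈ SP b F := Submodule.subset_span ⟨l, c, rfl⟩
lemma SP.word1 (l : List ℕ) : itIntAux b l ∈ SP b ℂ := by
  have := SP.word (b := b) l (1:ℂ)
  simpa using this
lemma SP.const (c : F) : (fun _ => c) ∈ SP b F := by
  have := SP.word (b := b) [] c
  simpa [itIntAux] using this
lemma SP0_le : SP0 b F ≤ SP b F := Submodule.span_mono fun _ ⟨l, _, c, h⟩ => ⟨l, c, h⟩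

lemma SP.int [CompleteSpace F] (hb : Bd b) (i : ℕ) {f : ℝ → F} (hf : f ∈ SP b F) : (fun x => ∫ s in (0:ℝ)..x, b i s • f s) ∈ SP0 b F := by
  have hf' := hf
  unfold SP at hf
  induction hf using Submodule.span_induction with
  | mem f h => 
    obtain ⟨l, c, rfl⟩ := h
    refine Submodule.subset_span ⟨i :: l, by simp, c, ?_⟩
    funext x
    simp only [itIntAux, ← mul_smul]
    exact intervalIntegral.integral_smul_const (fun s => b i s * itIntAux b l s) c
  | zero => simp only [Pi.zero_apply, smul_zero, intervalIntegral.integral_zero]; exact Submodule.zero_mem _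
  | add f g hf hg h1 h2 => 
    have := Submodule.add_mem _ (h1 hf) (h2 hg)
    convert this using 1
    funext x
    simp only [Pi.add_apply, smul_add]
    exact intervalIntegral.integral_add (hb.iis i (SP.cont hb hf).continuousOn) (hb.iis i (SP.cont hb hg).continuousOn)
  | smul r f hf h =>
    have := Submodule.smul_mem _ r (h hf)
    convert this using 1
    funext x
    simp only [Pi.smul_apply]
    rw [← intervalIntegral.integral_smul]
    congr 1; funext s; rw [smul_comm]

lemma shuffle (hb : Bd b) : ∀ n, ∀ u v : List ℕ, u.length + v.length = n → (fun x => itIntAux b u x * itIntAux b v x) ∈ SP b ℂ := by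
  intro n
  induction n with
  | zero => 
    intro u v h
    have : u = [] := by rw [← List.length_eq_zero_iff]; omega
    have : v = [] := by rw [← List.length_eq_zero_iff]; omega
    subst_vars
    simpa [itIntAux] using SP.const (b := b) (1:ℂ)
  | succ n ih =>
    intro u v h
    match u, v, h with
    | [], v, _ => simpa [itIntAux] using SP.word1 (b := b) v
    | u, [], _ => simpa [itIntAux] using SP.word1 (b := b) u
    | i :: u, j :: v, h =>
      have h1 := SP0_le (SP.int hb i (ih u (j :: v) (by simp at h ⊢; omega)))
      have h2 := SP0_le (SP.int hb j (ih (i :: u) v (by simp at h ⊢; omega)))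
      have := Submodule.add_mem _ h1 h2
      convert this using 1
      funext x
      obtain ⟨C1, p1, q1⟩ := hb.bdd i
      obtain ⟨C2, p2, q2⟩ := hb.bdd j
      obtain ⟨C3, q3⟩ := (isCompact_uIcc (a := 0) (b := x)).exists_bound_of_continuousOn (it_cont hb u).continuousOn
      obtain ⟨C4, q4⟩ := (isCompact_uIcc (a := 0) (b := x)).exists_bound_of_continuousOn (it_cont hb v).continuousOn
      have := ibp' (f := fun s => b i s * itIntAux b u s) (g := fun s => b j s * itIntAux b v s) 
        ((hb.meas i).mul (it_cont hb u).measurable) ((hb.meas j).mul (it_cont hb v).measurable) (C := max (C1 * C3) (C2 * C4)) x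
        (fun s hs => by
          refine le_max_of_le_left ?_
          rw [norm_mul]; exact mul_le_mul (q1 s) (q3 s hs) (norm_nonneg _) p1)
        (fun s hs => by
          refine le_max_of_le_right ?_
          rw [norm_mul]; exact mul_le_mul (q2 s) (q4 s hs) (norm_nonneg _) p2)
      simp only [itIntAux, Pi.add_apply, smul_eq_mul]
      rw [this]
      congr 1
      · congr 1; funext s; ring
      · congr 1; funext s; ring
end UC

namespace UC
open Set Filter Topology Metric Function
variable {E F G : Type} [NormedAddCommGroup E] [NormedSpace ℂ E] [NormedAddCommGroup F] [NormedSpace ℂ F] [NormedAddCommGroup G] [NormedSpace ℂ G]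
variable {b : ℕ → ℝ → ℂ}

lemma SP.clm (L : F →L[ℂ] G) {f : ℝ → F} (hf : f ∈ SP b F) : (fun x => L (f x)) ∈ SP b G := by
  unfold SP at hf
  induction hf using Submodule.span_induction with
  | mem f h => 
    obtain ⟨l, c, rfl⟩ := h
    simp only [map_smul]
    exact SP.word l (L c)
  | zero => simp only [Pi.zero_apply, map_zero]; exact Submodule.zero_mem _
  | add f g hf hg h1 h2 => 
    simp only [Pi.add_apply, map_add]
    exact Submodule.add_mem _ h1 h2
  | smul r f hf h =>
    simp only [Pi.smul_apply, map_smul]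
    exact Submodule.smul_mem _ r h

lemma SP.smul_word (hb : Bd b) (u : List ℕ) {f : ℝ → F} (hf : f ∈ SP b F) : (fun x => itIntAux b u x • f x) ∈ SP b F := by
  unfold SP at hf
  induction hf using Submodule.span_induction with
  | mem f h => 
    obtain ⟨l, c, rfl⟩ := h
    have := SP.clm (ContinuousLinearMap.toSpanSingleton ℂ c) (shuffle hb _ u l rfl)
    simpa [mul_smul] using this
  | zero => simp only [Pi.zero_apply, smul_zero]; exact Submodule.zero_mem _
  | add f g hf hg h1 h2 => 
    simp only [Pi.add_apply, smul_add]
    exact Submodule.add_mem _ h1 h2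
  | smul r f hf h =>
    simp only [Pi.smul_apply, smul_comm _ r]
    exact Submodule.smul_mem _ r h

lemma SP.bil (hb : Bd b) (B : E →L[ℂ] F →L[ℂ] G) {f : ℝ → E} {g : ℝ → F} (hf : f ∈ SP b E) (hg : g ∈ SP b F) : (fun x => B (f x) (g x)) ∈ SP b G := by
  unfold SP at hf
  induction hf using Submodule.span_induction with
  | mem f h => 
    obtain ⟨l, c, rfl⟩ := h
    have := SP.smul_word hb l (SP.clm (B c) hg)
    simpa using this
  | zero => simp only [Pi.zero_apply, map_zero, zero_apply]; exact Submodule.zero_mem _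
  | add f g hf hg h1 h2 => 
    simp only [Pi.add_apply, map_add, add_apply]
    exact Submodule.add_mem _ h1 h2
  | smul r f hf h =>
    simp only [Pi.smul_apply, map_smul, smul_apply]
    exact Submodule.smul_mem _ r h

lemma SP.mul (hb : Bd b) {f g : ℝ → ℂ} (hf : f ∈ SP b ℂ) (hg : g ∈ SP b ℂ) : (fun x => f x * g x) ∈ SP b ℂ :=
  SP.bil hb (ContinuousLinearMap.mul ℂ ℂ) hf hg
lemma SP.smulc {f : ℝ → ℂ} (hf : f ∈ SP b ℂ) (c : F) : (fun x => f x • c) ∈ SP b F :=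
  SP.clm (ContinuousLinearMap.toSpanSingleton ℂ c) hf
lemma SP.sum {ι : Type*} (s : Finset ι) {f : ι → ℝ → F} (h : ∀ i ∈ s, f i ∈ SP b F) : (fun x => ∑ i ∈ s, f i x) ∈ SP b F := by
  have := Submodule.sum_mem (SP b F) h
  convert this using 1
  funext x; simp
lemma SP.prod (hb : Bd b) {ι : Type*} (s : Finset ι) {f : ι → ℝ → ℂ} (h : ∀ i ∈ s, f i ∈ SP b ℂ) : (fun x => ∏ i ∈ s, f i x) ∈ SP b ℂ := by
  classical
  induction s using Finset.induction_on with
  | empty => simpa using SP.const (b := b) (1:ℂ)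
  | insert i s hi ih =>
    simp only [Finset.prod_insert hi]
    exact SP.mul hb (h i (by simp)) (ih fun j hj => h j (by simp [hj]))
lemma SP.poly (hb : Bd b) {n : ℕ} {A : ℝ → Fin n → ℂ} (hA : ∀ i, (fun x => A x i) ∈ SP b ℂ) (p : MvPolynomial (Fin n) ℂ) : 
    (fun x => MvPolynomial.eval (A x) p) ∈ SP b ℂ := by
  induction p using MvPolynomial.induction_on with
  | C c => simpa using SP.const (b := b) c
  | add p q hp hq => simp only [map_add]; exact Submodule.add_mem _ hp hq
  | mul_X p i hp => simpa using SP.mul hb hp (hA i)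
lemma SP.multilin (hb : Bd b) {n m : ℕ} {A : ℝ → Fin n → ℂ} (hA : ∀ i, (fun x => A x i) ∈ SP b ℂ) 
    (L : ContinuousMultilinearMap ℂ (fun _ : Fin m => (Fin n → ℂ)) F) : (fun x => L fun _ => A x) ∈ SP b F := by
  classical
  have e : ∀ x, L (fun _ => A x) = ∑ r : Fin m → Fin n, (∏ j, A x (r j)) • L (fun j => Pi.single (r j) 1) := by
    intro x
    have h1 : (fun _ : Fin m => A x) = fun _ => ∑ i, A x i • (Pi.single i (1:ℂ) : Fin n → ℂ) := by
      funext _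
      exact pi_eq_sum_univ' (A x)
    rw [h1, L.map_sum]
    congr 1; funext r
    rw [L.map_smul_univ]
  simp only [e]
  exact SP.sum _ fun r _ => SP.smulc (SP.prod hb _ fun j _ => hA (r j)) _

/-- uniform limits on `[0,T]` -/
def CC (b : ℕ → ℝ → ℂ) (T : ℝ) (f : ℝ → F) : Prop := ∀ ε > 0, ∃ s ∈ SP b F, ∀ x ∈ Icc 0 T, ‖f x - s x‖ ≤ ε
def CC0 (b : ℕ → ℝ → ℂ) (T : ℝ) (f : ℝ → F) : Prop := ∀ ε > 0, ∃ s ∈ SP0 b F, ∀ x ∈ Icc 0 T, ‖f x - s x‖ ≤ ε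

variable {T : ℝ}
lemma CC0.cc {f : ℝ → F} (h : CC0 b T f) : CC b T f := fun ε hε => by
  obtain ⟨s, hs, h⟩ := h ε hε
  exact ⟨s, SP0_le hs, h⟩
lemma CC.of_mem {f : ℝ → F} (h : f ∈ SP b F) : CC b T f := fun ε hε => ⟨f, h, by simp [hε.le]⟩
lemma CC.congr {f g : ℝ → F} (h : CC b T f) (hg : ∀ x ∈ Icc 0 T, g x = f x) : CC b T g := fun ε hε => by
  obtain ⟨s, hs, h⟩ := h ε hε
  exact ⟨s, hs, fun x hx => by rw [hg x hx]; exact h x hx⟩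
lemma CC.lim {f : ℝ → F} (h : ∀ ε > 0, ∃ g, CC b T g ∧ ∀ x ∈ Icc 0 T, ‖f x - g x‖ ≤ ε) : CC b T f := fun ε hε => by
  obtain ⟨g, hg, h1⟩ := h (ε / 2) (by positivity)
  obtain ⟨s, hs, h2⟩ := hg (ε / 2) (by positivity)
  refine ⟨s, hs, fun x hx => ?_⟩
  have := norm_sub_le_norm_sub_add_norm_sub (f x) (g x) (s x)
  linarith [h1 x hx, h2 x hx]
lemma CC.add {f g : ℝ → F} (hf : CC b T f) (hg : CC b T g) : CC b T (fun x => f x + g x) := fun ε hε => by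
  obtain ⟨s, hs, h1⟩ := hf (ε / 2) (by positivity)
  obtain ⟨t, ht, h2⟩ := hg (ε / 2) (by positivity)
  refine ⟨s + t, Submodule.add_mem _ hs ht, fun x hx => ?_⟩
  have : f x + g x - (s + t) x = (f x - s x) + (g x - t x) := by simp only [Pi.add_apply]; abel
  rw [this]
  have := norm_add_le (f x - s x) (g x - t x)
  linarith [h1 x hx, h2 x hx]
lemma CC0.add {f g : ℝ → F} (hf : CC0 b T f) (hg : CC0 b T g) : CC0 b T (fun x => f x + g x) := fun ε hε => by
  obtain ⟨s, hs, h1⟩ := hf (ε / 2) (by positivity)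
  obtain ⟨t, ht, h2⟩ := hg (ε / 2) (by positivity)
  refine ⟨s + t, Submodule.add_mem _ hs ht, fun x hx => ?_⟩
  have : f x + g x - (s + t) x = (f x - s x) + (g x - t x) := by simp only [Pi.add_apply]; abel
  rw [this]
  have := norm_add_le (f x - s x) (g x - t x)
  linarith [h1 x hx, h2 x hx]
lemma CC0.sum {ι : Type*} (s : Finset ι) {f : ι → ℝ → F} (h : ∀ i, CC0 b T (f i)) : CC0 b T (fun x => ∑ i ∈ s, f i x) := by
  classical
  induction s using Finset.induction_on with
  | empty => simp only [Finset.sum_empty]; exact fun ε hε => ⟨0, Submodule.zero_mem _, by simp [hε.le]⟩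
  | insert i s hi ih => simp only [Finset.sum_insert hi]; exact (h i).add ih
lemma CC.contOn (hb : Bd b) {f : ℝ → F} (hf : CC b T f) : ContinuousOn f (Icc 0 T) := by
  refine continuousOn_of_uniform_approx_of_continuousOn fun u hu => ?_
  obtain ⟨ε, hε, hu⟩ := Metric.mem_uniformity_dist.1 hu
  obtain ⟨s, hs, h⟩ := hf (ε / 2) (by positivity)
  refine ⟨s, (SP.cont hb hs).continuousOn, fun x hx => hu ?_⟩
  rw [dist_eq_norm]
  exact (h x hx).trans_lt (by linarith)
lemma CC.bdd (hb : Bd b) {f : ℝ → F} (hf : CC b T f) : ∃ C > 0, ∀ x ∈ Icc 0 T, ‖f x‖ ≤ C := by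
  obtain ⟨C, h⟩ := isCompact_Icc.exists_bound_of_continuousOn (hf.contOn hb)
  exact ⟨max C 1, by positivity, fun x hx => (h x hx).trans (le_max_left _ _)⟩

lemma CC.bil (hb : Bd b) (B : E →L[ℂ] F →L[ℂ] G) {f : ℝ → E} {g : ℝ → F} (hf : CC b T f) (hg : CC b T g) : CC b T (fun x => B (f x) (g x)) := by
  obtain ⟨C, hC, hfC⟩ := hf.bdd hb
  obtain ⟨C', hC', hgC⟩ := hg.bdd hb
  intro ε hε
  set N := ‖B‖ + 1
  have hN : 0 < N := by positivity
  have hBN : ‖B‖ ≤ N := by simp [N]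
  set δ := min 1 (ε / (2 * N * (C + 1 + C')))
  have hδ : 0 < δ := by positivity
  obtain ⟨t, ht, h2⟩ := hg δ hδ
  obtain ⟨s, hs, h1⟩ := hf δ hδ
  refine ⟨_, SP.bil hb B hs ht, fun x hx => ?_⟩
  have e : B (f x) (g x) - B (s x) (t x) = B (f x - s x) (g x) + B (s x) (g x - t x) := by
    simp only [map_sub, sub_apply]; abel
  have hsx : ‖s x‖ ≤ C + 1 := by
    have : s x = f x - (f x - s x) := by abel
    rw [this]
    exact (norm_sub_le _ _).trans (add_le_add (hfC x hx) ((h1 x hx).trans (min_le_left _ _)))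
  rw [e]
  calc _ ≤ ‖B‖ * ‖f x - s x‖ * ‖g x‖ + ‖B‖ * ‖s x‖ * ‖g x - t x‖ := (norm_add_le _ _).trans (add_le_add (B.le_opNorm₂ _ _) (B.le_opNorm₂ _ _))
    _ ≤ N * δ * C' + N * (C + 1) * δ := by
      gcongr
      · exact h1 x hx
      · exact hgC x hx
      · exact h2 x hx
    _ = δ * (N * (C + 1 + C')) := by ring
    _ ≤ (ε / (2 * N * (C + 1 + C'))) * (N * (C + 1 + C')) := by gcongr; exact min_le_right _ _
    _ = ε / 2 := by field_simp
    _ ≤ ε := by linarith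

lemma CC.int [CompleteSpace F] (hb : Bd b) (i : ℕ) {f : ℝ → F} (hf : CC b T f) : CC0 b T (fun x => ∫ s in (0:ℝ)..x, b i s • f s) := by
  intro ε hε
  obtain ⟨C, hC, hbC⟩ := hb.bdd i
  obtain ⟨s, hs, h⟩ := hf (ε / ((C + 1) * (|T| + 1))) (by positivity)
  refine ⟨_, SP.int hb i hs, fun x hx => ?_⟩
  have hsub : uIcc 0 x ⊆ Icc 0 T := by rw [uIcc_of_le hx.1]; exact Icc_subset_Icc_right hx.2
  rw [← intervalIntegral.integral_sub (hb.iis i ((hf.contOn hb).mono hsub)) (hb.iis i (SP.cont hb hs).continuousOn)]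
  refine (intervalIntegral.norm_integral_le_of_norm_le_const (C := C * (ε / ((C + 1) * (|T| + 1)))) fun y hy => ?_).trans ?_
  · rw [← smul_sub, norm_smul]
    exact mul_le_mul (hbC y) (h y (hsub (uIoc_subset_uIcc hy))) (norm_nonneg _) hC
  · have hx' : |x - 0| ≤ |T| := by rw [sub_zero]; exact abs_le_abs_of_nonneg hx.1 hx.2
    calc _ ≤ (C + 1) * (ε / ((C + 1) * (|T| + 1))) * (|T| + 1) := by gcongr <;> linarith
      _ = ε := by field_simp

lemma CC0.end_zero (hT : 0 ≤ T) (huc : ∀ l, l ≠ [] → itIntAux b l T = 0) {f : ℝ → F} (hf : CC0 b T f) : f T = 0 := by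
  have hz : ∀ s ∈ SP0 b F, s T = 0 := by
    intro s hs
    unfold SP0 at hs
    induction hs using Submodule.span_induction with
    | mem f h => obtain ⟨l, hl, c, rfl⟩ := h; simp [huc l hl]
    | zero => rfl
    | add f g hf hg h1 h2 => simp [h1, h2]
    | smul r f hf h => simp [h]
  rw [← norm_le_zero_iff]
  refine le_of_forall_pos_le_add fun ε hε => ?_
  obtain ⟨s, hs, h⟩ := hf ε hε
  have := h T ⟨hT, le_rfl⟩
  rw [hz s hs, sub_zero] at this
  linarith
end UC

namespace UC
open Set Filter Topology Metric Function
variable {b : ℕ → ℝ → ℂ} {T : ℝ}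

lemma abs_co_le {n : ℕ} (j : Fin n × Bool) (z : Fin n → ℂ) : |co j z| ≤ ‖z j.1‖ := by
  unfold co
  split_ifs
  · exact Complex.abs_im_le_norm _
  · exact Complex.abs_re_le_norm _

lemma inR_of_norm {w : ℂ} (h : ‖w‖ ≤ 1) : inR w :=
  ⟨abs_le.1 ((Complex.abs_re_le_norm _).trans h), abs_le.1 ((Complex.abs_im_le_norm _).trans h)⟩

lemma mem_box_of_norm {n : ℕ} {h : Fin n × Bool → ℝ} {z : Fin n → ℂ} (hz : ∀ j : Fin n × Bool, ‖z j.1‖ ≤ h j) : z ∈ box (fun j => -h j) h := 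
  fun j => abs_le.1 ((abs_co_le j z).trans (hz j))

lemma taylor_term {n : ℕ} {F : Type} [NormedAddCommGroup F] [NormedSpace ℂ F] [CompleteSpace F] {f : (Fin n → ℂ) → F} {W : Set (Fin n → ℂ)} 
    (hW : IsOpen W) (hf : ∀ w ∈ W, DifferentiableAt ℂ f w) (h0 : (0 : Fin n → ℂ) ∈ W) (v : Fin n → ℂ) (m : ℕ) :
    iteratedDeriv m (fun l : ℂ => f (l • v)) 0 = iteratedFDeriv ℂ m f 0 (fun _ => v) := by
  set g : ℂ →L[ℂ] (Fin n → ℂ) := ContinuousLinearMap.toSpanSingleton ℂ v with hg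
  have e : (fun l : ℂ => f (l • v)) = f ∘ g := by funext l; simp [hg]
  have hW' : IsOpen (g ⁻¹' W) := hW.preimage g.continuous
  have h0' : g 0 ∈ W := by simpa using h0
  have := ContinuousLinearMap.iteratedFDerivWithin_comp_right g (hol_contDiff hW hf m) hW.uniqueDiffOn hW'.uniqueDiffOn (x := 0) h0' (i := m) le_rfl
  rw [iteratedFDerivWithin_of_isOpen m hW' h0', iteratedFDerivWithin_of_isOpen m hW h0'] at this
  rw [iteratedDeriv_eq_iteratedFDeriv, e, this]
  simp [hg]

theorem approx_zero (hb : Bd b) {n : ℕ} {h : Fin n × Bool → ℝ} {A : ℝ → Fin n → ℂ} (hA : ∀ i, (fun x => A x i) ∈ SP b ℂ)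
    (h0 : 0 ≤ h) (hAh : ∀ x ∈ Icc 0 T, ∀ j : Fin n × Bool, 2 * ‖A x j.1‖ ≤ h j) {F : Type} [NormedAddCommGroup F] [NormedSpace ℂ F] [CompleteSpace F] 
    {f : (Fin n → ℂ) → F} (hf : HolNear f (box (fun j => -h j) h)) : CC b T (fun x => f (A x)) := by
  obtain ⟨W, hW, hBW, hfW⟩ := mem_nhdsSet_iff_exists.1 hf
  have hd : ∀ w ∈ W, DifferentiableAt ℂ f w := fun w hw => hfW hw
  have hcont : ContinuousOn f (box (fun j => -h j) h) := fun z hz => (hd z (hBW hz)).continuousAt.continuousWithinAt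
  obtain ⟨M, hM⟩ := (isCompact_box _ _).exists_bound_of_continuousOn hcont
  have hmem : ∀ x ∈ Icc 0 T, ∀ l : ℂ, ‖l‖ ≤ 2 → l • A x ∈ box (fun j => -h j) h := by
    intro x hx l hl
    refine mem_box_of_norm fun j => ?_
    rw [Pi.smul_apply, norm_smul]
    exact (mul_le_mul_of_nonneg_right hl (norm_nonneg _)).trans (hAh x hx j)
  have h0W : (0 : Fin n → ℂ) ∈ W := hBW (mem_box_of_norm fun j => by simpa using h0 j)
  have hdiff : ∀ x ∈ Icc 0 T, DifferentiableOn ℂ (fun l : ℂ => f (l • A x)) (closedBall 0 2) := by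
    intro x hx l hl
    have := hd _ (hBW (hmem x hx l (by simpa using hl)))
    exact (DifferentiableAt.comp (g := f) (f := fun l : ℂ => l • A x) l this (by fun_prop)).differentiableWithinAt
  set c : ℕ → ℝ → F := fun m x => ((m.factorial : ℂ))⁻¹ • iteratedFDeriv ℂ m f 0 (fun _ => A x) with hc
  have hsum : ∀ x ∈ Icc 0 T, HasSum (fun m => c m x) (f (A x)) := by
    intro x hx
    have := Complex.hasSum_taylorSeries_on_ball ((hdiff x hx).mono ball_subset_closedBall) (z := 1) (by simp)
    simpa [taylor_term hW hd h0W, hc] using this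
  have hbd : ∀ m, ∀ x ∈ Icc 0 T, ‖c m x‖ ≤ M * (1 / 2) ^ m := by
    intro m x hx
    have := Complex.norm_iteratedDeriv_le_of_forall_mem_sphere_norm_le (C := M) m (by norm_num : (0:ℝ) < 2)
      (((hdiff x hx).mono closure_ball_subset_closedBall).diffContOnCl) (fun z hz => hM _ (hmem x hx z (by simpa using hz.le)))
    rw [taylor_term hW hd h0W] at this
    have hp : (0:ℝ) < m.factorial := by exact_mod_cast m.factorial_pos
    rw [hc]; simp only
    rw [norm_smul, norm_inv, Complex.norm_natCast]
    calc _ ≤ (m.factorial : ℝ)⁻¹ * (m.factorial * M / 2 ^ m) := by gcongr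
      _ = _ := by rw [one_div, inv_pow]; field_simp
  have hsu : Summable (fun m : ℕ => M * (1 / 2 : ℝ) ^ m) := summable_geometric_two.mul_left M
  have hunif := tendstoUniformlyOn_tsum_nat hsu hbd
  refine CC.lim fun ε hε => ?_
  obtain ⟨N, hN⟩ := (Metric.tendstoUniformlyOn_iff.1 hunif ε hε).exists
  refine ⟨fun x => ∑ m ∈ Finset.range N, c m x, CC.of_mem (SP.sum _ fun m _ => ?_), fun x hx => ?_⟩
  · exact Submodule.smul_mem _ _ (SP.multilin hb hA _)
  · have := hN x hx
    rw [(hsum x hx).tsum_eq, dist_eq_norm] at this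
    exact this.le

theorem approx (hb : Bd b) (m : ℕ) : ∀ (n : ℕ) (ps : List (MvPolynomial (Fin n) ℂ)), ps.length = m → ∀ (h : Fin n × Bool → ℝ) (A : ℝ → Fin n → ℂ), 
    (∀ i, (fun x => A x i) ∈ SP b ℂ) → 0 ≤ h → (∀ x ∈ Icc 0 T, ∀ j : Fin n × Bool, 2 * ‖A x j.1‖ ≤ h j) → 
    (∀ x ∈ Icc 0 T, ∀ p ∈ ps, ‖MvPolynomial.eval (A x) p‖ ≤ 1 / 2) → ∀ (F : Type) [NormedAddCommGroup F] [NormedSpace ℂ F] [CompleteSpace F] 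
    (f : (Fin n → ℂ) → F), HolNear f (KK ps (fun j => -h j) h) → CC b T (fun x => f (A x)) := by
  induction m with
  | zero =>
    intro n ps hps h A hA h0 hAh hp F _ _ _ f hf
    rw [List.length_eq_zero_iff] at hps
    subst hps
    rw [KK_nil] at hf
    exact approx_zero hb hA h0 hAh hf
  | succ m ih =>
    intro n ps hps h A hA h0 hAh hp F _ _ _ f hf
    obtain ⟨p, ps, rfl⟩ := List.exists_cons_of_length_eq_add_one hps
    have hps' : ps.length = m := by simpa using hps
    have hlh : (fun j => -h j) ≤ h := fun j => (neg_nonpos.2 (h0 j)).trans (h0 j)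
    obtain ⟨G, hG, hGf⟩ := extP m n p ps hps' _ _ hlh F f hf
    have e : liftB (-1) (fun j => -h j) = fun j => -(liftB 1 h j) := by
      funext ⟨i, c⟩
      refine Fin.cases ?_ (fun i => ?_) i <;> rfl
    rw [e] at hG
    have := ih (n+1) (liftP ps) (by simp [liftP, hps']) (liftB 1 h) (fun x => gr p (A x)) ?_ ?_ ?_ ?_ F G hG
    · refine this.congr fun x hx => ?_
      have hx' : A x ∈ KK (p :: ps) (fun j => -h j) h := by
        refine ⟨mem_box_of_norm fun j => ?_, fun q hq => inR_of_norm ((hp x hx q hq).trans (by norm_num))⟩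
        have := hAh x hx j
        have := norm_nonneg (A x j.1)
        linarith
      exact ((eventually_nhdsSet_iff_forall.1 hGf _ hx').self_of_nhds).symm
    · intro i
      refine Fin.cases ?_ (fun i => ?_) i
      · exact SP.poly hb hA p
      · exact hA i
    · rintro ⟨i, c⟩
      refine Fin.cases ?_ (fun i => ?_) i
      · exact zero_le_one
      · exact h0 (i, c)
    · rintro x hx ⟨i, c⟩
      refine Fin.cases ?_ (fun i => ?_) i
      · have := hp x hx p (by simp)
        change 2 * ‖MvPolynomial.eval (A x) p‖ ≤ 1
        linarith
      · exact hAh x hx (i, c)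
    · intro x hx q hq
      simp only [liftP, List.mem_map] at hq
      obtain ⟨q, hq, rfl⟩ := hq
      rw [MvPolynomial.eval_rename]
      exact hp x hx q (by simp [hq])

theorem transport (hb : Bd b) (hT : 0 ≤ T) (huc : ∀ l, l ≠ [] → itIntAux b l T = 0) {n : ℕ} {V : Type} [NormedAddCommGroup V] [NormedSpace ℂ V] [CompleteSpace V]
    {Ω : Fin n → ℝ → V →L[ℂ] V} (hΩ : ∀ i, CC b T (Ω i)) {y : ℝ → V} (hyc : ContinuousOn y (Icc 0 T)) 
    (hy : ∀ x ∈ Icc 0 T, y x = y 0 + ∑ i : Fin n, ∫ s in (0:ℝ)..x, b i s • (Ω i s) (y s)) : y T = y 0 := by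
  set Φ : (ℝ → V) → ℝ → V := fun u x => ∑ i : Fin n, ∫ s in (0:ℝ)..x, b i s • (Ω i s) (u s) with hΦ
  have hΦc : ∀ u, CC b T u → CC0 b T (Φ u) := fun u hu => 
    CC0.sum _ fun i => CC.int hb i (CC.bil hb (ContinuousLinearMap.id ℂ (V →L[ℂ] V)) (hΩ i) hu)
  set Y : ℕ → ℝ → V := fun m => Nat.rec (fun _ => y 0) (fun _ u x => y 0 + Φ u x) m with hY
  have hYs : ∀ m x, Y (m+1) x = y 0 + Φ (Y m) x := fun m x => rfl
  have hYc : ∀ m, CC b T (Y m) := by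
    intro m
    induction m with
    | zero => exact CC.of_mem (SP.const _)
    | succ m ih => exact (CC.of_mem (SP.const (y 0))).add (hΦc _ ih).cc
  choose Cb hCb hbC using hb.bdd
  choose CΩ hCΩ hΩC using fun i => (hΩ i).bdd hb
  set K : ℝ := ∑ i : Fin n, Cb i * CΩ i with hK
  have hK0 : 0 ≤ K := Finset.sum_nonneg fun i _ => mul_nonneg (hCb i) (hCΩ i).le
  obtain ⟨M, hM⟩ := isCompact_Icc.exists_bound_of_continuousOn (hyc.sub (continuousOn_const (c := y 0)))
  have hM0 : 0 ≤ M := (norm_nonneg _).trans (hM 0 ⟨le_rfl, hT⟩)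
  have hest : ∀ m, ∀ x ∈ Icc 0 T, ‖y x - Y m x‖ ≤ M * ((K * x) ^ m / m.factorial) := by
    intro m
    induction m with
    | zero => intro x hx; simpa [hY] using hM x hx
    | succ m ih =>
      intro x hx
      have hsub : uIcc 0 x ⊆ Icc 0 T := by rw [uIcc_of_le hx.1]; exact Icc_subset_Icc_right hx.2
      have e : y x - Y (m+1) x = ∑ i : Fin n, ∫ s in (0:ℝ)..x, b i s • (Ω i s) (y s - Y m s) := by
        rw [hy x hx, hYs, hΦ]
        simp only
        rw [add_sub_add_left_eq_sub, ← Finset.sum_sub_distrib]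
        refine Finset.sum_congr rfl fun i _ => ?_
        rw [← intervalIntegral.integral_sub (hb.iis i ((((hΩ i).contOn hb).clm_apply hyc).mono hsub))
          (hb.iis i ((((hΩ i).contOn hb).clm_apply ((hYc m).contOn hb)).mono hsub))]
        simp only [map_sub, smul_sub]
      rw [e]
      have hi : ∀ i : Fin n, ‖∫ s in (0:ℝ)..x, b i s • (Ω i s) (y s - Y m s)‖ ≤ ∫ s in (0:ℝ)..x, Cb i * CΩ i * (M * ((K * s) ^ m / m.factorial)) := by
        intro i
        refine intervalIntegral.norm_integral_le_of_norm_le hx.1 (Eventually.of_forall fun s hs => ?_) ((by fun_prop : Continuous _).intervalIntegrable _ _)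
        have hs' : s ∈ Icc 0 T := ⟨hs.1.le, hs.2.trans hx.2⟩
        rw [norm_smul, mul_assoc]
        refine mul_le_mul (hbC i s) (((Ω i s).le_opNorm _).trans ?_) (norm_nonneg _) (hCb i)
        exact mul_le_mul (hΩC i s hs') (ih s hs') (norm_nonneg _) (hCΩ i).le
      refine (norm_sum_le _ _).trans ((Finset.sum_le_sum fun i _ => hi i).trans (le_of_eq ?_))
      have e2 : (∫ s in (0:ℝ)..x, (M * ((K * s) ^ m / m.factorial))) = M * (K ^ m * (x ^ (m+1) / (m+1)) / m.factorial) := by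
        simp only [mul_pow, intervalIntegral.integral_const_mul, intervalIntegral.integral_div, integral_pow]
        simp
      simp only [intervalIntegral.integral_const_mul (Cb _ * CΩ _)]
      rw [← Finset.sum_mul, ← hK, e2, Nat.factorial_succ]
      push_cast
      have : (m.factorial : ℝ) ≠ 0 := by exact_mod_cast m.factorial_ne_zero
      field_simp
      ring
  have hyC : CC b T y := by
    refine CC.lim fun ε hε => ?_
    have ht : Tendsto (fun m : ℕ => M * ((K * T) ^ m / m.factorial)) atTop (𝓝 (M * 0)) := (FloorSemiring.tendsto_pow_div_factorial_atTop (K * T)).const_mul M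
    rw [mul_zero] at ht
    obtain ⟨m, hm⟩ := (ht.eventually (gt_mem_nhds hε)).exists
    refine ⟨Y m, hYc m, fun x hx => (hest m x hx).trans (le_trans ?_ hm.le)⟩
    have := hx.1; have := hx.2
    gcongr
  have h1 := (hΦc y hyC).end_zero hT huc
  have h2 := hy T ⟨hT, le_rfl⟩
  rw [h2]
  change y 0 + Φ y T = y 0
  rw [h1, add_zero]
end UC

namespace UC
open Set Filter Topology Metric Function Asymptotics
variable {b : ℕ → ℝ → ℂ} {T : ℝ}

lemma int_small (hb : Bd b) (i : ℕ) {F : Type} [NormedAddCommGroup F] [NormedSpace ℂ F] {f : ℝ → F} {x : ℝ} (hx : x ∈ Icc 0 T) 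
    (hf : ContinuousWithinAt f (Icc 0 T) x) :
    (fun x' => ∫ s in x..x', b i s • (f x - f s)) =o[𝓝[Icc 0 T] x] fun x' => x' - x := by
  obtain ⟨C, hC, hbC⟩ := hb.bdd i
  refine IsLittleO.of_bound fun c hc => ?_
  obtain ⟨δ, hδ, h⟩ := Metric.continuousWithinAt_iff.1 hf (c / (C + 1)) (by positivity)
  filter_upwards [self_mem_nhdsWithin, mem_nhdsWithin_of_mem_nhds (ball_mem_nhds x hδ)] with x' h1 h2
  refine intervalIntegral.norm_integral_le_of_norm_le_const fun s hs => ?_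
  have hs' : s ∈ uIcc x x' := uIoc_subset_uIcc hs
  have a1 : s ∈ Icc 0 T := (ordConnected_Icc.uIcc_subset hx h1) hs'
  have a2 : dist s x < δ := by
    rw [Real.dist_eq]
    rw [mem_ball, Real.dist_eq] at h2
    exact (abs_sub_left_of_mem_uIcc hs').trans_lt h2
  have := h a1 a2
  rw [dist_eq_norm, norm_sub_rev] at this
  rw [norm_smul]
  calc _ ≤ (C + 1) * (c / (C + 1)) := mul_le_mul ((hbC s).trans (by linarith)) this.le (norm_nonneg _) (by positivity)
    _ = c := by field_simp

theorem ode (hb : Bd b) (hT : 0 ≤ T) {n : ℕ} {A : ℝ → Fin n → ℂ} (hA : ∀ x i, A x i = ∫ s in (0:ℝ)..x, b i s)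
    {V0 V : Type} [NormedAddCommGroup V0] [NormedSpace ℂ V0] [NormedAddCommGroup V] [NormedSpace ℂ V] [CompleteSpace V]
    {ρ : (Fin n → ℂ) → (Fin n → ℂ) → V0 →L[ℂ] V0} {g : (Fin n → ℂ) → V0 →L[ℂ] V} {e : (Fin n → ℂ) → V →L[ℂ] V0}
    (hg : ∀ x ∈ Icc 0 T, TD ρ g (A x)) (he : ∀ x ∈ Icc 0 T, (e (A x)).comp (g (A x)) = 1)
    (hΩ : ∀ i, ContinuousOn (fun x => omg ρ g e i (A x)) (Icc 0 T))
    {w : ℝ → V0} (hw : ∀ x ∈ Icc 0 T, ∀ᶠ x' in 𝓝[Icc 0 T] x, w x' = ρ (A x') (A x) (w x)) :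
    ContinuousOn (fun x => g (A x) (w x)) (Icc 0 T) ∧ 
    ∀ x ∈ Icc 0 T, g (A x) (w x) = g (A 0) (w 0) + ∑ i : Fin n, ∫ s in (0:ℝ)..x, b i s • (omg ρ g e i (A s)) (g (A s) (w s)) := by
  set y : ℝ → V := fun x => g (A x) (w x) with hy
  have hAd : ∀ x x' i, A x' i - A x i = ∫ s in x..x', b i s := fun x x' i => by
    rw [hA, hA]; exact intervalIntegral.integral_interval_sub_left (hb.ii _ _ _) (hb.ii _ _ _)
  have hAO : ∀ x, (fun x' => A x' - A x) =O[𝓝[Icc 0 T] x] fun x' => x' - x := by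
    intro x
    rw [isBigO_pi]
    intro i
    obtain ⟨C, hC, hbC⟩ := hb.bdd i
    refine IsBigO.of_bound C (Eventually.of_forall fun x' => ?_)
    rw [Pi.sub_apply, hAd]
    exact intervalIntegral.norm_integral_le_of_norm_le_const fun s _ => hbC s
  have hAc : ∀ x, Tendsto A (𝓝[Icc 0 T] x) (𝓝 (A x)) := by
    intro x
    refine Tendsto.mono_left ?_ nhdsWithin_le_nhds
    rw [tendsto_pi_nhds]
    intro i
    simp only [hA]
    exact (intervalIntegral.continuous_primitive (hb.ii i) 0).tendsto x
  have key : ∀ x ∈ Icc 0 T, (fun x' => y x' - y x - ∑ i : Fin n, ∫ s in x..x', b i s • (omg ρ g e i (A x)) (y x)) =o[𝓝[Icc 0 T] x] fun x' => x' - x := by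
    intro x hx
    set G : (Fin n → ℂ) → V0 →L[ℂ] V := fun z => (g z).comp (ρ z (A x)) with hG
    have hGd : HasFDerivAt G (fderiv ℂ G (A x)) (A x) := (hg x hx).hasFDerivAt
    have hyG : ∀ᶠ x' in 𝓝[Icc 0 T] x, y x' = G (A x') (w x) := by
      filter_upwards [hw x hx] with x' h
      simp only [hy, hG, h]; rfl
    have hyx : y x = G (A x) (w x) := hyG.self_of_nhdsWithin hx
    have h1 : (fun z => G z (w x) - G (A x) (w x) - fderiv ℂ G (A x) (z - A x) (w x)) =o[𝓝 (A x)] fun z => z - A x := by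
      have := (hGd.clm_apply (hasFDerivAt_const (w x) (A x))).isLittleO
      simpa using this
    have h2 := (h1.comp_tendsto (hAc x)).trans_isBigO (hAO x)
    refine h2.congr' ?_ EventuallyEq.rfl
    filter_upwards [hyG] with x' hx'
    simp only [comp_apply]
    rw [hx', hyx]
    congr 1
    have e1 : A x' - A x = ∑ i, (A x' i - A x i) • (Pi.single i (1:ℂ) : Fin n → ℂ) := pi_eq_sum_univ' (A x' - A x)
    rw [e1, map_sum, sum_apply]
    refine Finset.sum_congr rfl fun i _ => ?_
    rw [map_smul, smul_apply, ← hyx, hAd, ← intervalIntegral.integral_smul_const]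
    congr 1; funext s; congr 1
    have e2 : e (A x) (y x) = w x := congrArg (fun L : V0 →L[ℂ] V0 => L (w x)) (he x hx)
    simp only [omg, ContinuousLinearMap.comp_apply, e2]
    rfl
  have hint : ∀ (c : V) (i : Fin n) x, (fun x' => ∫ s in x..x', b i s • c) =O[𝓝[Icc 0 T] x] fun x' => x' - x := by
    intro c i x
    obtain ⟨C, hC, hbC⟩ := hb.bdd i
    refine IsBigO.of_bound (C * ‖c‖) (Eventually.of_forall fun x' => ?_)
    exact intervalIntegral.norm_integral_le_of_norm_le_const fun s _ => by rw [norm_smul]; gcongr; exact hbC s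
  have hyc : ContinuousOn y (Icc 0 T) := by
    intro x hx
    have h1 : (fun x' => y x' - y x) =O[𝓝[Icc 0 T] x] fun x' => x' - x := by
      have := (key x hx).isBigO.add (IsBigO.sum (s := Finset.univ) fun i _ => hint (omg ρ g e i (A x) (y x)) i x)
      simpa using this
    have h2 : Tendsto (fun x' => x' - x) (𝓝[Icc 0 T] x) (𝓝 0) := by
      refine Tendsto.mono_left ?_ nhdsWithin_le_nhds
      have : Continuous fun x' : ℝ => x' - x := by fun_prop
      simpa using this.tendsto x
    have h3 := h1.trans_tendsto h2
    have := h3.add_const (y x)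
    simpa [ContinuousWithinAt] using this
  refine ⟨hyc, ?_⟩
  have hΩy : ∀ i : Fin n, ContinuousOn (fun x => omg ρ g e i (A x) (y x)) (Icc 0 T) := fun i => (hΩ i).clm_apply hyc
  set Z : ℝ → V := fun x => y x - ∑ i : Fin n, ∫ s in (0:ℝ)..x, b i s • (omg ρ g e i (A s)) (y s) with hZ
  have hZd : ∀ x ∈ Icc 0 T, HasDerivWithinAt Z 0 (Icc 0 T) x := by
    intro x hx
    rw [hasDerivWithinAt_iff_isLittleO]
    simp only [smul_zero, sub_zero]
    have := (key x hx).add (IsLittleO.sum (s := (Finset.univ : Finset (Fin n))) fun (i : Fin n) _ => int_small hb i hx (hΩy i x hx))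
    refine this.congr' ?_ EventuallyEq.rfl
    filter_upwards [self_mem_nhdsWithin] with x' hx'
    have sub : ∀ {p q}, p ∈ Icc 0 T → q ∈ Icc 0 T → uIcc p q ⊆ Icc 0 T := fun hp hq => ordConnected_Icc.uIcc_subset hp hq
    have hz : (0:ℝ) ∈ Icc 0 T := ⟨le_rfl, hT⟩
    have e1 : ∀ i : Fin n, (∫ s in x..x', b i s • ((omg ρ g e i (A x)) (y x) - (omg ρ g e i (A s)) (y s))) = 
      (∫ s in x..x', b i s • (omg ρ g e i (A x)) (y x)) - ((∫ s in (0:ℝ)..x', b i s • (omg ρ g e i (A s)) (y s)) - ∫ s in (0:ℝ)..x, b i s • (omg ρ g e i (A s)) (y s)) := by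
      intro i
      rw [intervalIntegral.integral_interval_sub_left (hb.iis i ((hΩy i).mono (sub hz hx'))) (hb.iis i ((hΩy i).mono (sub hz hx))),
        ← intervalIntegral.integral_sub (hb.iis i continuousOn_const) (hb.iis i ((hΩy i).mono (sub hx hx')))]
      simp only [smul_sub]
    simp only [Finset.sum_apply, e1, Finset.sum_sub_distrib, hZ]
    abel
  intro x hx
  have := constant_of_derivWithin_zero (f := Z) (a := 0) (b := T) (fun x hx => (hZd x hx).differentiableWithinAt) 
    (fun x hx => by
      have h' : 0 < T := hx.1.trans_lt hx.2
      exact (hZd x ⟨hx.1, hx.2.le⟩).derivWithin (uniqueDiffOn_Icc h' x ⟨hx.1, hx.2.le⟩)) x hx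
  simp only [hZ, intervalIntegral.integral_same, Finset.sum_const_zero, sub_zero] at this
  rw [sub_eq_iff_eq_add] at this
  exact this
end UC

namespace UC
open Set Filter Topology Metric Function Asymptotics BoundedContinuousFunction
variable {b : ℕ → ℝ → ℂ} {T : ℝ}

section rep
variable {G : Type} [Group G] [TopologicalSpace G] [DiscreteTopology G]

/-- right translation -/
def RT (h : G) : (G →ᵇ ℂ) →L[ℂ] (G →ᵇ ℂ) :=
  LinearMap.mkContinuous
    { toFun := fun f => f.compContinuous ⟨fun γ => γ * h, continuous_of_discreteTopology⟩
      map_add' := fun f g => by ext; rfl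
      map_smul' := fun c f => by ext; rfl } 1 fun f => by
    rw [one_mul]
    exact (BoundedContinuousFunction.norm_le (norm_nonneg _)).2 fun γ => f.norm_coe_le_norm _

lemma RT_apply (h : G) (f : G →ᵇ ℂ) (γ : G) : RT h f γ = f (γ * h) := rfl
lemma RT_one : RT (1 : G) = 1 := by ext f γ; simp [RT_apply]
lemma RT_mul (h k : G) : (RT h).comp (RT k) = RT (h * k) := by ext f γ; simp [RT_apply, mul_assoc]
end rep

theorem core (hb : Bd b) (hT : 0 ≤ T) (huc : ∀ l, l ≠ [] → itIntAux b l T = 0) {n : ℕ} {A : ℝ → Fin n → ℂ} (hA : ∀ x i, A x i = ∫ s in (0:ℝ)..x, b i s)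
    {U : Set (Fin n → ℂ)} (hU : IsOpen U) (hh : polyHull (A '' Icc 0 T) ⊆ U) {G : Type} [Group G] (t : (Fin n → ℂ) → (Fin n → ℂ) → G)
    (ht : ∀ x ∈ U, ∃ r > 0, ∀ z0 ∈ ball x r, t z0 z0 = 1 ∧ ∀ z1 ∈ ball x r, ∀ z2 ∈ ball x r, t z0 z1 * t z1 z2 = t z0 z2)
    (τ : ℝ → G) (hτ : ∀ x ∈ Icc 0 T, ∀ᶠ x' in 𝓝[Icc 0 T] x, τ x' = t (A x') (A x) * τ x) : τ T = τ 0 := by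
  letI : TopologicalSpace G := ⊥
  haveI : DiscreteTopology G := ⟨rfl⟩
  have h0T : (0:ℝ) ∈ Icc 0 T := ⟨le_rfl, hT⟩
  have hTT : T ∈ Icc 0 T := ⟨hT, le_rfl⟩
  have hAw : ∀ i : Fin n, (fun x => A x i) = itIntAux b [(i:ℕ)] := by
    intro i; funext x; rw [hA]; simp [itIntAux]
  have hAS : ∀ i, (fun x => A x i) ∈ SP b ℂ := fun i => by rw [hAw]; exact SP.word1 _
  have hAc : Continuous A := continuous_pi fun i => SP.cont hb (hAS i)
  have hAT : A T = A 0 := by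
    funext i
    have h1 : A T i = 0 := by
      have := congrFun (hAw i) T
      rw [this, huc _ (by simp)]
    rw [h1, hA]; simp
  obtain ⟨h, hh0, ps, hKU, hΓ⟩ := poly_choice (isCompact_Icc.image hAc) ⟨_, mem_image_of_mem A h0T⟩ hU hh
  have hAΓ : ∀ x ∈ Icc 0 T, A x ∈ KK ps (fun _ => -h) (fun _ => h) := by
    intro x hx
    have := hΓ _ (mem_image_of_mem A hx)
    refine ⟨mem_box_of_norm fun j => ?_, fun p hp => inR_of_norm ((this.2 p hp).trans (by norm_num))⟩
    have h1 := this.1 j.1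
    have := norm_nonneg (A x j.1)
    linarith
  set ρ : (Fin n → ℂ) → (Fin n → ℂ) → (G →ᵇ ℂ) →L[ℂ] (G →ᵇ ℂ) := fun z z' => RT (t z z') with hρ
  have hlt : ∀ z ∈ U, LocTriv ρ z := by
    intro z hz
    obtain ⟨r, hr, h⟩ := ht z hz
    refine ⟨r, hr, fun z0 h0 => ⟨?_, fun z1 h1 z2 h2 => ?_⟩⟩
    · simp only [hρ, (h z0 h0).1, RT_one]
    · simp only [hρ, RT_mul, (h z0 h0).2 z1 h1 z2 h2]
  obtain ⟨V, _, _, _, g, e, hge, hom⟩ := bundle (ρ := ρ) (lo := fun _ => -h) (hi := fun _ => h) (fun _ => by linarith : (fun _ => -h) ≤ fun _ => h) hU hKU hlt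
  have hΩ : ∀ i, CC b T (fun x => omg ρ g e i (A x)) := fun i =>
    approx hb _ n ps rfl (fun _ => h) A hAS (fun _ => hh0.le) (fun x hx j => (hΓ _ (mem_image_of_mem A hx)).1 j.1) 
      (fun x hx p hp => (hΓ _ (mem_image_of_mem A hx)).2 p hp) _ _ (hom i)
  set f0 : G →ᵇ ℂ := BoundedContinuousFunction.ofNormedAddCommGroup (({1} : Set G).indicator fun _ => (1:ℂ)) continuous_of_discreteTopology 1 (by
    intro x
    by_cases hx : x = 1 <;> simp [hx]) with hf0
  have hf0' : ∀ γ, f0 γ = 1 ↔ γ = 1 := by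
    intro γ
    by_cases hx : γ = 1 <;> simp [hf0, hx]
  set w : ℝ → (G →ᵇ ℂ) := fun x => RT (τ x) f0 with hw
  obtain ⟨hyc, hy⟩ := ode hb hT hA (fun x hx => (hge _ (hAΓ x hx)).1) (fun x hx => (hge _ (hAΓ x hx)).2) (fun i => (hΩ i).contOn hb) (w := w)
    (fun x hx => by
      filter_upwards [hτ x hx] with x' hx'
      simp only [hw, hρ, hx', ← RT_mul]
      rfl)
  have h1 := transport hb hT huc hΩ hyc hy
  rw [hAT] at h1
  have e2 : ∀ v, e (A 0) (g (A 0) v) = v := fun v => congrArg (fun L : (G →ᵇ ℂ) →L[ℂ] (G →ᵇ ℂ) => L v) (hge _ (hAΓ 0 h0T)).2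
  have h2 : w T = w 0 := by rw [← e2 (w T), h1, e2]
  have h3 : w T (τ T)⁻¹ = w 0 (τ T)⁻¹ := by rw [h2]
  simp only [hw, RT_apply, inv_mul_cancel] at h3
  have h4 := (hf0' _).1 (h3.symm.trans ((hf0' 1).2 rfl))
  exact inv_mul_eq_one.1 h4
end UC

namespace UC
open Set Filter Topology Metric Function CategoryTheory
open scoped unitInterval

section topo
variable {E : Type} [NormedAddCommGroup E] [NormedSpace ℝ E] {U : Set E}

lemma homotopic_of_convex {C : Set E} (hC : Convex ℝ C) (hCU : C ⊆ U) {x y : U} (p q : Path x y)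
    (hp : ∀ s, (p s : E) ∈ C) (hq : ∀ s, (q s : E) ∈ C) : p.Homotopic q := by
  have hmem : ∀ s : I × I, (1 - (s.1 : ℝ)) • (p s.2 : E) + (s.1 : ℝ) • (q s.2 : E) ∈ C := fun s =>
    hC (hp _) (hq _) (by linarith [s.1.2.2]) s.1.2.1 (by ring)
  refine ⟨{ toFun := fun s => ⟨(1 - (s.1 : ℝ)) • (p s.2 : E) + (s.1 : ℝ) • (q s.2 : E), hCU (hmem s)⟩
            continuous_toFun := by fun_prop
            map_zero_left := fun s => by simp
            map_one_left := fun s => by simp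
            prop' := ?_ }⟩
  intro t s hs
  apply Subtype.ext
  rcases hs with hs | hs
  · subst hs
    simp [← add_smul]
  · rw [mem_singleton_iff] at hs
    subst hs
    simp [← add_smul]

lemma seg_mem (x y : E) (s : I) : Path.segment x y s ∈ segment ℝ x y := by
  rw [← Path.range_segment]; exact mem_range_self s

/-- straight path in `U` -/
def segP {x y : U} (h : segment ℝ (x : E) y ⊆ U) : Path x y where
  toFun s := ⟨Path.segment (x : E) y s, h (by rw [← Path.range_segment]; exact mem_range_self _)⟩
  continuous_toFun := by fun_prop
  source' := by simp
  target' := by simp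

variable {x0 : U} (sc : ∀ z : U, FundamentalGroupoid.mk x0 ⟶ FundamentalGroupoid.mk z)

open Classical in
/-- class of the straight segment -/
def sg (z z' : U) : FundamentalGroupoid.mk z ⟶ FundamentalGroupoid.mk z' :=
  if h : segment ℝ (z : E) z' ⊆ U then Path.Homotopic.Quotient.mk (segP h) else inv (sc z) ≫ sc z'

lemma sg_eq {C : Set E} (hC : Convex ℝ C) (hCU : C ⊆ U) {x y : U} (p : Path x y)
    (hp : ∀ s, (p s : E) ∈ C) : sg sc x y = Path.Homotopic.Quotient.mk p := by
  have hs : segment ℝ (x : E) y ⊆ C := hC.segment_subset (by simpa using hp 0) (by simpa using hp 1)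
  rw [sg, dif_pos (hs.trans hCU)]
  refine Path.Homotopic.Quotient.eq.2 (homotopic_of_convex hC hCU _ _ (fun s => ?_) hp)
  exact hs (seg_mem _ _ s)

lemma sg_self {C : Set E} (hC : Convex ℝ C) (hCU : C ⊆ U) {x : U} (hx : (x : E) ∈ C) :
    sg sc x x = 𝟙 _ := by
  rw [sg_eq sc hC hCU (Path.refl x) (fun s => by simpa using hx)]
  rfl

lemma sg_comp {C : Set E} (hC : Convex ℝ C) (hCU : C ⊆ U) {x y z : U} (hx : (x : E) ∈ C) (hy : (y : E) ∈ C) (hz : (z : E) ∈ C) :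
    sg sc x y ≫ sg sc y z = sg sc x z := by
  have h1 := hC.segment_subset hx hy
  have h2 := hC.segment_subset hy hz
  have k1 : ∀ s, (segP (h1.trans hCU) s : E) ∈ C := fun s => h1 (seg_mem _ _ s)
  have k2 : ∀ s, (segP (h2.trans hCU) s : E) ∈ C := fun s => h2 (seg_mem _ _ s)
  rw [sg_eq sc hC hCU _ k1, sg_eq sc hC hCU _ k2, sg_eq sc hC hCU ((segP (h1.trans hCU)).trans (segP (h2.trans hCU))) ?_]
  · rfl
  · intro s
    rw [Path.trans_apply]
    split_ifs
    · exact k1 _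
    · exact k2 _

open Classical in
/-- transition cocycle in the fundamental group -/
def tr (z' z : E) : FundamentalGroup U x0 :=
  if h : z ∈ U ∧ z' ∈ U then sc ⟨z, h.1⟩ ≫ sg sc ⟨z, h.1⟩ ⟨z', h.2⟩ ≫ inv (sc ⟨z', h.2⟩) else 1

lemma tr_loc (hU : IsOpen U) : ∀ x ∈ U, ∃ r > 0, ∀ z0 ∈ ball x r, tr sc z0 z0 = 1 ∧
    ∀ z1 ∈ ball x r, ∀ z2 ∈ ball x r, tr sc z0 z1 * tr sc z1 z2 = tr sc z0 z2 := by
  intro x hx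
  obtain ⟨r, hr, hb⟩ := Metric.isOpen_iff.1 hU x hx
  have hC : Convex ℝ (ball x r) := convex_ball x r
  refine ⟨r, hr, fun z0 h0 => ⟨?_, fun z1 h1 z2 h2 => ?_⟩⟩
  · rw [tr, dif_pos ⟨hb h0, hb h0⟩, sg_self sc hC hb h0]
    simp
  · rw [tr, dif_pos ⟨hb h1, hb h0⟩, tr, dif_pos ⟨hb h2, hb h1⟩, tr, dif_pos ⟨hb h2, hb h0⟩,
      ← sg_comp sc hC hb (x := ⟨z2, hb h2⟩) (y := ⟨z1, hb h1⟩) (z := ⟨z0, hb h0⟩) h2 h1 h0, CategoryTheory.End.mul_def]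
    simp

/-- image of a real segment -/
def kap (A : C(ℝ, U)) (x x' : ℝ) : FundamentalGroupoid.mk (A x) ⟶ FundamentalGroupoid.mk (A x') :=
  Path.Homotopic.Quotient.mk ((Path.segment x x').map A.continuous)

lemma kap_comp (A : C(ℝ, U)) (x y z : ℝ) : kap A x y ≫ kap A y z = kap A x z := by
  have h := SimplyConnectedSpace.paths_homotopic ((Path.segment x y).trans (Path.segment y z)) (Path.segment x z)
  have h2 := Path.Homotopic.Quotient.eq.2 (h.map A)
  rw [Path.map_trans] at h2
  exact h2

lemma kap_self (A : C(ℝ, U)) (x : ℝ) : kap A x x = 𝟙 _ := by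
  rw [kap, Path.segment_same]; rfl

theorem topo (hU : IsOpen U) (hUc : IsConnected U) {T : ℝ} (A : C(ℝ, U)) (hAT : A T = A 0)
    (hcore : ∀ {G : Type} [Group G] (t : E → E → G)
      (_ : ∀ x ∈ U, ∃ r > 0, ∀ z0 ∈ ball x r, t z0 z0 = 1 ∧ ∀ z1 ∈ ball x r, ∀ z2 ∈ ball x r, t z0 z1 * t z1 z2 = t z0 z2)
      (τ : ℝ → G) (_ : ∀ x, ∀ᶠ x' in 𝓝 x, τ x' = t (A x') (A x) * τ x), τ T = τ 0) :
    (((Path.segment 0 T).map A.continuous).cast rfl hAT.symm).Homotopic (Path.refl (A 0)) := by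
  have hpc : IsPathConnected U := hU.isConnected_iff_isPathConnected.1 hUc
  have : PathConnectedSpace U := isPathConnected_iff_pathConnectedSpace.1 hpc
  let sc : ∀ z : U, FundamentalGroupoid.mk (A 0) ⟶ FundamentalGroupoid.mk z := fun z =>
    Path.Homotopic.Quotient.mk (PathConnectedSpace.somePath (A 0) z)
  have key := hcore (G := FundamentalGroup U (A 0)) (tr sc) (tr_loc sc hU)
    (fun x => kap A 0 x ≫ inv (sc (A x))) (by
      intro x
      obtain ⟨r, hr, hb⟩ := Metric.isOpen_iff.1 hU (A x) (A x).2
      have hc : Continuous fun y => (A y : E) := by fun_prop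
      obtain ⟨δ, hδ, hd⟩ := Metric.continuous_iff'.1 hc x r hr |> Metric.eventually_nhds_iff_ball.1
      filter_upwards [ball_mem_nhds x hδ] with x' hx'
      have hk : sg sc (A x) (A x') = kap A x x' := by
        refine sg_eq sc (convex_ball (A x : E) r) hb _ fun s => ?_
        refine hd _ ?_
        have : Path.segment x x' s ∈ segment ℝ x x' := by
          rw [← Path.range_segment]; exact mem_range_self s
        exact (convex_ball x δ).segment_subset (mem_ball_self hδ) hx' this
      have ht : tr sc (A x') (A x) = sc (A x) ≫ kap A x x' ≫ inv (sc (A x')) := by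
        rw [tr, dif_pos ⟨(A x).2, (A x').2⟩, ← hk]
      refine Eq.trans ?_ (CategoryTheory.End.mul_def _ _).symm
      rw [ht]
      rw [← kap_comp A 0 x x']
      simp)
  simp only [kap_self, Category.id_comp] at key
  have key2 : kap A 0 T = inv (sc (A 0)) ≫ sc (A T) := by
    rw [← key]; simp
  apply Path.Homotopic.Quotient.eq.1
  have gen : ∀ (z : U) (h : A 0 = z) (p : Path (A 0) z), (Path.Homotopic.Quotient.mk p : FundamentalGroupoid.mk (A 0) ⟶ FundamentalGroupoid.mk z) = inv (sc (A 0)) ≫ sc z →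
      Path.Homotopic.Quotient.mk (p.cast rfl h) = Path.Homotopic.Quotient.mk (Path.refl (A 0)) := by
    intro z h p hp
    subst h
    rw [IsIso.inv_hom_id] at hp
    exact hp
  exact gen _ hAT.symm _ key2
end topo
end UC

namespace UC
open Set Filter Topology Metric Function

/-- truncated and shifted sequence -/
def shf (T : ℝ) (a : ℕ → ℝ → ℂ) (j : ℕ) : ℝ → ℂ := (Icc 0 T).indicator (a (j + 1))

lemma shf_bd {T : ℝ} {a : ℕ → ℝ → ℂ} (ha : MemX T a) : Bd (shf T a) := by
  obtain ⟨hm, C, hC⟩ := ha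
  refine ⟨fun i => (hm _).indicator measurableSet_Icc, fun i => ⟨|C| ^ (i + 1), by positivity, fun x => ?_⟩⟩
  by_cases hx : x ∈ Icc 0 T
  · rw [shf, indicator_of_mem hx]
    refine (hC _ (by omega) x hx).trans ?_
    rw [← abs_pow]
    exact le_abs_self _
  · rw [shf, indicator_of_notMem hx]
    simp

lemma shf_int {T : ℝ} {a : ℕ → ℝ → ℂ} (l : List ℕ) : ∀ x ∈ Icc 0 T, itIntAux (shf T a) l x = itIntAux a (l.map (· + 1)) x := by
  induction l with
  | nil => intro x hx; rfl
  | cons i l ih =>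
    intro x hx
    simp only [itIntAux, List.map_cons]
    apply intervalIntegral.integral_congr
    intro s hs
    rw [uIcc_of_le hx.1] at hs
    have hs' : s ∈ Icc 0 T := ⟨hs.1, hs.2.trans hx.2⟩
    simp only [ih s hs', shf, indicator_of_mem hs']

lemma subset_hull {k : ℕ} (K : Set (Fin k → ℂ)) : K ⊆ polyHull K := fun z hz _ _ h => h z hz

theorem final (T : ℝ) (hT : 0 < T) (a : ℕ → ℝ → ℂ) (ha : MemX T a)
    (k : ℕ) (huc : IsUnivCenter T a) (U : Set (Fin k → ℂ)) (hU : IsOpen U) (hUc : IsConnected U)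
    (hh : polyHull (pathA T a k '' Set.Icc 0 T) ⊆ U) :
      pathA T a k 0 = 0 ∧ pathA T a k T = 0 ∧
      ∃ H : ℝ × ℝ → (Fin k → ℂ),
        ContinuousOn H (Set.Icc 0 1 ×ˢ Set.Icc 0 T) ∧
        (∀ p ∈ Set.Icc (0 : ℝ) 1 ×ˢ Set.Icc (0 : ℝ) T, H p ∈ U) ∧
        (∀ x ∈ Set.Icc (0 : ℝ) T, H (0, x) = pathA T a k x) ∧
        (∀ x ∈ Set.Icc (0 : ℝ) T, H (1, x) = 0) ∧
        (∀ s ∈ Set.Icc (0 : ℝ) 1, H (s, 0) = 0 ∧ H (s, T) = 0) := by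
  have hb := shf_bd ha
  have hTm : T ∈ Icc 0 T := ⟨hT.le, le_rfl⟩
  have huc' : ∀ l, l ≠ [] → itIntAux (shf T a) l T = 0 := by
    intro l hl
    rw [shf_int l T hTm]
    have := huc (l.map (· + 1)).reverse (by simpa using hl) (by simp)
    rwa [itInt, List.reverse_reverse] at this
  set A : ℝ → Fin k → ℂ := fun x i => ∫ s in (0:ℝ)..x, shf T a i s with hA
  have hAw : ∀ i : Fin k, (fun x => A x i) = itIntAux (shf T a) [(i:ℕ)] := by
    intro i; funext x; simp [hA, itIntAux]
  have hAc : Continuous A := continuous_pi fun i => SP.cont hb (by rw [hAw]; exact SP.word1 _ : (fun x => A x i) ∈ SP (shf T a) ℂ)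
  have hAp : ∀ x ∈ Icc 0 T, A x = pathA T a k x := by
    intro x hx
    funext i
    have h1 := shf_int (a := a) [(i:ℕ)] x hx
    simpa [itIntAux, hA, pathA] using h1
  have hA0 : A 0 = 0 := by funext i; simp [hA]
  have hAT : A T = 0 := by
    funext i
    exact (congrFun (hAw i) T).trans (huc' _ (by simp))
  have him : A '' Icc 0 T = pathA T a k '' Icc 0 T := image_congr hAp
  rw [← him] at hh
  refine ⟨by rw [← hAp 0 ⟨le_rfl, hT.le⟩, hA0], by rw [← hAp T hTm, hAT], ?_⟩
  have hAU : ∀ x ∈ Icc 0 T, A x ∈ U := fun x hx => hh (subset_hull _ (mem_image_of_mem A hx))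
  let B : C(ℝ, U) := ⟨fun x => ⟨A (projIcc 0 T hT.le x), hAU _ (projIcc 0 T hT.le x).2⟩, by fun_prop⟩
  have hBA : ∀ x ∈ Icc 0 T, (B x : Fin k → ℂ) = A x := by
    intro x hx
    simp only [B, ContinuousMap.coe_mk, projIcc_of_mem hT.le hx]
  have hB0 : (B 0 : Fin k → ℂ) = 0 := by rw [hBA 0 ⟨le_rfl, hT.le⟩, hA0]
  have hBT : B T = B 0 := Subtype.ext (by rw [hB0, hBA T hTm, hAT])
  obtain ⟨F⟩ := topo hU hUc (T := T) B hBT (by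
    intro G _ t ht τ hτ
    refine core hb hT.le huc' (fun x i => rfl) hU hh t ht τ ?_
    intro x hx
    filter_upwards [mem_nhdsWithin_of_mem_nhds (hτ x), self_mem_nhdsWithin] with x' h1 h2
    rwa [hBA x hx, hBA x' h2] at h1)
  refine ⟨fun p => (F (projIcc 0 1 zero_le_one p.1, projIcc 0 1 zero_le_one (p.2 / T)) : Fin k → ℂ), ?_, ?_, ?_, ?_, ?_⟩
  · have : Continuous fun p : ℝ × ℝ => (F (projIcc 0 1 zero_le_one p.1, projIcc 0 1 zero_le_one (p.2 / T)) : Fin k → ℂ) := by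
      have h1 : Continuous fun p : ℝ × ℝ => (projIcc (0:ℝ) 1 zero_le_one p.1, projIcc (0:ℝ) 1 zero_le_one (p.2 / T)) := by fun_prop
      exact continuous_subtype_val.comp (F.continuous.comp h1)
    exact this.continuousOn
  · intro p _
    exact (F _).2
  · intro x hx
    have hx' : x / T ∈ Icc (0:ℝ) 1 := ⟨div_nonneg hx.1 hT.le, (div_le_one hT).2 hx.2⟩
    simp only [projIcc_left, projIcc_of_mem zero_le_one hx']
    rw [show (⟨0, _⟩ : unitInterval) = 0 from rfl, F.apply_zero]
    have : AffineMap.lineMap (0:ℝ) T (x / T) = x := by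
      simp [AffineMap.lineMap_apply, hT.ne']
    simp [this, hBA x hx, hAp x hx]
  · intro x hx
    simp only [projIcc_right]
    rw [show (⟨1, _⟩ : unitInterval) = 1 from rfl, F.apply_one]
    simp [hB0]
  · intro s hs
    constructor
    · simp only [zero_div, projIcc_left]
      rw [show (⟨0, _⟩ : unitInterval) = 0 from rfl, F.source, hB0]
    · simp only [div_self hT.ne', projIcc_right]
      rw [show (⟨1, _⟩ : unitInterval) = 1 from rfl, F.target, hB0]
end UC

/-- if `a ∈ Xᵏ` is a universal center then for every open connected
`U ⊆ ℂᵏ` containing the polynomially convex hull of `Γ_k = A_k([0,T])`, the path `A_k` is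
a closed loop at `0` and is null-homotopic in `U` (through loops based at `0`). -/
theorem univCenter_nullhomotopic (T : ℝ) (hT : 0 < T) (a : ℕ → ℝ → ℂ) (ha : MemX T a)
    (k : ℕ) (hXk : ∀ j, k < j → a j = 0) (huc : IsUnivCenter T a) :
    ∀ U : Set (Fin k → ℂ), IsOpen U → IsConnected U →
      polyHull (pathA T a k '' Set.Icc 0 T) ⊆ U →
      pathA T a k 0 = 0 ∧ pathA T a k T = 0 ∧
      ∃ H : ℝ × ℝ → (Fin k → ℂ),
        ContinuousOn H (Set.Icc 0 1 ×ˢ Set.Icc 0 T) ∧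
        (∀ p ∈ Set.Icc (0 : ℝ) 1 ×ˢ Set.Icc (0 : ℝ) T, H p ∈ U) ∧
        (∀ x ∈ Set.Icc (0 : ℝ) T, H (0, x) = pathA T a k x) ∧
        (∀ x ∈ Set.Icc (0 : ℝ) T, H (1, x) = 0) ∧
        (∀ s ∈ Set.Icc (0 : ℝ) 1, H (s, 0) = 0 ∧ H (s, T) = 0) := by
  intro U hU hUc hh
  exact UC.final T hT a ha k huc U hU hUc hh
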